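/- arXiv:2604.02042 — 2 statements merged into one kernel-verified Lean document; each statement's English description precedes it below -/
import Mathlib

section
/- Let γ ∈ W^{1,1}_{i,r}(𝕋, ℝ^n). Then γ is convex if and only if for every w ∈ (0,1) the image of the map ρ_{γ,w}: 𝕋 → S^{n−1}, ρ_{γ,w}(u) = (γ(u+w) − γ(u))/|γ(u+w) − γ(u)|, is a great circle of S^{n−1} and ρ_{γ,w} admits a monotonic angle parametrization, i.e. the continuous lift θ: [0,1] → ℝ of u ↦ ∠(ρ_{γ,w}(0), ρ_{γ,w}(u)) is monotonic with θ(1) ∈ {2π, −2π}. -/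
open MeasureTheory Real Set intervalIntegral
open scoped ENNReal RealInnerProductSpace

noncomputable section

/-- A closed `W^{1,1}`-curve on the torus `𝕋 = ℝ/ℤ` with values in `ℝⁿ`, encoded as a
`1`-periodic absolutely continuous function `toFun : ℝ → ℝⁿ` together with its
(weak) derivative `deriv'`. -/
structure ClosedCurve (n : ℕ) where
  toFun : ℝ → EuclideanSpace ℝ (Fin n)
  deriv' : ℝ → EuclideanSpace ℝ (Fin n)
  periodic : Function.Periodic toFun 1
  deriv'_periodic : Function.Periodic deriv' 1
  integrableOn : MeasureTheory.IntegrableOn deriv' (Set.Icc (0:ℝ) 1)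
  eq_integral : ∀ t : ℝ, toFun t = toFun 0 + ∫ s in (0:ℝ)..t, deriv' s

namespace ClosedCurve

variable {n : ℕ}

/-- Injectivity as a map on the torus `ℝ/ℤ`. -/
def IsInj (γ : ClosedCurve n) : Prop :=
  ∀ s t : ℝ, γ.toFun s = γ.toFun t → ∃ k : ℤ, s - t = (k : ℝ)

/-- Regularity: the derivative does not vanish a.e. -/
def IsRegular (γ : ClosedCurve n) : Prop := ∀ᵐ t : ℝ ∂volume, γ.deriv' t ≠ 0

/-- Parametrization by arc length: `|γ'| = 1` a.e. -/
def IsArclength (γ : ClosedCurve n) : Prop := ∀ᵐ t : ℝ ∂volume, ‖γ.deriv' t‖ = 1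

/-- The length of a closed curve. -/
def length (γ : ClosedCurve n) : ℝ := ∫ t in (0:ℝ)..1, ‖γ.deriv' t‖

end ClosedCurve

/-- Orthogonal projection onto the orthogonal complement of `span {v}` (for `v ≠ 0`). -/
def projPerp {F : Type*} [NormedAddCommGroup F] [InnerProductSpace ℝ F] (v x : F) : F :=
  x - (⟪v, x⟫ / ‖v‖ ^ 2) • v

/-- The Gauss map `φ_γ(u,w)`: the unit secant direction. -/
def gaussMap {n : ℕ} (γ : ClosedCurve n) (u w : ℝ) : EuclideanSpace ℝ (Fin n) :=
  ‖γ.toFun (u + w) - γ.toFun u‖⁻¹ • (γ.toFun (u + w) - γ.toFun u)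

/-- `|∂_u φ_γ(u,w)|`, expressed via the identity (1.8) of the paper. -/
def gaussDerivU {n : ℕ} (γ : ClosedCurve n) (u w : ℝ) : ℝ :=
  ‖projPerp (gaussMap γ u w) (γ.deriv' (u + w) - γ.deriv' u)‖ /
    ‖γ.toFun (u + w) - γ.toFun u‖

/-- `|∂_w φ_γ(u,w)|`, expressed via the identity (1.7) of the paper. -/
def gaussDerivW {n : ℕ} (γ : ClosedCurve n) (u w : ℝ) : ℝ :=
  ‖projPerp (gaussMap γ u w) (γ.deriv' (u + w))‖ / ‖γ.toFun (u + w) - γ.toFun u‖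

/-- The generalized tangent-point energy `TP^{(p,q)}` (with values in `[0,∞]`). -/
def TP {n : ℕ} (p q : ℝ) (γ : ClosedCurve n) : ℝ≥0∞ :=
  ∫⁻ u in Set.Ioc (0:ℝ) 1, ∫⁻ w in Set.Ioc (0:ℝ) 1,
    ENNReal.ofReal
      (‖projPerp (γ.deriv' u) (γ.toFun (u + w) - γ.toFun u)‖ ^ q /
        ‖γ.toFun (u + w) - γ.toFun u‖ ^ p * (‖γ.deriv' u‖ * ‖γ.deriv' (u + w)‖))

/-- The minorant `G^{(p,q)}_w`. -/
def Gw {n : ℕ} (p q : ℝ) (γ : ClosedCurve n) (w : ℝ) : ℝ≥0∞ :=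
  ∫⁻ u in Set.Ioc (0:ℝ) 1,
    ENNReal.ofReal ((1/2 * gaussDerivU γ u w) ^ q *
      ‖γ.toFun (u + w) - γ.toFun u‖ ^ (2*q - p))

/-- The minorant `G^{(p,q)}`. -/
def G {n : ℕ} (p q : ℝ) (γ : ClosedCurve n) : ℝ≥0∞ :=
  ∫⁻ w in Set.Ioc (0:ℝ) 1, Gw p q γ w

/-- A round circle in a euclidean space: a sphere intersected with a 2-dimensional plane
through its center. -/
def IsCircle {F : Type*} [NormedAddCommGroup F] [InnerProductSpace ℝ F] (S : Set F) : Prop :=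
  ∃ (c : F) (r : ℝ) (V : Submodule ℝ F), 0 < r ∧ Module.finrank ℝ V = 2 ∧
    S = {x | ‖x - c‖ = r ∧ x - c ∈ V}

/-- A great circle of the unit sphere. -/
def IsGreatCircle {F : Type*} [NormedAddCommGroup F] [InnerProductSpace ℝ F]
    (S : Set F) : Prop :=
  ∃ V : Submodule ℝ F, Module.finrank ℝ V = 2 ∧ S = {x | ‖x‖ = 1 ∧ x ∈ V}

/-- Half of a great circle of the unit sphere: a great-circle arc of angular length `π`. -/
def IsHalfGreatCircle {F : Type*} [NormedAddCommGroup F] [InnerProductSpace ℝ F]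
    (S : Set F) : Prop :=
  ∃ a b : F, ‖a‖ = 1 ∧ ‖b‖ = 1 ∧ ⟪a, b⟫ = 0 ∧
    S = (fun t : ℝ => Real.cos t • a + Real.sin t • b) '' Set.Icc 0 π

/-- A curve is convex if its image is the boundary (within its affine hull) of a convex
planar (2-dimensional) set. -/
def ClosedCurve.IsConvex {n : ℕ} (γ : ClosedCurve n) : Prop :=
  ∃ K : Set (EuclideanSpace ℝ (Fin n)), Convex ℝ K ∧
    Module.finrank ℝ (affineSpan ℝ K).direction = 2 ∧
    Set.range γ.toFun = intrinsicFrontier ℝ K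

theorem exists_add_half_eq_of_periodic {f : ℝ → ℝ} (hf : Continuous f)
    (hp : Function.Periodic f 1) : ∃ s, f (s + 1 / 2) = f s := by
  have h1 : f (1 / 2 + 1 / 2) = f 0 := by
    have := hp 0
    norm_num at this ⊢
    exact this
  have hg : Continuous fun s => f (s + 1 / 2) - f s := by fun_prop
  have key : (0 : ℝ) ∈ uIcc ((fun s => f (s + 1 / 2) - f s) 0)
      ((fun s => f (s + 1 / 2) - f s) (1 / 2)) := by
    simp only [h1, zero_add, mem_uIcc, sub_nonpos, sub_nonneg]
    rcases le_total (f (1 / 2)) (f 0) with h | h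
    · exact Or.inl ⟨h, h⟩
    · exact Or.inr ⟨h, h⟩
  obtain ⟨s, -, hs⟩ := intermediate_value_uIcc hg.continuousOn key
  exact ⟨s, sub_eq_zero.1 hs⟩

theorem half_ne_intCast (k : ℤ) : (1 / 2 : ℝ) ≠ k := by
  intro h
  have h2 : (1 : ℝ) = ((2 * k : ℤ) : ℝ) := by push_cast; linarith
  have h3 : (1 : ℤ) = 2 * k := by exact_mod_cast h2
  omega

theorem exists_continuous_angle {c : ℝ → ℂ} (hc : Continuous c) (h0 : ∀ u, c u ≠ 0) :
    ∃ β : ℝ → ℝ, Continuous β ∧ ∀ u, c u = ‖c u‖ * Complex.exp (β u * Complex.I) := by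
  have he : Complex.exp (Complex.log (c 0)) = (⟨c, hc⟩ : C(ℝ, ℂ)) 0 := Complex.exp_log (h0 0)
  obtain ⟨F, ⟨-, hF⟩, -⟩ := Complex.isCoveringMapOn_exp.existsUnique_continuousMap_lifts
    (⟨c, hc⟩ : C(ℝ, ℂ)) he (fun a => h0 a)
  refine ⟨fun u => (F u).im, by fun_prop, fun u => ?_⟩
  have hu : Complex.exp (F u) = c u := congrFun hF u
  rw [← hu, Complex.norm_exp, Complex.ofReal_exp, ← Complex.exp_add, Complex.re_add_im]

theorem eq_of_mem_frontier_of_same_ray {K : Set ℂ} (hK : Convex ℝ K) {z p q : ℂ}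
    (hz : z ∈ interior K) (hp : p ∈ frontier K) (hq : q ∈ frontier K) {r : ℝ} (hr : 0 < r)
    (h : q - z = r * (p - z)) : q = p := by
  have main : ∀ {p q : ℂ} {r : ℝ}, p ∈ frontier K → q ∈ frontier K → 0 < r →
      q - z = r * (p - z) → 1 ≤ r := by
    intro p q r hp hq hr h
    by_contra! hlt
    refine hq.2 (hK.openSegment_interior_closure_subset_interior hz hp.1 ?_)
    refine ⟨1 - r, r, by linarith, hr, by ring, ?_⟩
    simp only [Complex.real_smul]
    push_cast
    linear_combination -h
  have h1 : 1 ≤ r := main hp hq hr h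
  have hr0 : (r : ℂ) ≠ 0 := by exact_mod_cast hr.ne'
  have h2 : 1 ≤ r⁻¹ := main hq hp (inv_pos.2 hr) (by
    rw [h]; push_cast; field_simp)
  have h3 : r = 1 := le_antisymm ((one_le_inv₀ hr).1 h2) h1
  rw [h3] at h
  push_cast at h
  linear_combination h

theorem exists_pos_eq_mul_of_arg_eq {a b : ℂ} (ha : a ≠ 0) (hb : b ≠ 0)
    (h : a.arg = b.arg) : ∃ r : ℝ, 0 < r ∧ b = r * a := by
  rw [Complex.arg_eq_arg_iff ha hb] at h
  exact ⟨‖b‖ / ‖a‖, by positivity, by push_cast; exact h.symm⟩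

theorem range_eq_frontier_convexHull {c : ℝ → ℂ} (hc : Continuous c)
    (hp : Function.Periodic c 1) (hinj : ∀ s t, c s = c t → ∃ k : ℤ, s - t = k)
    (hne : (interior (convexHull ℝ (range c))).Nonempty)
    (hsupp : ∀ u, ∃ m : ℂ, m ≠ 0 ∧ ∀ x, 0 ≤ ⟪m, c x - c u⟫) :
    range c = frontier (convexHull ℝ (range c)) := by
  have hsub : range c ⊆ frontier (convexHull ℝ (range c)) := by
    rintro _ ⟨u, rfl⟩
    refine ⟨subset_closure (subset_convexHull ℝ _ (mem_range_self u)), fun hint => ?_⟩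
    obtain ⟨m, hm, hmx⟩ := hsupp u
    have hall : ∀ z ∈ convexHull ℝ (range c), 0 ≤ ⟪m, z - c u⟫ := by
      intro z hz
      have hconv : Convex ℝ {z : ℂ | ⟪m, c u⟫ ≤ ⟪m, z⟫} :=
        convex_halfSpace_ge ⟨fun x y => inner_add_right _ _ _,
          fun a x => by rw [real_inner_smul_right, smul_eq_mul]⟩ _
      have := convexHull_min (t := {z : ℂ | ⟪m, c u⟫ ≤ ⟪m, z⟫}) (by
        rintro _ ⟨x, rfl⟩
        have := hmx x
        rw [inner_sub_right] at this
        change ⟪m, c u⟫ ≤ ⟪m, c x⟫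
        linarith) hconv hz
      rw [inner_sub_right]
      simpa using this
    have ht : Filter.Tendsto (fun e : ℝ => c u - (e : ℂ) * m) (nhdsWithin 0 (Ioi 0))
        (nhds (c u)) := by
      have : Continuous fun e : ℝ => c u - (e : ℂ) * m := by fun_prop
      have h := this.tendsto 0
      simp only [Complex.ofReal_zero, zero_mul, sub_zero] at h
      exact h.mono_left nhdsWithin_le_nhds
    obtain ⟨e, he, he0⟩ := ((ht.eventually (mem_interior_iff_mem_nhds.1 hint)).and
      self_mem_nhdsWithin).exists
    have h1 := hall _ he
    have h2 : c u - (e : ℂ) * m - c u = (-e) • m := by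
      rw [Complex.real_smul]; push_cast; ring
    rw [h2, inner_smul_right, real_inner_self_eq_norm_sq] at h1
    have : 0 < ‖m‖ ^ 2 := by positivity
    have he0' : 0 < e := he0
    nlinarith
  refine hsub.antisymm fun p hpf => ?_
  by_contra hpn
  obtain ⟨z, hz⟩ := hne
  have hK := convex_convexHull ℝ (range c)
  have hpz : p - z ≠ 0 := by
    intro h
    rw [sub_eq_zero] at h
    exact hpf.2 (h ▸ hz)
  have hcz : ∀ u, c u - z ≠ 0 := by
    intro u h
    rw [sub_eq_zero] at h
    exact (hsub (mem_range_self u)).2 (h ▸ hz)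
  have hslit : ∀ u, -((c u - z) / (p - z)) ∈ Complex.slitPlane := by
    intro u
    rw [Complex.mem_slitPlane_iff]
    by_contra! hcon
    set q := (c u - z) / (p - z) with hq
    have hqr : q = (q.re : ℂ) := Complex.ext rfl (by simpa using hcon.2)
    have hq0 : q ≠ 0 := div_ne_zero (hcz u) hpz
    have hre : 0 < q.re := by
      refine lt_of_le_of_ne (by simpa using hcon.1) fun h => hq0 ?_
      rw [hqr, ← h]; rfl
    refine hpn ⟨u, eq_of_mem_frontier_of_same_ray hK hz hpf (hsub (mem_range_self u)) hre ?_⟩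
    rw [← hqr, hq]; field_simp
  have hF : Continuous fun u => Complex.arg (-((c u - z) / (p - z))) := by
    rw [continuous_iff_continuousAt]
    intro u
    exact (Complex.continuousAt_arg (hslit u)).comp
      (f := fun u => -((c u - z) / (p - z))) (by fun_prop)
  obtain ⟨s, hs⟩ := exists_add_half_eq_of_periodic hF (fun u => by simp only [hp u])
  obtain ⟨r, hr, hrr⟩ := exists_pos_eq_mul_of_arg_eq
    (Complex.slitPlane_ne_zero (hslit _)) (Complex.slitPlane_ne_zero (hslit _)) hs
  have : c s = c (s + 1 / 2) := by
    refine eq_of_mem_frontier_of_same_ray hK hz (hsub (mem_range_self _))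
      (hsub (mem_range_self _)) hr ?_
    generalize c (s + 1 / 2) = y at hrr ⊢
    field_simp at hrr
    linear_combination -hrr
  obtain ⟨k, hk⟩ := hinj _ _ this.symm
  exact half_ne_intCast k (by rw [← hk]; ring)

/-- The determinant of two plane vectors. -/
def planarCross (a b : ℂ) : ℝ := a.re * b.im - a.im * b.re

theorem planarCross_polar (r s α β : ℝ) :
    planarCross (r * Complex.exp (α * Complex.I)) (s * Complex.exp (β * Complex.I)) =
      r * s * Real.sin (β - α) := by
  simp only [planarCross, Complex.re_ofReal_mul, Complex.im_ofReal_mul,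
    Complex.exp_ofReal_mul_I_re, Complex.exp_ofReal_mul_I_im, Real.sin_sub]
  ring

/-- A closed curve on the boundary of a planar convex set, winding once counterclockwise around
the interior point `0` of this set, with polar angle `β`. -/
structure IsPolarBoundary (K : Set ℂ) (c : ℝ → ℂ) (β : ℝ → ℝ) : Prop where
  convex : Convex ℝ K
  zero_mem : 0 ∈ interior K
  continuous : Continuous c
  periodic : Function.Periodic c 1
  mem_frontier : ∀ u, c u ∈ frontier K
  polar : ∀ u, c u = ‖c u‖ * Complex.exp (β u * Complex.I)
  continuous_angle : Continuous β
  strictMono_angle : StrictMono β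
  angle_add_one : ∀ u, β (u + 1) = β u + 2 * π

namespace IsPolarBoundary

variable {K : Set ℂ} {c : ℝ → ℂ} {β : ℝ → ℝ}

theorem ne_zero (h : IsPolarBoundary K c β) (u : ℝ) : c u ≠ 0 := fun h0 =>
  (h.mem_frontier u).2 (h0 ▸ h.zero_mem)

theorem norm_pos (h : IsPolarBoundary K c β) (u : ℝ) : 0 < ‖c u‖ := norm_pos_iff.2 (h.ne_zero u)

theorem planarCross_eq (h : IsPolarBoundary K c β) (u v : ℝ) :
    planarCross (c u) (c v) = ‖c u‖ * ‖c v‖ * Real.sin (β v - β u) := by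
  conv_lhs => rw [h.polar u, h.polar v]
  exact planarCross_polar _ _ _ _

theorem ne_of_pos_of_lt_one (h : IsPolarBoundary K c β) (u : ℝ) {w : ℝ} (hw : 0 < w)
    (hw1 : w < 1) : c (u + w) ≠ c u := by
  intro he
  have h1 : β u < β (u + w) := h.strictMono_angle (by linarith)
  have h2 : β (u + w) < β u + 2 * π := by
    rw [← h.angle_add_one]
    exact h.strictMono_angle (by linarith)
  have h3 : Complex.exp (β (u + w) * Complex.I) = Complex.exp (β u * Complex.I) := by
    have hp1 := h.polar (u + w)
    have hp0 := h.polar u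
    rw [he] at hp1
    have h4 := hp1.symm.trans hp0
    exact mul_left_cancel₀ (by exact_mod_cast (h.norm_pos u).ne') h4
  obtain ⟨k, hk⟩ := Complex.exp_eq_exp_iff_exists_int.1 h3
  have hk' := congrArg Complex.im hk
  simp at hk'
  have hpi := Real.pi_pos
  have hk0 : (0 : ℝ) < k := by
    by_contra! hc
    nlinarith
  have hk1 : (k : ℝ) < 1 := by
    by_contra! hc
    nlinarith
  have a1 : 0 < k := by exact_mod_cast hk0
  have a2 : k < 1 := by exact_mod_cast hk1
  omega

theorem triangle_nonneg_of_neg (h : IsPolarBoundary K c β) {s t x : ℝ} (hst : s < t) (htx : t < x)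
    (hxs : x < s + 1) (hneg : planarCross (c x) (c s) < 0) :
    0 ≤ planarCross (c s) (c t) + planarCross (c t) (c x) + planarCross (c x) (c s) := by
  have b1 := h.strictMono_angle hst
  have b2 := h.strictMono_angle htx
  have b3 : β x < β s + 2 * π := by
    rw [← h.angle_add_one]
    exact h.strictMono_angle hxs
  have hsin : 0 < Real.sin (β x - β s) := by
    rw [h.planarCross_eq, ← neg_sub, Real.sin_neg] at hneg
    have := mul_pos (h.norm_pos x) (h.norm_pos s)
    by_contra! hc
    nlinarith
  have hlt : β x - β s < π := by
    by_contra! hc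
    have := Real.sin_nonneg_of_nonneg_of_le_pi (x := β x - β s - π) (by linarith) (by linarith)
    rw [Real.sin_sub_pi] at this
    linarith
  have hX : 0 < planarCross (c s) (c t) := by
    rw [h.planarCross_eq]
    have := Real.sin_pos_of_pos_of_lt_pi (x := β t - β s) (by linarith) (by linarith)
    have := h.norm_pos s
    have := h.norm_pos t
    positivity
  have hY : 0 < planarCross (c t) (c x) := by
    rw [h.planarCross_eq]
    have := Real.sin_pos_of_pos_of_lt_pi (x := β x - β t) (by linarith) (by linarith)
    have := h.norm_pos t
    have := h.norm_pos x
    positivity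
  by_contra! hlt0
  set X := planarCross (c s) (c t) with hXd
  set Y := planarCross (c t) (c x) with hYd
  set Z := planarCross (c x) (c s) with hZd
  have hXY : X + Y ≠ 0 := by positivity
  have hp : (Y / (X + Y)) • c s + (X / (X + Y)) • c x ∈ closure K :=
    h.convex.closure (h.mem_frontier s).1 (h.mem_frontier x).1 (by positivity) (by positivity)
      (by field_simp; ring)
  have hZ : 0 < -Z := by linarith
  refine (h.mem_frontier t).2
    (h.convex.openSegment_interior_closure_subset_interior h.zero_mem hp ?_)
  refine ⟨1 - (X + Y) / (-Z), (X + Y) / (-Z), ?_, by positivity, by ring, ?_⟩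
  · rw [sub_pos, div_lt_one hZ]
    linarith
  · have e1 : (-Z) • c t = Y • c s + X • c x := by
      apply Complex.ext <;> simp [hXd, hYd, hZd, planarCross] <;> ring
    have e2 : c t = (-Z)⁻¹ • (Y • c s + X • c x) := by
      rw [← e1, smul_smul, inv_mul_cancel₀ hZ.ne', one_smul]
    rw [e2, smul_zero, zero_add, smul_add, smul_add, smul_smul, smul_smul, smul_smul, smul_smul]
    congr 2
    · field_simp
    · field_simp

theorem triangle_nonneg (h : IsPolarBoundary K c β) {s t x : ℝ} (hst : s ≤ t) (htx : t ≤ x)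
    (hxs : x ≤ s + 1) :
    0 ≤ planarCross (c s) (c t) + planarCross (c t) (c x) + planarCross (c x) (c s) := by
  rcases hst.eq_or_lt with rfl | hst
  · apply le_of_eq; simp only [planarCross]; ring
  rcases htx.eq_or_lt with rfl | htx
  · apply le_of_eq; simp only [planarCross]; ring
  rcases hxs.eq_or_lt with rfl | hxs
  · apply le_of_eq; simp only [planarCross, h.periodic s]; ring
  rcases lt_or_ge (planarCross (c x) (c s)) 0 with h1 | h1
  · exact h.triangle_nonneg_of_neg hst htx hxs h1
  rcases lt_or_ge (planarCross (c s) (c t)) 0 with h2 | h2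
  · have := h.triangle_nonneg_of_neg htx hxs (add_lt_add_left hst 1)
      (by rwa [h.periodic s])
    rw [h.periodic s] at this
    linarith
  rcases lt_or_ge (planarCross (c t) (c x)) 0 with h3 | h3
  · have := h.triangle_nonneg_of_neg hxs (add_lt_add_left hst 1) (add_lt_add_left htx 1)
      (by rwa [h.periodic t])
    rw [h.periodic s, h.periodic t] at this
    linarith
  linarith

theorem planarCross_chord_nonneg (h : IsPolarBoundary K c β) {u w e : ℝ} (he : 0 ≤ e)
    (hew : e ≤ w) (hew1 : e ≤ 1 - w) :
    0 ≤ planarCross (c (u + w) - c u) (c (u + e + w) - c (u + e)) := by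
  have h1 := h.triangle_nonneg (s := u) (t := u + w) (x := u + e + w)
    (by linarith) (by linarith) (by linarith)
  have h2 := h.triangle_nonneg (s := u) (t := u + e) (x := u + w)
    (by linarith) (by linarith) (by linarith)
  have h3 : planarCross (c (u + w) - c u) (c (u + e + w) - c (u + e)) =
      (planarCross (c u) (c (u + w)) + planarCross (c (u + w)) (c (u + e + w)) +
        planarCross (c (u + e + w)) (c u)) +
      (planarCross (c u) (c (u + e)) + planarCross (c (u + e)) (c (u + w)) +
        planarCross (c (u + w)) (c u)) := by
    simp only [planarCross, Complex.sub_re, Complex.sub_im]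
    ring
  rw [h3]
  linarith

theorem neg_chord_div_mem_slitPlane (h : IsPolarBoundary K c β) (u : ℝ) {w : ℝ} (hw : 0 < w)
    (hw1 : w < 1) : -((c (u + w) - c u) / c u) ∈ Complex.slitPlane := by
  rw [Complex.mem_slitPlane_iff]
  by_contra! hcon
  set q := (c (u + w) - c u) / c u with hq
  have hu := h.ne_zero u
  have hqr : q = (q.re : ℂ) := Complex.ext rfl (by simpa using hcon.2)
  have hre : 0 ≤ q.re := by simpa using hcon.1
  refine h.ne_of_pos_of_lt_one u hw hw1 (eq_of_mem_frontier_of_same_ray h.convex h.zero_mem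
    (h.mem_frontier u) (h.mem_frontier (u + w)) (r := 1 + q.re) (by linarith) ?_)
  push_cast
  rw [← hqr, hq]
  field_simp
  ring

end IsPolarBoundary

theorem monotone_of_sin_nonneg {θ : ℝ → ℝ} (hθ : Continuous θ) {d : ℝ} (hd : 0 < d)
    (hs : ∀ u e, 0 ≤ e → e ≤ d → 0 ≤ Real.sin (θ (u + e) - θ u)) : Monotone θ := by
  have hloc : ∀ u e, 0 ≤ e → e ≤ d → θ u ≤ θ (u + e) := by
    intro u e he hed
    by_contra! hlt
    have hg : ContinuousOn (fun x => θ (u + x) - θ u) (Icc 0 e) := by fun_prop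
    have hm : max ((θ (u + e) - θ u) / 2) (-(π / 2)) ∈
        Icc ((fun x => θ (u + x) - θ u) e) ((fun x => θ (u + x) - θ u) 0) := by
      constructor
      · exact le_trans (by simp only; linarith) (le_max_left _ _)
      · simp only [add_zero, sub_self]
        exact max_le (by linarith) (by linarith [Real.pi_pos])
    obtain ⟨x, hx, hxe⟩ := intermediate_value_Icc' he hg hm
    have h1 := hs u x hx.1 (hx.2.trans hed)
    simp only at hxe
    rw [hxe] at h1
    have h2 : max ((θ (u + e) - θ u) / 2) (-(π / 2)) < 0 :=
      max_lt (by linarith) (by linarith [Real.pi_pos])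
    have h3 : -π < max ((θ (u + e) - θ u) / 2) (-(π / 2)) :=
      lt_of_lt_of_le (by linarith [Real.pi_pos]) (le_max_right _ _)
    linarith [Real.sin_neg_of_neg_of_neg_pi_lt h2 h3]
  intro u v huv
  obtain ⟨N, hN⟩ := exists_nat_gt ((v - u) / d)
  have hN0 : (0 : ℝ) < N := lt_of_le_of_lt (div_nonneg (by linarith) hd.le) hN
  set e := (v - u) / N with he
  have he0 : 0 ≤ e := div_nonneg (by linarith) hN0.le
  have hed : e ≤ d := by
    rw [he, div_le_iff₀ hN0]
    rw [div_lt_iff₀ hd] at hN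
    linarith
  have hk : ∀ k : ℕ, θ u ≤ θ (u + k * e) := by
    intro k
    induction k with
    | zero => simp
    | succ k ih =>
      refine ih.trans ((hloc _ e he0 hed).trans (le_of_eq ?_))
      congr 1
      push_cast
      ring
  have := hk N
  rwa [he, mul_div_cancel₀ _ hN0.ne', add_sub_cancel] at this

theorem IsPolarBoundary.exists_monotone_chord_angle {K : Set ℂ} {c : ℝ → ℂ} {β : ℝ → ℝ}
    (h : IsPolarBoundary K c β) {w : ℝ} (hw : 0 < w) (hw1 : w < 1) :
    ∃ θ : ℝ → ℝ, Continuous θ ∧ Monotone θ ∧ (∀ u, θ (u + 1) = θ u + 2 * π) ∧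
      ∀ u, c (u + w) - c u = ‖c (u + w) - c u‖ * Complex.exp (θ u * Complex.I) := by
  have hslit := fun u => h.neg_chord_div_mem_slitPlane u hw hw1
  have hc := h.continuous
  have hβ := h.continuous_angle
  have hcont : Continuous fun u => Complex.arg (-((c (u + w) - c u) / c u)) := by
    rw [continuous_iff_continuousAt]
    intro u
    have hne := h.ne_zero u
    exact (Complex.continuousAt_arg (hslit u)).comp
      (f := fun u => -((c (u + w) - c u) / c u))
      ((((hc.comp (continuous_add_const w)).sub hc).continuousAt.div hc.continuousAt hne).neg)
  set θ : ℝ → ℝ := fun u => β u + π + Complex.arg (-((c (u + w) - c u) / c u)) with hθ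
  have hθc : Continuous θ := by rw [hθ]; fun_prop
  have hper : ∀ u, θ (u + 1) = θ u + 2 * π := by
    intro u
    have e1 : c (u + 1 + w) = c (u + w) := by
      rw [add_right_comm]; exact h.periodic _
    simp only [hθ, e1, h.periodic u, h.angle_add_one]
    ring
  have hpolar : ∀ u, c (u + w) - c u = ‖c (u + w) - c u‖ * Complex.exp (θ u * Complex.I) := by
    intro u
    have hu := h.ne_zero u
    have hu' : (‖c u‖ : ℂ) ≠ 0 := by exact_mod_cast (h.norm_pos u).ne'
    have h1 := Complex.norm_mul_exp_arg_mul_I (-((c (u + w) - c u) / c u))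
    have h2 : Complex.exp (θ u * Complex.I) = Complex.exp (β u * Complex.I) * (-1) *
        Complex.exp (Complex.arg (-((c (u + w) - c u) / c u)) * Complex.I) := by
      rw [← Complex.exp_pi_mul_I, ← Complex.exp_add, ← Complex.exp_add]
      congr 1
      simp only [hθ]
      push_cast
      ring
    have h3 : c (u + w) - c u = -(c u * (-((c (u + w) - c u) / c u))) := by
      field_simp
    rw [h2]
    conv_lhs => rw [h3, ← h1, norm_neg, norm_div]
    conv_lhs => enter [1, 1]; rw [h.polar u]
    push_cast
    field_simp
  refine ⟨θ, hθc, monotone_of_sin_nonneg hθc (d := min w (1 - w))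
    (lt_min hw (by linarith)) ?_, hper, hpolar⟩
  intro u e he hed
  have h1 := h.planarCross_chord_nonneg (u := u) he (hed.trans (min_le_left _ _))
    (hed.trans (min_le_right _ _))
  rw [hpolar u, hpolar (u + e), planarCross_polar] at h1
  have n1 : 0 < ‖c (u + w) - c u‖ :=
    norm_pos_iff.2 (sub_ne_zero.2 (h.ne_of_pos_of_lt_one u hw hw1))
  have n2 : 0 < ‖c (u + e + w) - c (u + e)‖ :=
    norm_pos_iff.2 (sub_ne_zero.2 (h.ne_of_pos_of_lt_one (u + e) hw hw1))
  exact nonneg_of_mul_nonneg_right h1 (mul_pos n1 n2)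

theorem exists_isPolarBoundary_or_conj {K : Set ℂ} {c : ℝ → ℂ} (hK : Convex ℝ K)
    (h0 : 0 ∈ interior K) (hc : Continuous c) (hp : Function.Periodic c 1)
    (hinj : ∀ s t, c s = c t → ∃ k : ℤ, s - t = k) (hf : ∀ u, c u ∈ frontier K) :
    (∃ β, IsPolarBoundary K c β) ∨
      ∃ β, IsPolarBoundary (Complex.conjCLE ⁻¹' K) (fun u => Complex.conjCLE (c u)) β := by
  have hne : ∀ u, c u ≠ 0 := fun u hu => (hf u).2 (hu ▸ h0)
  have hn : ∀ u, (0 : ℝ) < ‖c u‖ := fun u => norm_pos_iff.2 (hne u)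
  obtain ⟨β, hβ, hpol⟩ := exists_continuous_angle hc hne
  have hpi := Real.pi_pos
  have hray : ∀ u v (k : ℤ), β u = β v + k * (2 * π) → c u = c v := by
    intro u v k hk
    refine eq_of_mem_frontier_of_same_ray hK h0 (hf v) (hf u)
      (div_pos (hn u) (hn v)) ?_
    have he : Complex.exp (β u * Complex.I) = Complex.exp (β v * Complex.I) := by
      rw [Complex.exp_eq_exp_iff_exists_int]
      refine ⟨k, ?_⟩
      rw [hk]
      push_cast
      ring
    have hv0 : (‖c v‖ : ℂ) ≠ 0 := by exact_mod_cast (hn v).ne'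
    rw [sub_zero, sub_zero]
    conv_lhs => rw [hpol u, he]
    conv_rhs => rw [hpol v]
    push_cast
    rw [norm_mul, Complex.norm_exp_ofReal_mul_I]
    simp only [Complex.norm_real, norm_norm, mul_one]
    field_simp
  have hturn : ∀ u, ∃ k : ℤ, β (u + 1) = β u + k * (2 * π) := by
    intro u
    have h1 := hpol (u + 1)
    rw [hp u] at h1
    have h2 := mul_left_cancel₀ (by exact_mod_cast (hn u).ne') (h1.symm.trans (hpol u))
    obtain ⟨k, hk⟩ := Complex.exp_eq_exp_iff_exists_int.1 h2
    refine ⟨k, ?_⟩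
    have := congrArg Complex.im hk
    simpa using this
  choose k hk using hturn
  have hkc : ∀ u, k u = k 0 := by
    have hcont : Continuous fun u => ((k u : ℤ) : ℝ) := by
      have : (fun u => ((k u : ℤ) : ℝ)) = fun u => (β (u + 1) - β u) / (2 * π) := by
        funext u
        rw [hk u]
        field_simp
        ring
      rw [this]
      fun_prop
    have hcont' : Continuous k := Int.isClosedEmbedding_coe_real.isEmbedding.continuous_iff.2 hcont
    intro u
    exact PreconnectedSpace.constant inferInstance hcont'
  have hk0 : k 0 ≠ 0 := by
    intro h
    obtain ⟨s, hs⟩ := exists_add_half_eq_of_periodic hβ (fun u => by simp [hk u, hkc u, h])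
    obtain ⟨m, hm⟩ := hinj _ _ (hray (s + 1 / 2) s 0 (by rw [hs]; simp))
    exact half_ne_intCast m (by rw [← hm]; ring)
  have hmul : ∀ (m : ℤ) u, β (u + m) = β u + m * (k 0 * (2 * π)) := by
    intro m
    induction m using Int.induction_on with
    | zero => simp
    | succ i ih =>
      intro u
      have := hk (u + i)
      rw [hkc] at this
      push_cast at ih ⊢
      rw [← add_assoc, this, ih]
      ring
    | pred i ih =>
      intro u
      have := hk (u + (-i - 1))
      rw [hkc] at this
      push_cast at ih ⊢
      have e : u + (-(i : ℝ) - 1) + 1 = u + -i := by ring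
      rw [e, ih] at this
      linarith
  have hβinj : Function.Injective β := by
    intro u v huv
    obtain ⟨m, hm⟩ := hinj u v (hray u v 0 (by simp [huv]))
    have hu : u = v + m := by linarith
    rw [hu, hmul] at huv
    have h3 : (m : ℝ) * (k 0 * (2 * π)) = 0 := by linarith
    have hk0' : (k 0 : ℝ) ≠ 0 := by exact_mod_cast hk0
    have hm0 : (m : ℝ) = 0 := by
      rcases mul_eq_zero.1 h3 with h | h
      · exact h
      · exact absurd h (by positivity)
    rw [hu, hm0, add_zero]
  have hshort : ∀ v ∈ Ioo (0 : ℝ) 1, ∀ m : ℤ, β v ≠ β 0 + m * (2 * π) := by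
    intro v hv m hm
    obtain ⟨j, hj⟩ := hinj _ _ (hray _ _ m hm)
    rw [sub_zero] at hj
    have a1 : (0 : ℝ) < j := hj ▸ hv.1
    have a2 : (j : ℝ) < 1 := hj ▸ hv.2
    have a1' : 0 < j := by exact_mod_cast a1
    have a2' : j < 1 := by exact_mod_cast a2
    omega
  have hk1 := hk 0
  rw [zero_add] at hk1
  rcases hβ.strictMono_of_inj hβinj with hmono | hanti
  · left
    have h01 : β 0 < β 1 := hmono one_pos
    have hkpos : 0 < k 0 := by
      by_contra! hcon
      have : (k 0 : ℝ) ≤ 0 := by exact_mod_cast hcon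
      nlinarith
    have hk2 : k 0 = 1 := by
      by_contra hcon
      have : (2 : ℝ) ≤ k 0 := by
        have : 2 ≤ k 0 := by omega
        exact_mod_cast this
      obtain ⟨v, hv, hve⟩ := intermediate_value_Ioo zero_le_one hβ.continuousOn
        (show β 0 + 2 * π ∈ Ioo (β 0) (β 1) from ⟨by linarith, by nlinarith⟩)
      exact hshort v hv 1 (by simpa using hve)
    exact ⟨β, hK, h0, hc, hp, hf, hpol, hβ, hmono, fun u => by rw [hk, hkc, hk2]; simp⟩
  · right
    have h01 : β 1 < β 0 := hanti one_pos
    have hkneg : k 0 < 0 := by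
      by_contra! hcon
      have : (0 : ℝ) ≤ k 0 := by exact_mod_cast hcon
      nlinarith
    have hk2 : k 0 = -1 := by
      by_contra hcon
      have : (k 0 : ℝ) ≤ -2 := by
        have : k 0 ≤ -2 := by omega
        exact_mod_cast this
      obtain ⟨v, hv, hve⟩ := intermediate_value_Ioo' zero_le_one hβ.continuousOn
        (show β 0 - 2 * π ∈ Ioo (β 1) (β 0) from ⟨by nlinarith, by linarith⟩)
      exact hshort v hv (-1) (by rw [hve]; push_cast; ring)
    refine ⟨fun u => -β u, ?_, ?_, ?_, ?_, ?_, ?_, ?_, ?_, ?_⟩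
    · exact hK.linear_preimage Complex.conjCLE.toLinearEquiv.toLinearMap
    · have := Complex.conjCLE.toHomeomorph.preimage_interior K
      change (0 : ℂ) ∈ interior (Complex.conjCLE.toHomeomorph ⁻¹' K)
      rw [← this]
      simpa using h0
    · exact Complex.conjCLE.continuous.comp hc
    · intro u
      simp only [hp u]
    · intro u
      have := Complex.conjCLE.toHomeomorph.preimage_frontier K
      change _ ∈ frontier (Complex.conjCLE.toHomeomorph ⁻¹' K)
      rw [← this]
      simpa using hf u
    · intro u
      simp only [Complex.conjCLE_apply, RCLike.norm_conj]
      conv_lhs => rw [hpol u]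
      rw [map_mul, Complex.conj_ofReal, ← Complex.exp_conj, map_mul, Complex.conj_I,
        Complex.conj_ofReal]
      push_cast
      ring_nf
    · exact hβ.neg
    · exact hanti.neg
    · intro u
      rw [hk, hkc, hk2]
      push_cast
      ring

theorem intrinsicInterior_eq_interior {E : Type*} [NormedAddCommGroup E] [NormedSpace ℝ E]
    {s : Set E} (hs : affineSpan ℝ s = ⊤) : intrinsicInterior ℝ s = interior s := by
  have ho : IsOpen (affineSpan ℝ s : Set E) := by rw [hs]; exact isOpen_univ
  have h : (Subtype.val ⁻¹' interior s : Set (affineSpan ℝ s)) = interior (Subtype.val ⁻¹' s) :=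
    ho.isOpenEmbedding_subtypeVal.isOpenMap.preimage_interior_eq_interior_preimage
      continuous_subtype_val s
  rw [intrinsicInterior, ← h, image_preimage_eq_iff, Subtype.range_coe_subtype]
  intro x _
  change x ∈ affineSpan ℝ s
  rw [hs]
  trivial

theorem intrinsicFrontier_eq_frontier {E : Type*} [NormedAddCommGroup E] [NormedSpace ℝ E]
    {s : Set E} (hs : affineSpan ℝ s = ⊤) : intrinsicFrontier ℝ s = frontier s := by
  have ho : IsOpen (affineSpan ℝ s : Set E) := by rw [hs]; exact isOpen_univ
  have h : (Subtype.val ⁻¹' frontier s : Set (affineSpan ℝ s)) = frontier (Subtype.val ⁻¹' s) :=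
    ho.isOpenEmbedding_subtypeVal.isOpenMap.preimage_frontier_eq_frontier_preimage
      continuous_subtype_val s
  rw [intrinsicFrontier, ← h, image_preimage_eq_iff, Subtype.range_coe_subtype]
  intro x _
  change x ∈ affineSpan ℝ s
  rw [hs]
  trivial

theorem exists_linearIsometry_complex_range_eq {E : Type*} [NormedAddCommGroup E]
    [InnerProductSpace ℝ E] (V : Submodule ℝ E) (hV : Module.finrank ℝ V = 2) :
    ∃ L : ℂ →ₗᵢ[ℝ] E, ∀ x, x ∈ V ↔ ∃ z, L z = x := by
  have : FiniteDimensional ℝ V := Module.finite_of_finrank_eq_succ hV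
  let e : ℂ ≃ₗᵢ[ℝ] V := Complex.orthonormalBasisOneI.equiv (stdOrthonormalBasis ℝ V)
    (finCongr hV.symm)
  refine ⟨V.subtypeₗᵢ.comp e.toLinearIsometry, fun x => ⟨fun hx => ⟨e.symm ⟨x, hx⟩, by simp⟩, ?_⟩⟩
  rintro ⟨z, rfl⟩
  exact (e z).2

/-- The affine isometric embedding of the complex plane with base point `p` and linear part `L`. -/
def planeEmbedding {E : Type*} [NormedAddCommGroup E] [InnerProductSpace ℝ E]
    (L : ℂ →ₗᵢ[ℝ] E) (p : E) : ℂ →ᵃⁱ[ℝ] E :=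
  (AffineIsometryEquiv.vaddConst ℝ p).toAffineIsometry.comp L.toAffineIsometry

theorem planeEmbedding_apply {E : Type*} [NormedAddCommGroup E] [InnerProductSpace ℝ E]
    (L : ℂ →ₗᵢ[ℝ] E) (p : E) (z : ℂ) : planeEmbedding L p z = L z + p := rfl

theorem affineSpan_eq_top_of_image {E : Type*} [NormedAddCommGroup E] [InnerProductSpace ℝ E]
    (φ : ℂ →ᵃⁱ[ℝ] E) {s : Set ℂ} (hs : s.Nonempty)
    (h : Module.finrank ℝ (affineSpan ℝ (φ '' s)).direction = 2) : affineSpan ℝ s = ⊤ := by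
  have hmap : affineSpan ℝ (φ '' s) = (affineSpan ℝ s).map φ.toAffineMap :=
    (AffineSubspace.map_span φ.toAffineMap s).symm
  rw [hmap, AffineSubspace.map_direction] at h
  have hle := Submodule.finrank_map_le φ.toAffineMap.linear (affineSpan ℝ s).direction
  rw [h] at hle
  have htop : (affineSpan ℝ s).direction = ⊤ :=
    Submodule.eq_top_of_finrank_eq (le_antisymm (Submodule.finrank_le _)
      (by rwa [Complex.finrank_real_complex]))
  exact (AffineSubspace.direction_eq_top_iff_of_nonempty
    (hs.affineSpan ℝ)).1 htop

theorem ClosedCurve.continuous {n : ℕ} (γ : ClosedCurve n) : Continuous γ.toFun := by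
  have h01 : IntervalIntegrable γ.deriv' volume 0 (0 + 1) := by
    rw [zero_add, intervalIntegrable_iff_integrableOn_Icc_of_le zero_le_one]
    exact γ.integrableOn
  have hint := fun a b => γ.deriv'_periodic.intervalIntegrable one_ne_zero h01 a b
  have : γ.toFun = fun t => γ.toFun 0 + ∫ s in (0 : ℝ)..t, γ.deriv' s := funext γ.eq_integral
  rw [this]
  exact continuous_const.add (intervalIntegral.continuous_primitive hint 0)

/-- The secant directions of `γ` with parameter increment `w` traverse a great circle exactly once,
with a continuous monotone angle. -/
def HasMonotoneSecantAngle {n : ℕ} (γ : ClosedCurve n) (w : ℝ) : Prop :=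
  ∃ b : EuclideanSpace ℝ (Fin n), ‖b‖ = 1 ∧ ⟪gaussMap γ 0 w, b⟫ = 0 ∧
    ∃ θ : ℝ → ℝ, ContinuousOn θ (Set.Icc 0 1) ∧ θ 0 = 0 ∧
      (MonotoneOn θ (Set.Icc 0 1) ∨ AntitoneOn θ (Set.Icc 0 1)) ∧
      (θ 1 = 2 * π ∨ θ 1 = -(2 * π)) ∧
      (∀ u ∈ Set.Icc (0:ℝ) 1,
        gaussMap γ u w = Real.cos (θ u) • gaussMap γ 0 w + Real.sin (θ u) • b) ∧
      Set.range (fun u => gaussMap γ u w) =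
        Set.range (fun t : ℝ => Real.cos t • gaussMap γ 0 w + Real.sin t • b)

theorem hasMonotoneSecantAngle_of_polar {n : ℕ} (γ : ClosedCurve n)
    {K : Set ℂ} {c : ℝ → ℂ} {β : ℝ → ℝ} (h : IsPolarBoundary K c β)
    (L : ℂ →ₗᵢ[ℝ] EuclideanSpace ℝ (Fin n)) (p : EuclideanSpace ℝ (Fin n))
    (hγ : ∀ u, γ.toFun u = L (c u) + p) {w : ℝ} (hw : w ∈ Ioo (0 : ℝ) 1) :
    HasMonotoneSecantAngle γ w := by
  obtain ⟨θ, hθ, hmono, hper, hpol⟩ := h.exists_monotone_chord_angle hw.1 hw.2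
  have hg : ∀ u, gaussMap γ u w = L (Complex.exp (θ u * Complex.I)) := by
    intro u
    have hn : ‖c (u + w) - c u‖ ≠ 0 :=
      norm_ne_zero_iff.2 (sub_ne_zero.2 (h.ne_of_pos_of_lt_one u hw.1 hw.2))
    have e : γ.toFun (u + w) - γ.toFun u = L (c (u + w) - c u) := by
      rw [hγ, hγ, map_sub]; abel
    rw [gaussMap, e, L.norm_map, ← map_smul]
    congr 1
    conv_lhs => rw [hpol u]
    rw [norm_mul, Complex.norm_exp_ofReal_mul_I, mul_one, Complex.norm_real, norm_norm,
      ← Complex.real_smul, smul_smul, inv_mul_cancel₀ hn, one_smul]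
  set z : ℂ := Complex.exp (θ 0 * Complex.I) with hz
  have hrot : ∀ t : ℝ, Real.cos t • L z + Real.sin t • L (Complex.I * z) =
      L (Complex.exp ((t + θ 0 : ℝ) * Complex.I)) := by
    intro t
    rw [← map_smul, ← map_smul, ← map_add]
    congr 1
    rw [Complex.ofReal_add, add_mul, Complex.exp_add, ← hz, Complex.exp_mul_I, Complex.real_smul,
      Complex.real_smul, Complex.ofReal_cos, Complex.ofReal_sin]
    ring
  have hrep : ∀ u, gaussMap γ u w = Real.cos (θ u - θ 0) • gaussMap γ 0 w +
      Real.sin (θ u - θ 0) • L (Complex.I * z) := by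
    intro u
    rw [hg 0, hrot, hg u, sub_add_cancel]
  have h1 : θ 1 = θ 0 + 2 * π := by simpa using hper 0
  refine ⟨L (Complex.I * z), ?_, ?_, fun u => θ u - θ 0, by fun_prop, sub_self _,
    Or.inl fun x _ y _ hxy => sub_le_sub_right (hmono hxy) _, Or.inl (by simp only [h1]; ring),
    fun u _ => hrep u, ?_⟩
  · rw [L.norm_map, norm_mul, Complex.norm_I, one_mul, hz, Complex.norm_exp_ofReal_mul_I]
  · rw [hg 0, L.inner_map_map, ← hz, Complex.inner]
    simp
    ring
  · apply Subset.antisymm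
    · rintro _ ⟨u, rfl⟩
      exact ⟨θ u - θ 0, (hrep u).symm⟩
    · rintro _ ⟨t, rfl⟩
      have hpi : (0 : ℝ) < 2 * π := by positivity
      have hmem : toIcoMod hpi 0 t ∈ Ico (0 : ℝ) (0 + 2 * π) := toIcoMod_mem_Ico hpi 0 t
      obtain ⟨u, -, hu⟩ := intermediate_value_Icc (zero_le_one' ℝ) hθ.continuousOn
        (show θ 0 + toIcoMod hpi 0 t ∈ Icc (θ 0) (θ 1) from
          ⟨by linarith [hmem.1], by rw [h1]; linarith [hmem.2]⟩)
      refine ⟨u, ?_⟩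
      have ht : θ u - θ 0 = t - toIcoDiv hpi 0 t * (2 * π) := by
        rw [hu, add_sub_cancel_left, toIcoMod, zsmul_eq_mul]
      simp only
      rw [hrep u, ht, Real.cos_sub_int_mul_two_pi, Real.sin_sub_int_mul_two_pi]

theorem ClosedCurve.IsConvex.hasMonotoneSecantAngle {n : ℕ} {γ : ClosedCurve n}
    (hinj : γ.IsInj) (hconv : γ.IsConvex) {w : ℝ} (hw : w ∈ Ioo (0 : ℝ) 1) :
    HasMonotoneSecantAngle γ w := by
  obtain ⟨K, hK, hdim, hrange⟩ := hconv
  have hKne : K.Nonempty := by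
    rw [nonempty_iff_ne_empty]
    rintro rfl
    rw [direction_affineSpan, vectorSpan_empty, finrank_bot] at hdim
    omega
  obtain ⟨p, hp⟩ := hKne.intrinsicInterior hK
  have hpK : p ∈ affineSpan ℝ K := subset_affineSpan ℝ K (intrinsicInterior_subset hp)
  obtain ⟨L, hL⟩ := exists_linearIsometry_complex_range_eq _ hdim
  set φ := planeEmbedding L p with hφ
  have hmem : ∀ x ∈ affineSpan ℝ K, ∃ z, φ z = x := by
    intro x hx
    obtain ⟨z, hz⟩ := (hL (x - p)).1 (AffineSubspace.vsub_mem_direction hx hpK)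
    exact ⟨z, by rw [hφ, planeEmbedding_apply, hz, sub_add_cancel]⟩
  have himg : φ '' (φ ⁻¹' K) = K := by
    rw [image_preimage_eq_iff]
    exact fun x hx => hmem x (subset_affineSpan ℝ K hx)
  set K' := φ ⁻¹' K with hK'
  have hK'c : Convex ℝ K' := hK.affine_preimage φ.toAffineMap
  have hK'ne : K'.Nonempty := by
    rw [← image_nonempty, himg]
    exact hKne
  have hspan : affineSpan ℝ K' = ⊤ := by
    refine affineSpan_eq_top_of_image φ hK'ne ?_
    rw [himg]
    exact hdim
  have h0 : (0 : ℂ) ∈ interior K' := by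
    rw [← himg, φ.intrinsicInterior_image, intrinsicInterior_eq_interior hspan] at hp
    obtain ⟨z, hz, hzp⟩ := hp
    have : φ z = φ 0 := by rw [hzp, hφ, planeEmbedding_apply, map_zero, zero_add]
    rwa [← φ.injective this]
  rw [← himg, φ.intrinsicFrontier_image, intrinsicFrontier_eq_frontier hspan] at hrange
  have hpre : ∀ u, ∃ z ∈ frontier K', φ z = γ.toFun u := fun u => by
    have : γ.toFun u ∈ φ '' frontier K' := hrange ▸ mem_range_self u
    exact this
  choose c hcf hcγ using hpre
  have hcc : Continuous c := by
    rw [φ.isometry.isEmbedding.continuous_iff]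
    exact γ.continuous.congr fun u => (hcγ u).symm
  have hcp : Function.Periodic c 1 := fun u => φ.injective (by
    rw [hcγ, hcγ, γ.periodic u])
  have hci : ∀ s t, c s = c t → ∃ k : ℤ, s - t = k := fun s t hst =>
    hinj s t (by rw [← hcγ, ← hcγ, hst])
  rcases exists_isPolarBoundary_or_conj hK'c h0 hcc hcp hci hcf with ⟨β, hβ⟩ | ⟨β, hβ⟩
  · exact hasMonotoneSecantAngle_of_polar γ hβ L p (fun u => (hcγ u).symm) hw
  · refine hasMonotoneSecantAngle_of_polar γ hβ
      (L.comp Complex.conjLIE.toLinearIsometry) p (fun u => ?_) hw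
    rw [← hcγ u, hφ, planeEmbedding_apply]
    simp

theorem sum_mul_sin_nonneg {N : ℕ} {τ r : ℕ → ℝ} (hτ : Monotone τ) (h0 : 0 ≤ τ 0)
    (hN : τ N ≤ 2 * π) (hr : ∀ k, 0 ≤ r k)
    (hsum : ∑ j ∈ Finset.range N, r j * Real.sin (τ j) = 0) {k : ℕ} (hk : k ≤ N) :
    0 ≤ ∑ j ∈ Finset.range k, r j * Real.sin (τ j) := by
  rcases le_total (τ k) π with h | h
  · refine Finset.sum_nonneg fun j hj => mul_nonneg (hr j) ?_
    exact Real.sin_nonneg_of_nonneg_of_le_pi (h0.trans (hτ (Nat.zero_le j)))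
      ((hτ (Finset.mem_range.1 hj).le).trans h)
  · rw [← Finset.sum_range_add_sum_Ico _ hk] at hsum
    have h1 : ∑ j ∈ Finset.Ico k N, r j * Real.sin (τ j) ≤ 0 := by
      refine Finset.sum_nonpos fun j hj => mul_nonpos_of_nonneg_of_nonpos (hr j) ?_
      obtain ⟨hkj, hjN⟩ := Finset.mem_Ico.1 hj
      have a1 := hτ hkj
      have a2 := hτ hjN.le
      have := Real.sin_nonneg_of_nonneg_of_le_pi (x := τ j - π) (by linarith) (by linarith)
      rw [Real.sin_sub_pi] at this
      linarith
    linarith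

theorem exists_monotone_extension {θ : ℝ → ℝ} {T : ℝ} (hθ : MonotoneOn θ (Icc 0 1))
    (h1 : θ 1 = θ 0 + T) :
    ∃ σ : ℝ → ℝ, Monotone σ ∧ (∀ u, σ (u + 1) = σ u + T) ∧
      ∀ u, σ u = θ (Int.fract u) + ⌊u⌋ * T := by
  refine ⟨fun u => θ (Int.fract u) + ⌊u⌋ * T, ?_, fun u => ?_, fun _ => rfl⟩
  · have hm0 : (0 : ℝ) ∈ Icc (0 : ℝ) 1 := by simp
    have hm1 : (1 : ℝ) ∈ Icc (0 : ℝ) 1 := by simp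
    have hfr : ∀ u : ℝ, Int.fract u ∈ Icc (0 : ℝ) 1 := fun u =>
      ⟨Int.fract_nonneg u, (Int.fract_lt_one u).le⟩
    have hT : 0 ≤ T := by
      have := hθ hm0 hm1 zero_le_one
      linarith
    intro u v huv
    rcases (Int.floor_mono huv).eq_or_lt with h | h
    · simp only [h]
      have : Int.fract u ≤ Int.fract v := by
        rw [Int.fract, Int.fract, h]
        linarith
      linarith [hθ (hfr u) (hfr v) this]
    · have a1 : θ (Int.fract u) ≤ θ 1 := hθ (hfr u) hm1 (hfr u).2
      have a2 : θ 0 ≤ θ (Int.fract v) := hθ hm0 (hfr v) (hfr v).1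
      have a3 : (⌊u⌋ : ℝ) + 1 ≤ ⌊v⌋ := by exact_mod_cast h
      have a4 := mul_le_mul_of_nonneg_right a3 hT
      simp only
      linarith
  · simp only [Int.fract_add_one, Int.floor_add_one]
    push_cast
    ring

section SecantSpan

variable {n : ℕ} {γ : ClosedCurve n} {w : ℝ}

theorem HasMonotoneSecantAngle.exists_orthonormal (hinj : γ.IsInj) (hw : w ∈ Ioo (0 : ℝ) 1)
    (h : HasMonotoneSecantAngle γ w) :
    ∃ (a b : EuclideanSpace ℝ (Fin n)) (σ : ℝ → ℝ), ‖a‖ = 1 ∧ ‖b‖ = 1 ∧ ⟪a, b⟫ = 0 ∧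
      a ∈ range (fun u => gaussMap γ u w) ∧
      (b ∈ range (fun u => gaussMap γ u w) ∨ -b ∈ range (fun u => gaussMap γ u w)) ∧
      Monotone σ ∧ (∀ u, σ (u + 1) = σ u + 2 * π) ∧
      ∀ u, gaussMap γ u w = Real.cos (σ u) • a + Real.sin (σ u) • b := by
  have hfract : ∀ u, gaussMap γ u w = gaussMap γ (Int.fract u) w := by
    intro u
    have hp : ∀ x, γ.toFun (x - ⌊u⌋) = γ.toFun x := fun x => by
      simpa using γ.periodic.sub_zsmul_eq ⌊u⌋ (x := x)
    rw [gaussMap, gaussMap, Int.fract, hp, sub_add_eq_add_sub, hp]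
  have hextend : ∀ {a b : EuclideanSpace ℝ (Fin n)} {θ : ℝ → ℝ}, θ 0 = 0 → θ 1 = 2 * π →
      MonotoneOn θ (Icc 0 1) → (∀ u ∈ Icc (0 : ℝ) 1,
        gaussMap γ u w = Real.cos (θ u) • a + Real.sin (θ u) • b) →
      ∃ σ : ℝ → ℝ, Monotone σ ∧ (∀ u, σ (u + 1) = σ u + 2 * π) ∧
        ∀ u, gaussMap γ u w = Real.cos (σ u) • a + Real.sin (σ u) • b := by
    intro a b θ h0 h1 hmono hrep
    obtain ⟨σ, hσ, hper, hσθ⟩ := exists_monotone_extension (T := 2 * π) hmono (by rw [h0, h1]; ring)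
    refine ⟨σ, hσ, hper, fun u => ?_⟩
    rw [hfract, hrep _ ⟨Int.fract_nonneg u, (Int.fract_lt_one u).le⟩, hσθ,
      Real.cos_add_int_mul_two_pi, Real.sin_add_int_mul_two_pi]
  have hnorm : ‖gaussMap γ 0 w‖ = 1 := by
    have hne : γ.toFun (0 + w) - γ.toFun 0 ≠ 0 := by
      intro h0
      obtain ⟨k, hk⟩ := hinj _ _ (sub_eq_zero.1 h0)
      rw [zero_add, sub_zero] at hk
      have a1 : (0 : ℝ) < k := hk ▸ hw.1
      have a2 : (k : ℝ) < 1 := hk ▸ hw.2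
      have a1' : 0 < k := by exact_mod_cast a1
      have a2' : k < 1 := by exact_mod_cast a2
      omega
    rw [gaussMap, norm_smul, norm_inv, norm_norm, inv_mul_cancel₀ (norm_ne_zero_iff.2 hne)]
  obtain ⟨b, hb, hab, θ, -, h0, hmono, h1, hrep, hrange⟩ := h
  have hbr : b ∈ range (fun u => gaussMap γ u w) := by
    rw [hrange]
    exact ⟨π / 2, by simp⟩
  have hpi := Real.pi_pos
  have hm0 : (0 : ℝ) ∈ Icc (0 : ℝ) 1 := by simp
  have hm1 : (1 : ℝ) ∈ Icc (0 : ℝ) 1 := by simp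
  rcases hmono with hmono | hanti
  · have h1' : θ 1 = 2 * π := by
      have := hmono hm0 hm1 zero_le_one
      rcases h1 with h1 | h1
      · exact h1
      · linarith
    obtain ⟨σ, hσ⟩ := hextend h0 h1' hmono hrep
    exact ⟨_, b, σ, hnorm, hb, hab, mem_range_self (f := fun u => gaussMap γ u w) 0,
      Or.inl hbr, hσ⟩
  · have h1' : -θ 1 = 2 * π := by
      have := hanti hm0 hm1 zero_le_one
      rcases h1 with h1 | h1
      · linarith
      · linarith
    obtain ⟨σ, hσ⟩ := hextend (a := gaussMap γ 0 w) (b := -b) (θ := fun u => -θ u)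
      (by simp only [h0, neg_zero]) h1' hanti.neg
      (fun u hu => by rw [hrep u hu, Real.cos_neg, Real.sin_neg, smul_neg, neg_smul, neg_neg])
    exact ⟨_, -b, σ, hnorm, by rw [norm_neg, hb], by rw [inner_neg_right, hab, neg_zero],
      mem_range_self (f := fun u => gaussMap γ u w) 0, Or.inr (by rwa [neg_neg]), hσ⟩

/-- The linear span of the secants of `γ` with parameter increment `w`. -/
def secantSpan (γ : ClosedCurve n) (w : ℝ) : Submodule ℝ (EuclideanSpace ℝ (Fin n)) :=
  Submodule.span ℝ (range fun u => γ.toFun (u + w) - γ.toFun u)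

theorem secant_mem_secantSpan (γ : ClosedCurve n) (u w : ℝ) :
    γ.toFun (u + w) - γ.toFun u ∈ secantSpan γ w :=
  Submodule.subset_span ⟨u, rfl⟩

theorem gaussMap_mem_secantSpan (γ : ClosedCurve n) (u w : ℝ) :
    gaussMap γ u w ∈ secantSpan γ w :=
  Submodule.smul_mem _ _ (secant_mem_secantSpan γ u w)

theorem norm_smul_gaussMap (γ : ClosedCurve n) (u w : ℝ) :
    ‖γ.toFun (u + w) - γ.toFun u‖ • gaussMap γ u w = γ.toFun (u + w) - γ.toFun u := by
  rcases eq_or_ne (γ.toFun (u + w) - γ.toFun u) 0 with h | h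
  · rw [gaussMap, h, norm_zero, zero_smul]
  · rw [gaussMap, smul_smul, mul_inv_cancel₀ (norm_ne_zero_iff.2 h), one_smul]

theorem HasMonotoneSecantAngle.finrank_secantSpan (hinj : γ.IsInj) (hw : w ∈ Ioo (0 : ℝ) 1)
    (h : HasMonotoneSecantAngle γ w) : Module.finrank ℝ (secantSpan γ w) = 2 := by
  obtain ⟨a, b, σ, ha, hb, hab, har, hbr, -, -, hrep⟩ := h.exists_orthonormal hinj hw
  have hon : Orthonormal ℝ ![a, b] := by
    rw [orthonormal_iff_ite]
    intro i j
    fin_cases i <;> fin_cases j <;>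
      simp [ha, hb, hab, real_inner_comm a b]
  have hspan : secantSpan γ w = Submodule.span ℝ (range ![a, b]) := by
    apply le_antisymm
    · rw [secantSpan, Submodule.span_le]
      rintro _ ⟨u, rfl⟩
      simp only
      rw [← norm_smul_gaussMap, hrep]
      refine Submodule.smul_mem _ _ (Submodule.add_mem _ (Submodule.smul_mem _ _ ?_)
        (Submodule.smul_mem _ _ ?_))
      · exact Submodule.subset_span ⟨0, rfl⟩
      · exact Submodule.subset_span ⟨1, rfl⟩
    · rw [Submodule.span_le]
      rintro _ ⟨i, rfl⟩
      have ha' : a ∈ secantSpan γ w := by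
        obtain ⟨u, rfl⟩ := har
        exact gaussMap_mem_secantSpan γ u w
      have hb' : b ∈ secantSpan γ w := by
        rcases hbr with ⟨u, rfl⟩ | ⟨u, hu⟩
        · exact gaussMap_mem_secantSpan γ u w
        · rw [← neg_neg b, ← hu]
          exact Submodule.neg_mem _ (gaussMap_mem_secantSpan γ u w)
      fin_cases i
      · exact ha'
      · exact hb'
  rw [hspan, finrank_span_eq_card hon.linearIndependent, Fintype.card_fin]

theorem secantSpan_natCast_mul_le (γ : ClosedCurve n) (k : ℕ) (w : ℝ) :
    secantSpan γ (k * w) ≤ secantSpan γ w := by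
  rw [secantSpan, Submodule.span_le]
  rintro _ ⟨u, rfl⟩
  change γ.toFun (u + k * w) - γ.toFun u ∈ secantSpan γ w
  induction k with
  | zero => simp
  | succ k ih =>
    have h := Submodule.add_mem _ (secant_mem_secantSpan γ (u + k * w) w) ih
    rw [sub_add_sub_cancel] at h
    convert h using 3
    push_cast
    ring

theorem secantSpan_half_eq (hinj : γ.IsInj)
    (h : ∀ w ∈ Ioo (0 : ℝ) 1, HasMonotoneSecantAngle γ w) (j : ℕ) :
    secantSpan γ (1 / (2 * (j + 1) : ℕ)) = secantSpan γ (1 / 2) := by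
  have hj : (0 : ℝ) < j + 1 := by positivity
  have hm : (1 / (2 * (j + 1) : ℕ) : ℝ) ∈ Ioo (0 : ℝ) 1 := by
    constructor
    · positivity
    · push_cast
      rw [div_lt_one (by positivity)]
      linarith [(Nat.cast_nonneg j : (0 : ℝ) ≤ j)]
  have hm2 : (1 / 2 : ℝ) ∈ Ioo (0 : ℝ) 1 := by constructor <;> norm_num
  symm
  apply Submodule.eq_of_le_of_finrank_eq
  · have := secantSpan_natCast_mul_le γ (j + 1) (1 / (2 * (j + 1) : ℕ))
    convert this using 2
    push_cast
    field_simp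
  · rw [(h _ hm).finrank_secantSpan hinj hm, (h _ hm2).finrank_secantSpan hinj hm2]

theorem tendsto_floor_div_two_mul {x : ℝ} (hx : 0 ≤ x) :
    Filter.Tendsto (fun j : ℕ => ((⌊x * (2 * (j + 1) : ℕ)⌋₊ : ℝ) * (1 / (2 * (j + 1) : ℕ) : ℝ)))
      Filter.atTop (nhds x) := by
  have h1 : Filter.Tendsto (fun j : ℕ => ((2 * (j + 1) : ℕ) : ℝ)) Filter.atTop Filter.atTop := by
    refine tendsto_natCast_atTop_atTop.comp (Filter.tendsto_atTop_mono (fun j => ?_)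
      Filter.tendsto_id)
    simp only [id]
    omega
  refine ((tendsto_nat_floor_mul_div_atTop hx).comp h1).congr fun j => ?_
  simp only [Function.comp]
  rw [mul_one_div]

theorem secant_mem_secantSpan_half (hinj : γ.IsInj)
    (h : ∀ w ∈ Ioo (0 : ℝ) 1, HasMonotoneSecantAngle γ w) (s t : ℝ) :
    γ.toFun t - γ.toFun s ∈ secantSpan γ (1 / 2) := by
  have key : ∀ u x : ℝ, 0 ≤ x → γ.toFun (u + x) - γ.toFun u ∈ secantSpan γ (1 / 2) := by
    intro u x hx
    have hc : Continuous fun y => γ.toFun (u + y) - γ.toFun u :=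
      (γ.continuous.comp (continuous_const_add u)).sub continuous_const
    refine (secantSpan γ (1 / 2)).closed_of_finiteDimensional.mem_of_tendsto
      ((hc.tendsto x).comp (tendsto_floor_div_two_mul hx))
      (Filter.Eventually.of_forall fun j => ?_)
    have := secantSpan_natCast_mul_le γ ⌊x * (2 * (j + 1) : ℕ)⌋₊ (1 / (2 * (j + 1) : ℕ))
      (secant_mem_secantSpan γ u _)
    rwa [secantSpan_half_eq hinj h] at this
  rcases le_total s t with hst | hst
  · simpa using key s (t - s) (by linarith)
  · have := Submodule.neg_mem _ (key t (s - t) (by linarith))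
    simpa using this

theorem HasMonotoneSecantAngle.exists_discrete_support (hinj : γ.IsInj) {N : ℕ} (hN : 1 < N)
    (h : HasMonotoneSecantAngle γ (1 / N)) (u : ℝ) :
    ∃ m ∈ secantSpan γ (1 / N), ‖m‖ = 1 ∧
      ∀ k ≤ N, 0 ≤ ⟪m, γ.toFun (u + k * (1 / N)) - γ.toFun u⟫ := by
  have hN0 : (1 : ℝ) < N := by exact_mod_cast hN
  have hw : (1 / N : ℝ) ∈ Ioo (0 : ℝ) 1 :=
    ⟨by positivity, by rw [div_lt_one (by positivity)]; exact hN0⟩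
  obtain ⟨a, b, σ, ha, hb, hab, har, hbr, hσ, hper, hrep⟩ := h.exists_orthonormal hinj hw
  set w : ℝ := 1 / N with hwd
  have haa : ⟪a, a⟫ = 1 := by rw [real_inner_self_eq_norm_sq, ha, one_pow]
  have hbb : ⟪b, b⟫ = 1 := by rw [real_inner_self_eq_norm_sq, hb, one_pow]
  have hba : ⟪b, a⟫ = 0 := by rw [real_inner_comm, hab]
  have ha' : a ∈ secantSpan γ w := by
    obtain ⟨u, rfl⟩ := har
    exact gaussMap_mem_secantSpan γ u w
  have hb' : b ∈ secantSpan γ w := by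
    rcases hbr with ⟨u, rfl⟩ | ⟨u, hu⟩
    · exact gaussMap_mem_secantSpan γ u w
    · rw [← neg_neg b, ← hu]
      exact Submodule.neg_mem _ (gaussMap_mem_secantSpan γ u w)
  set m := Real.cos (σ u) • b - Real.sin (σ u) • a with hm
  have hstep : ∀ x, ⟪m, γ.toFun (x + w) - γ.toFun x⟫ =
      ‖γ.toFun (x + w) - γ.toFun x‖ * Real.sin (σ x - σ u) := by
    intro x
    rw [← norm_smul_gaussMap γ x w, real_inner_smul_right, norm_smul_gaussMap, hrep, hm,
      Real.sin_sub]
    simp only [inner_sub_left, inner_add_right, real_inner_smul_left, real_inner_smul_right, haa,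
      hbb, hab, hba]
    ring
  have hsum : ∀ k : ℕ, ⟪m, γ.toFun (u + k * w) - γ.toFun u⟫ = ∑ j ∈ Finset.range k,
      ‖γ.toFun (u + j * w + w) - γ.toFun (u + j * w)‖ * Real.sin (σ (u + j * w) - σ u) := by
    intro k
    induction k with
    | zero => simp
    | succ k ih =>
      have hk : u + (k + 1 : ℕ) * w = u + k * w + w := by
        push_cast
        ring
      rw [Finset.sum_range_succ, ← ih, ← hstep, ← inner_add_right, sub_add_sub_cancel', hk]
  refine ⟨m, Submodule.sub_mem _ (Submodule.smul_mem _ _ hb') (Submodule.smul_mem _ _ ha'), ?_,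
    fun k hk => ?_⟩
  · have : ‖m‖ ^ 2 = 1 := by
      rw [← real_inner_self_eq_norm_sq, hm]
      simp only [inner_sub_left, inner_sub_right, real_inner_smul_left, real_inner_smul_right, haa,
        hbb, hab, hba]
      linear_combination Real.sin_sq_add_cos_sq (σ u)
    exact (pow_eq_one_iff_of_nonneg (norm_nonneg m) two_ne_zero).1 this
  · rw [hsum]
    have hNw : u + N * w = u + 1 := by
      rw [hwd]
      field_simp
    refine sum_mul_sin_nonneg (N := N) (τ := fun j : ℕ => σ (u + j * w) - σ u)
      (r := fun j : ℕ => ‖γ.toFun (u + j * w + w) - γ.toFun (u + j * w)‖) ?_ ?_ ?_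
      (fun j => norm_nonneg _) ?_ hk
    · intro i j hij
      have hij' : (i : ℝ) ≤ j := by exact_mod_cast hij
      have := mul_le_mul_of_nonneg_right hij' hw.1.le
      exact sub_le_sub_right (hσ (by linarith)) _
    · simp
    · simp only [hNw, hper]
      linarith
    · rw [← hsum, hNw, γ.periodic u, sub_self, inner_zero_right]

theorem exists_support_of_hasMonotoneSecantAngle (hinj : γ.IsInj)
    (h : ∀ w ∈ Ioo (0 : ℝ) 1, HasMonotoneSecantAngle γ w) (u : ℝ) :
    ∃ m ∈ secantSpan γ (1 / 2), ‖m‖ = 1 ∧ ∀ x, 0 ≤ ⟪m, γ.toFun x - γ.toFun u⟫ := by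
  have hex : ∀ j : ℕ, ∃ m ∈ secantSpan γ (1 / 2), ‖m‖ = 1 ∧ ∀ k ≤ 2 * (j + 1),
      0 ≤ ⟪m, γ.toFun (u + k * (1 / (2 * (j + 1) : ℕ))) - γ.toFun u⟫ := by
    intro j
    have hN : 1 < 2 * (j + 1) := by omega
    have hN0 : (1 : ℝ) < (2 * (j + 1) : ℕ) := by exact_mod_cast hN
    have := (h (1 / (2 * (j + 1) : ℕ))
      ⟨by positivity, by rw [div_lt_one (by positivity)]; exact hN0⟩).exists_discrete_support
      hinj hN u
    rwa [secantSpan_half_eq hinj h] at this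
  choose m hmV hm1 hm using hex
  obtain ⟨l, hl, φ, hφ, hlim⟩ := (isCompact_sphere (0 : EuclideanSpace ℝ (Fin n)) 1).tendsto_subseq
    (x := m) (fun j => by simp [hm1])
  refine ⟨l, (secantSpan γ (1 / 2)).closed_of_finiteDimensional.mem_of_tendsto hlim
    (Filter.Eventually.of_forall fun j => hmV _), by simpa using hl, fun x => ?_⟩
  set y := Int.fract (x - u) with hy
  have hxy : γ.toFun x = γ.toFun (u + y) := by
    have e : u + y = x - ⌊x - u⌋ := by rw [hy, Int.fract]; ring
    rw [e]
    simpa using (γ.periodic.sub_zsmul_eq ⌊x - u⌋ (x := x)).symm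
  rw [hxy]
  have hc : Continuous fun y => γ.toFun (u + y) - γ.toFun u :=
    (γ.continuous.comp (continuous_const_add u)).sub continuous_const
  have ht := ((hc.tendsto y).comp (tendsto_floor_div_two_mul (Int.fract_nonneg (x - u)))).comp
    hφ.tendsto_atTop
  refine ge_of_tendsto' (hlim.inner ht) fun j => hm _ _ ?_
  refine Nat.floor_le_of_le ?_
  have h1 : y ≤ 1 := (Int.fract_lt_one _).le
  have h2 : (0 : ℝ) ≤ (2 * (φ j + 1) : ℕ) := Nat.cast_nonneg _
  nlinarith

theorem isConvex_of_hasMonotoneSecantAngle (hinj : γ.IsInj)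
    (h : ∀ w ∈ Ioo (0 : ℝ) 1, HasMonotoneSecantAngle γ w) : γ.IsConvex := by
  have hm2 : (1 / 2 : ℝ) ∈ Ioo (0 : ℝ) 1 := by constructor <;> norm_num
  have hdim := (h _ hm2).finrank_secantSpan hinj hm2
  obtain ⟨L, hL⟩ := exists_linearIsometry_complex_range_eq _ hdim
  set φ := planeEmbedding L (γ.toFun 0) with hφ
  have hpre : ∀ u, ∃ z, φ z = γ.toFun u := by
    intro u
    obtain ⟨z, hz⟩ := (hL _).1 (secant_mem_secantSpan_half hinj h 0 u)
    exact ⟨z, by rw [hφ, planeEmbedding_apply, hz, sub_add_cancel]⟩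
  choose c hcγ using hpre
  have hcc : Continuous c := by
    rw [φ.isometry.isEmbedding.continuous_iff]
    exact γ.continuous.congr fun u => (hcγ u).symm
  have hcp : Function.Periodic c 1 := fun u => φ.injective (by
    rw [hcγ, hcγ, γ.periodic u])
  have hci : ∀ s t, c s = c t → ∃ k : ℤ, s - t = k := fun s t hst =>
    hinj s t (by rw [← hcγ, ← hcγ, hst])
  have hdiff : ∀ s t, L (c t - c s) = γ.toFun t - γ.toFun s := by
    intro s t
    rw [← hcγ, ← hcγ, hφ, planeEmbedding_apply, planeEmbedding_apply, map_sub]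
    abel
  have himg : φ '' range c = range γ.toFun := by
    rw [← range_comp]
    congr 1
    exact funext hcγ
  have hvec : vectorSpan ℝ (range γ.toFun) = secantSpan γ (1 / 2) := by
    apply le_antisymm
    · rw [vectorSpan, Submodule.span_le]
      rintro _ ⟨_, ⟨t, rfl⟩, _, ⟨s, rfl⟩, rfl⟩
      exact secant_mem_secantSpan_half hinj h s t
    · rw [secantSpan, Submodule.span_le]
      rintro _ ⟨u, rfl⟩
      exact vsub_mem_vectorSpan ℝ (mem_range_self _) (mem_range_self _)
  have hspan : affineSpan ℝ (range c) = ⊤ := by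
    refine affineSpan_eq_top_of_image φ (range_nonempty c) ?_
    rw [himg, direction_affineSpan, hvec, hdim]
  have hfront := range_eq_frontier_convexHull hcc hcp hci
    (interior_convexHull_nonempty_iff_affineSpan_eq_top.2 hspan) (fun u => by
      obtain ⟨m, hmV, hm1, hm⟩ := exists_support_of_hasMonotoneSecantAngle hinj h u
      obtain ⟨z, rfl⟩ := (hL m).1 hmV
      refine ⟨z, ?_, fun x => ?_⟩
      · rintro rfl
        simp at hm1
      · rw [← L.inner_map_map, hdiff]
        exact hm x)
  refine ⟨φ '' convexHull ℝ (range c), (convex_convexHull ℝ _).affine_image φ.toAffineMap, ?_, ?_⟩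
  · have : φ '' convexHull ℝ (range c) = convexHull ℝ (range γ.toFun) := by
      rw [← himg]
      exact φ.toAffineMap.image_convexHull (range c)
    rw [this, affineSpan_convexHull, direction_affineSpan, hvec, hdim]
  · rw [φ.intrinsicFrontier_image, intrinsicFrontier_eq_frontier
      (by rw [affineSpan_convexHull, hspan]), ← hfront, himg]

end SecantSpan

/-- **Convexity via the secant maps `ρ_{γ,w}`** (Lemma 3.6): `γ` is convex iff for every
`w ∈ (0,1)` the image of `ρ_{γ,w} = φ_γ(·,w)` is a great circle and `ρ_{γ,w}` is
parametrized by a monotonic continuous angle function `θ` (measured from `ρ_{γ,w}(0)`)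
with `θ(0) = 0` and `θ(1) ∈ {±2π}`. -/
theorem convex_iff_rho_great_circle_monotone {n : ℕ} (γ : ClosedCurve n)
    (hinj : γ.IsInj) (hreg : γ.IsRegular) :
    γ.IsConvex ↔ ∀ w ∈ Set.Ioo (0:ℝ) 1,
      ∃ b : EuclideanSpace ℝ (Fin n), ‖b‖ = 1 ∧ ⟪gaussMap γ 0 w, b⟫ = 0 ∧
      ∃ θ : ℝ → ℝ, ContinuousOn θ (Set.Icc 0 1) ∧ θ 0 = 0 ∧
        (MonotoneOn θ (Set.Icc 0 1) ∨ AntitoneOn θ (Set.Icc 0 1)) ∧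
        (θ 1 = 2 * π ∨ θ 1 = -(2 * π)) ∧
        (∀ u ∈ Set.Icc (0:ℝ) 1,
          gaussMap γ u w = Real.cos (θ u) • gaussMap γ 0 w + Real.sin (θ u) • b) ∧
        Set.range (fun u => gaussMap γ u w) =
          Set.range (fun t : ℝ => Real.cos t • gaussMap γ 0 w + Real.sin t • b) :=
  ⟨fun h _ hw => h.hasMonotoneSecantAngle hinj hw, fun h =>
    isConvex_of_hasMonotoneSecantAngle hinj h⟩

end
end

section
/- Let f: [0, ∞) → [0, ∞) be convex and monotonically increasing and let γ ∈ W^{1,1}_{i,r}(𝕋, ℝ^n). Then (a) ∫_𝕋 f(|∂_w φ_γ(u,w)|) dw ≥ f(π) for almost every u ∈ 𝕋, and (b) ∫_𝕋 f(|∂_u φ_γ(u,w)|) du ≥ f(2π) for all w ∈ (0,1), with equality in both when the image of γ is a circle parametrized with constant speed. If f is strictly convex and (a) holds with equality for almost every u ∈ 𝕋, or (b) holds with equality for all w ∈ (0,1), then the image of γ is a round circle and γ is parametrized with constant speed. -/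
open MeasureTheory Real Set intervalIntegral
open scoped ENNReal RealInnerProductSpace

noncomputable section

section Primitive

variable {F : Type*} [NormedAddCommGroup F] [InnerProductSpace ℝ F]

/-- `D` is an absolutely continuous curve with (almost everywhere) derivative `D'`. -/
structure IsPrimitive (D D' : ℝ → F) : Prop where
  intervalIntegrable : ∀ a b : ℝ, IntervalIntegrable D' volume a b
  eq_integral : ∀ t : ℝ, D t = D 0 + ∫ s in (0:ℝ)..t, D' s

namespace IsPrimitive

variable {D D' : ℝ → F}

theorem sub_eq (h : IsPrimitive D D') (a b : ℝ) : D b - D a = ∫ s in a..b, D' s := by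
  rw [h.eq_integral a, h.eq_integral b, add_sub_add_left_eq_sub]
  exact integral_interval_sub_left (h.intervalIntegrable _ _) (h.intervalIntegrable _ _)

theorem continuous (h : IsPrimitive D D') : Continuous D := by
  rw [funext h.eq_integral]
  exact continuous_const.add (intervalIntegral.continuous_primitive h.intervalIntegrable 0)

theorem comp_const_add (h : IsPrimitive D D') (u : ℝ) :
    IsPrimitive (fun t => D (u + t)) (fun t => D' (u + t)) := by
  refine ⟨fun a b => ?_, fun t => ?_⟩
  · simpa using (h.intervalIntegrable (u + a) (u + b)).comp_add_left (c := u)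
  · rw [intervalIntegral.integral_comp_add_left (fun s => D' s), ← h.sub_eq]
    abel

theorem sub {G G' : ℝ → F} (h : IsPrimitive D D') (hG : IsPrimitive G G') :
    IsPrimitive (fun t => D t - G t) (fun t => D' t - G' t) := by
  refine ⟨fun a b => (h.intervalIntegrable a b).sub (hG.intervalIntegrable a b), fun t => ?_⟩
  rw [intervalIntegral.integral_sub (h.intervalIntegrable _ _) (hG.intervalIntegrable _ _),
    ← h.sub_eq, ← hG.sub_eq]
  abel

theorem sub_const (h : IsPrimitive D D') (c : F) : IsPrimitive (fun t => D t - c) D' :=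
  ⟨h.intervalIntegrable, fun t => by rw [h.eq_integral t]; abel⟩

theorem ae_hasDerivAt [CompleteSpace F] (h : IsPrimitive D D') :
    ∀ᵐ t : ℝ, HasDerivAt D (D' t) t := by
  have hl : LocallyIntegrable D' volume := by
    intro x
    refine ⟨Ioc (x - 1) (x + 1), Ioc_mem_nhds (by linarith) (by linarith), ?_⟩
    exact (h.intervalIntegrable (x - 1) (x + 1)).1
  filter_upwards [LocallyIntegrable.ae_hasDerivAt_integral hl] with t ht
  rw [funext h.eq_integral]
  exact (ht 0).const_add _

/-- A real function whose increments are controlled by those of an absolutely continuous curve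
is absolutely continuous. -/
theorem absolutelyContinuousOnInterval {X : Type*} [PseudoMetricSpace X]
    (h : IsPrimitive D D') {g : ℝ → X} {a b C : ℝ}
    (hg : ∀ s ∈ uIcc a b, ∀ t ∈ uIcc a b, dist (g s) (g t) ≤ C * ‖D s - D t‖) :
    AbsolutelyContinuousOnInterval g a b := by
  have hΦ := ((h.intervalIntegrable a b).norm).absolutelyContinuousOnInterval_intervalIntegral
    (c := a) left_mem_uIcc
  have key : ∀ s t, ‖D s - D t‖ ≤
      dist (∫ v in a..s, ‖D' v‖) (∫ v in a..t, ‖D' v‖) := by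
    intro s t
    rw [h.sub_eq, Real.dist_eq, integral_interval_sub_left
      (h.intervalIntegrable _ _).norm (h.intervalIntegrable _ _).norm]
    exact norm_integral_le_abs_integral_norm
  rw [absolutelyContinuousOnInterval_iff] at hΦ ⊢
  intro ε hε
  obtain ⟨δ, hδ, H⟩ := hΦ (ε / (|C| + 1)) (by positivity)
  refine ⟨δ, hδ, fun E hE hlt => ?_⟩
  have h1 := H E hE hlt
  calc _ ≤ ∑ i ∈ Finset.range E.1, (|C| + 1) *
        dist (∫ v in a..(E.2 i).1, ‖D' v‖) (∫ v in a..(E.2 i).2, ‖D' v‖) := by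
        refine Finset.sum_le_sum fun i hi => ?_
        have h2 := hE.1 i hi
        refine (hg _ h2.1 _ h2.2).trans ?_
        refine mul_le_mul ?_ (key _ _) (norm_nonneg _) (by positivity)
        linarith [le_abs_self C]
    _ = (|C| + 1) * ∑ i ∈ Finset.range E.1,
        dist (∫ v in a..(E.2 i).1, ‖D' v‖) (∫ v in a..(E.2 i).2, ‖D' v‖) := by
        rw [Finset.mul_sum]
    _ < (|C| + 1) * (ε / (|C| + 1)) := by gcongr
    _ = ε := by field_simp

end IsPrimitive

/-- The angular speed `‖proj_{x^⊥} y‖ / ‖x‖` of a point moving through `x` with velocity `y`. -/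
def angSpeed (x y : F) : ℝ := ‖projPerp x y‖ / ‖x‖

theorem angSpeed_nonneg (x y : F) : 0 ≤ angSpeed x y := by unfold angSpeed; positivity

theorem projPerp_inv_norm_smul (x y : F) : projPerp (‖x‖⁻¹ • x) y = projPerp x y := by
  rcases eq_or_ne x 0 with rfl | hx
  · simp
  · have : ‖x‖ ≠ 0 := norm_ne_zero_iff.2 hx
    simp only [projPerp, norm_smul, norm_inv, norm_norm, real_inner_smul_left, smul_smul]
    congr 2
    field_simp

theorem inner_projPerp_self (x y : F) : ⟪x, projPerp x y⟫ = 0 := by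
  rcases eq_or_ne x 0 with rfl | hx
  · simp
  · have : ‖x‖ ≠ 0 := norm_ne_zero_iff.2 hx
    simp only [projPerp, inner_sub_right, real_inner_smul_right, real_inner_self_eq_norm_sq]
    field_simp
    ring

theorem norm_projPerp_le (x y : F) : ‖projPerp x y‖ ≤ ‖y‖ := by
  have h : ‖projPerp x y‖ ^ 2 = ⟪y, projPerp x y⟫ := by
    rw [← real_inner_self_eq_norm_sq]
    conv_lhs => rw [projPerp, inner_sub_left, real_inner_smul_left, ← projPerp,
      inner_projPerp_self]
    ring
  have h2 := real_inner_le_norm y (projPerp x y)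
  by_contra! hlt
  nlinarith [norm_nonneg y]

theorem angSpeed_le (x y : F) : angSpeed x y ≤ ‖y‖ / ‖x‖ := by
  unfold angSpeed
  gcongr
  exact norm_projPerp_le x y

theorem abs_deriv_cos_le {e x : F} (y : F) (he : ‖e‖ = 1) (hx : x ≠ 0) :
    |(⟪e, y⟫ * ‖x‖ - ⟪e, x⟫ * (⟪x, y⟫ / ‖x‖)) / ‖x‖ ^ 2| ≤
      √(1 - (⟪e, x⟫ / ‖x‖) ^ 2) * angSpeed x y := by
  have hn : ‖x‖ ≠ 0 := norm_ne_zero_iff.2 hx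
  have h0 : (⟪e, y⟫ * ‖x‖ - ⟪e, x⟫ * (⟪x, y⟫ / ‖x‖)) / ‖x‖ ^ 2 =
      ⟪projPerp x e, projPerp x y⟫ / ‖x‖ := by
    have : ⟪projPerp x e, projPerp x y⟫ = ⟪e, projPerp x y⟫ := by
      conv_lhs => rw [projPerp, inner_sub_left, real_inner_smul_left, inner_projPerp_self]
      ring
    rw [this, projPerp, inner_sub_right, real_inner_smul_right]
    field_simp
  have h1 : ‖projPerp x e‖ = √(1 - (⟪e, x⟫ / ‖x‖) ^ 2) := by
    have : 1 - (⟪e, x⟫ / ‖x‖) ^ 2 = ‖projPerp x e‖ ^ 2 := by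
      rw [projPerp, ← real_inner_self_eq_norm_sq]
      simp only [inner_sub_right, inner_sub_left, real_inner_smul_right, real_inner_smul_left,
        real_inner_self_eq_norm_sq, he, real_inner_comm e x, norm_smul, mul_pow,
        Real.norm_eq_abs, sq_abs]
      field_simp
      ring
    rw [this, Real.sqrt_sq (norm_nonneg _)]
  rw [h0, abs_div, abs_norm, angSpeed, ← h1, ← mul_div_assoc]
  gcongr
  exact abs_real_inner_le_norm _ _

theorem norm_inv_smul_sub_le {x y : F} (hx : x ≠ 0) (hy : y ≠ 0) :
    ‖‖x‖⁻¹ • x - ‖y‖⁻¹ • y‖ ≤ 2 / ‖x‖ * ‖x - y‖ := by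
  have hx' : 0 < ‖x‖ := norm_pos_iff.2 hx
  have hy' : 0 < ‖y‖ := norm_pos_iff.2 hy
  have h : ‖x‖⁻¹ • x - ‖y‖⁻¹ • y = ‖x‖⁻¹ • (x - y) + (‖x‖⁻¹ - ‖y‖⁻¹) • y := by
    module
  have h1 : ‖(‖x‖⁻¹ - ‖y‖⁻¹) • y‖ ≤ ‖x - y‖ / ‖x‖ := by
    have : (‖x‖⁻¹ - ‖y‖⁻¹) = (‖y‖ - ‖x‖) / (‖x‖ * ‖y‖) := by field_simp
    rw [norm_smul, this, Real.norm_eq_abs, abs_div, abs_of_pos (mul_pos hx' hy'), abs_sub_comm]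
    have := abs_norm_sub_norm_le x y
    calc _ = |‖x‖ - ‖y‖| / ‖x‖ := by field_simp
      _ ≤ _ := by gcongr
  calc _ ≤ ‖‖x‖⁻¹ • (x - y)‖ + ‖(‖x‖⁻¹ - ‖y‖⁻¹) • y‖ := h ▸ norm_add_le _ _
    _ ≤ ‖x - y‖ / ‖x‖ + ‖x - y‖ / ‖x‖ := by
        gcongr
        rw [norm_smul, norm_inv, norm_norm, inv_mul_eq_div]
    _ = _ := by ring

theorem IsPrimitive.exists_le_norm {D D' : ℝ → F} (h : IsPrimitive D D') {a b : ℝ}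
    (hne : ∀ t ∈ Icc a b, D t ≠ 0) : ∃ δ > 0, ∀ t ∈ Icc a b, δ ≤ ‖D t‖ := by
  rcases (Icc a b).eq_empty_or_nonempty with he | hn
  · exact ⟨1, one_pos, by simp [he]⟩
  · obtain ⟨x, hx, hmin⟩ := isCompact_Icc.exists_isMinOn hn h.continuous.norm.continuousOn
    exact ⟨‖D x‖, norm_pos_iff.2 (hne x hx), fun t ht => hmin ht⟩

theorem IsPrimitive.aestronglyMeasurable_angSpeed {D D' : ℝ → F} (h : IsPrimitive D D')
    (a b : ℝ) : AEStronglyMeasurable (fun t => angSpeed (D t) (D' t))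
      (volume.restrict (Ioc a b)) := by
  have h1 : AEStronglyMeasurable D' (volume.restrict (Ioc a b)) :=
    (h.intervalIntegrable a b).1.aestronglyMeasurable
  have h2 : AEStronglyMeasurable D (volume.restrict (Ioc a b)) :=
    h.continuous.aestronglyMeasurable
  unfold angSpeed projPerp
  refine AEStronglyMeasurable.div₀ ?_ h2.norm
  refine (h1.sub (AEStronglyMeasurable.smul ?_ h2)).norm
  exact AEStronglyMeasurable.div₀ (h2.inner h1) (h2.norm.pow 2)

theorem IsPrimitive.intervalIntegrable_angSpeed {D D' : ℝ → F} (h : IsPrimitive D D')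
    {a b : ℝ} (hab : a ≤ b) (hne : ∀ t ∈ Icc a b, D t ≠ 0) :
    IntervalIntegrable (fun t => angSpeed (D t) (D' t)) volume a b := by
  obtain ⟨δ, hδ, hle⟩ := h.exists_le_norm hne
  rw [intervalIntegrable_iff_integrableOn_Ioc_of_le hab]
  have h1 := ((h.intervalIntegrable a b).1.norm.const_mul δ⁻¹)
  refine h1.mono' (h.aestronglyMeasurable_angSpeed a b) ?_
  filter_upwards [ae_restrict_mem measurableSet_Ioc] with t ht
  rw [Real.norm_eq_abs, abs_of_nonneg (angSpeed_nonneg _ _)]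
  refine (angSpeed_le _ _).trans ?_
  rw [div_eq_inv_mul]
  gcongr
  exact hle t (Ioc_subset_Icc_self ht)

theorem lipschitz_arccos_const_mul {l : ℝ} (hl0 : 0 < l) (hl1 : l < 1) :
    ∃ C : ℝ, 0 ≤ C ∧ ∀ x ∈ Icc (-1:ℝ) 1, ∀ y ∈ Icc (-1:ℝ) 1,
      |arccos (l * x) - arccos (l * y)| ≤ C * |x - y| := by
  have hd : ∀ x ∈ Icc (-1:ℝ) 1, HasDerivWithinAt (fun x => arccos (l * x))
      (-(1 / √(1 - (l * x) ^ 2)) * (l * 1)) (Icc (-1:ℝ) 1) x := by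
    intro x hx
    have h1 : l * x ≠ -1 := by nlinarith [hx.1, hx.2]
    have h2 : l * x ≠ 1 := by nlinarith [hx.1, hx.2]
    exact (HasDerivAt.comp x (Real.hasDerivAt_arccos h1 h2)
      ((hasDerivAt_id x).const_mul l)).hasDerivWithinAt
  have hs : 0 < √(1 - l ^ 2) := Real.sqrt_pos.2 (by nlinarith)
  refine ⟨1 / √(1 - l ^ 2) * l, by positivity, fun x hx y hy => ?_⟩
  refine (convex_Icc (-1:ℝ) 1).norm_image_sub_le_of_norm_hasDerivWithin_le hd ?_ hy hx
  intro z hz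
  rw [mul_one, norm_mul, norm_neg, Real.norm_eq_abs, Real.norm_eq_abs, abs_of_pos hl0,
    abs_of_nonneg (by positivity)]
  have hz2 : 0 ≤ 1 - z ^ 2 := by nlinarith [hz.1, hz.2]
  have hsz : √(1 - l ^ 2) ≤ √(1 - (l * z) ^ 2) :=
    Real.sqrt_le_sqrt (by nlinarith [mul_nonneg (sq_nonneg l) hz2])
  gcongr

theorem IsPrimitive.abs_arccos_sub_le [CompleteSpace F] {D D' : ℝ → F} (h : IsPrimitive D D')
    {a b : ℝ} (hab : a ≤ b) (hne : ∀ t ∈ Icc a b, D t ≠ 0) {e : F} (he : ‖e‖ = 1)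
    {l : ℝ} (hl0 : 0 < l) (hl1 : l < 1) :
    |arccos (l * ⟪e, ‖D b‖⁻¹ • D b⟫) - arccos (l * ⟪e, ‖D a‖⁻¹ • D a⟫)| ≤
      ∫ t in a..b, angSpeed (D t) (D' t) := by
  obtain ⟨δ, hδ, hle⟩ := h.exists_le_norm hne
  obtain ⟨C, hC, hlip⟩ := lipschitz_arccos_const_mul hl0 hl1
  have hmem : ∀ x : F, ⟪e, ‖x‖⁻¹ • x⟫ ∈ Icc (-1:ℝ) 1 := by
    intro x
    have h1 := abs_real_inner_le_norm e (‖x‖⁻¹ • x)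
    have h2 : ‖‖x‖⁻¹ • x‖ ≤ 1 := by
      rw [norm_smul, norm_inv, norm_norm]
      exact inv_mul_le_one
    rw [he, one_mul] at h1
    exact abs_le.1 (h1.trans h2)
  have hac : AbsolutelyContinuousOnInterval
      (fun t => arccos (l * ⟪e, ‖D t‖⁻¹ • D t⟫)) a b := by
    refine h.absolutelyContinuousOnInterval (C := C * (2 / δ)) fun s hs t ht => ?_
    rw [uIcc_of_le hab] at hs ht
    rw [Real.dist_eq]
    refine (hlip _ (hmem _) _ (hmem _)).trans ?_
    rw [mul_assoc]
    gcongr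
    rw [← inner_sub_right]
    refine (abs_real_inner_le_norm _ _).trans ?_
    rw [he, one_mul]
    refine (norm_inv_smul_sub_le (hne s hs) (hne t ht)).trans ?_
    gcongr
    exact hle s hs
  rw [← hac.integral_deriv_eq_sub, ← Real.norm_eq_abs]
  refine intervalIntegral.norm_integral_le_of_norm_le hab ?_
    (h.intervalIntegrable_angSpeed hab hne)
  filter_upwards [h.ae_hasDerivAt] with t ht htm
  have hx : D t ≠ 0 := hne t (Ioc_subset_Icc_self htm)
  have hn : ‖D t‖ ≠ 0 := norm_ne_zero_iff.2 hx
  have hnorm : HasDerivAt (fun t => ‖D t‖) (⟪D t, D' t⟫ / ‖D t‖) t := by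
    have h1 := (ht.norm_sq).sqrt (by positivity)
    simp only [Real.sqrt_sq (norm_nonneg _)] at h1
    convert! h1 using 1
    field_simp
  have hc : HasDerivAt (fun t => ⟪e, ‖D t‖⁻¹ • D t⟫)
      ((⟪e, D' t⟫ * ‖D t‖ - ⟪e, D t⟫ * (⟪D t, D' t⟫ / ‖D t‖)) / ‖D t‖ ^ 2) t := by
    have h1 : HasDerivAt (fun t => ⟪e, D t⟫) (⟪e, D' t⟫) t := by
      simpa using (hasDerivAt_const t e).inner ℝ ht
    convert! h1.div hnorm hn using 1
    ext s
    simp [real_inner_smul_right, div_eq_inv_mul]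
  set c := ⟪e, ‖D t‖⁻¹ • D t⟫ with hcdef
  have hc1 : c ∈ Icc (-1:ℝ) 1 := hmem _
  have hbound := abs_deriv_cos_le (D' t) he hx
  have hcc : ⟪e, D t⟫ / ‖D t‖ = c := by
    rw [hcdef, real_inner_smul_right, div_eq_inv_mul]
  rw [hcc] at hbound
  have hcsq : c ^ 2 ≤ 1 := by nlinarith [hc1.1, hc1.2]
  have h1 : l * c ≠ -1 := by nlinarith [hc1.1, hc1.2]
  have h2 : l * c ≠ 1 := by nlinarith [hc1.1, hc1.2]
  have hder := HasDerivAt.comp t (Real.hasDerivAt_arccos h1 h2) (hc.const_mul l)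
  rw [show (fun t => arccos (l * ⟪e, ‖D t‖⁻¹ • D t⟫)) =
    arccos ∘ fun t => l * ⟪e, ‖D t‖⁻¹ • D t⟫ from rfl, hder.deriv]
  rw [norm_mul, norm_neg, norm_mul, Real.norm_eq_abs, Real.norm_eq_abs, Real.norm_eq_abs,
    abs_of_pos hl0, abs_of_nonneg (by positivity)]
  have hs : 0 < √(1 - (l * c) ^ 2) := Real.sqrt_pos.2 (by
    nlinarith [mul_nonneg (sq_nonneg l) (sub_nonneg.2 hcsq)])
  have hs2 : l * √(1 - c ^ 2) ≤ √(1 - (l * c) ^ 2) := by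
    apply Real.le_sqrt_of_sq_le
    rw [mul_pow, Real.sq_sqrt (by linarith)]
    nlinarith
  have hv := angSpeed_nonneg (D t) (D' t)
  calc _ ≤ 1 / √(1 - (l * c) ^ 2) * (l * (√(1 - c ^ 2) * angSpeed (D t) (D' t))) := by gcongr
    _ = (l * √(1 - c ^ 2)) / √(1 - (l * c) ^ 2) * angSpeed (D t) (D' t) := by ring
    _ ≤ 1 * angSpeed (D t) (D' t) := by
        gcongr
        exact div_le_one_of_le₀ hs2 hs.le
    _ = _ := one_mul _

open InnerProductGeometry in
/-- The angle between the endpoints of a curve avoiding the origin is at most the length of its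
radial projection to the unit sphere. -/
theorem IsPrimitive.angle_le [CompleteSpace F] {D D' : ℝ → F} (h : IsPrimitive D D')
    {a b : ℝ} (hab : a ≤ b) (hne : ∀ t ∈ Icc a b, D t ≠ 0) :
    angle (D a) (D b) ≤ ∫ t in a..b, angSpeed (D t) (D' t) := by
  have ha : ‖D a‖ ≠ 0 := norm_ne_zero_iff.2 (hne a (left_mem_Icc.2 hab))
  set e := ‖D a‖⁻¹ • D a with he_def
  have he : ‖e‖ = 1 := by rw [he_def, norm_smul, norm_inv, norm_norm, inv_mul_cancel₀ ha]
  have hlim : Filter.Tendsto (fun l : ℝ => arccos (l * ⟪e, ‖D b‖⁻¹ • D b⟫) -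
      arccos (l * ⟪e, e⟫)) (nhdsWithin 1 (Iio 1))
      (nhds (arccos (1 * ⟪e, ‖D b‖⁻¹ • D b⟫) - arccos (1 * ⟪e, e⟫))) := by
    refine Filter.Tendsto.mono_left (Continuous.tendsto ?_ 1) nhdsWithin_le_nhds
    exact (Real.continuous_arccos.comp (by fun_prop)).sub (Real.continuous_arccos.comp (by fun_prop))
  have hval : arccos (1 * ⟪e, ‖D b‖⁻¹ • D b⟫) - arccos (1 * ⟪e, e⟫) = angle (D a) (D b) := by
    rw [one_mul, one_mul, real_inner_self_eq_norm_sq, he, one_pow, Real.arccos_one, sub_zero,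
      angle, he_def, real_inner_smul_left, real_inner_smul_right]
    congr 1
    field_simp
  rw [← hval]
  refine le_of_tendsto hlim ?_
  filter_upwards [Ioo_mem_nhdsLT (zero_lt_one' ℝ)] with l hl
  exact (le_abs_self _).trans (h.abs_arccos_sub_le hab hne he hl.1 hl.2)

end Primitive

section Convex

theorem ConvexOn.exists_support {f : ℝ → ℝ} (hf : ConvexOn ℝ (Ici 0) f)
    (hmono : MonotoneOn f (Ici 0)) {L : ℝ} (hL : 0 < L) :
    ∃ m : ℝ, 0 ≤ m ∧ ∀ x ∈ Ici (0:ℝ), f L + m * (x - L) ≤ f x := by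
  set S := (fun y => (f y - f L) / (y - L)) '' Ioi L with hS
  have hne : S.Nonempty := (nonempty_Ioi).image _
  have hLm : L ∈ Ici (0:ℝ) := hL.le
  have hnn : ∀ s ∈ S, 0 ≤ s := by
    rintro _ ⟨y, hy, rfl⟩
    have hy' : L < y := hy
    exact div_nonneg (sub_nonneg.2 (hmono hLm (hL.trans hy').le hy'.le)) (by linarith)
  refine ⟨sInf S, le_csInf hne hnn, fun x hx => ?_⟩
  rcases lt_trichotomy x L with h | rfl | h
  · have : (f L - f x) / (L - x) ≤ sInf S := by
      refine le_csInf hne ?_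
      rintro _ ⟨y, hy, rfl⟩
      exact hf.slope_mono_adjacent hx (hL.trans hy).le h hy
    rw [div_le_iff₀ (by linarith)] at this
    linarith
  · simp
  · have : sInf S ≤ (f x - f L) / (x - L) := csInf_le ⟨0, hnn⟩ ⟨x, h, rfl⟩
    rw [le_div_iff₀ (by linarith)] at this
    linarith

variable {α : Type*} [MeasurableSpace α] {μ : Measure α} [IsProbabilityMeasure μ] {f : ℝ → ℝ}
  {v : α → ℝ} {L : ℝ}

theorem ofReal_support_le {m : ℝ} (hpos : ∀ x ∈ Ici (0:ℝ), 0 ≤ f x) (hm : 0 ≤ m)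
    (hL : 0 < L) {x : ℝ} (hx : 0 ≤ x) (h : f L + m * (x - L) ≤ f x) :
    ENNReal.ofReal (f L) + ENNReal.ofReal m * ENNReal.ofReal x ≤
      ENNReal.ofReal (f x) + ENNReal.ofReal (m * L) := by
  rw [← ENNReal.ofReal_mul hm, ← ENNReal.ofReal_add (hpos L hL.le) (by positivity),
    ← ENNReal.ofReal_add (hpos x hx) (by positivity)]
  exact ENNReal.ofReal_le_ofReal (by linarith)

theorem lintegral_support {m : ℝ} (hm : 0 ≤ m)
    (hlow : ENNReal.ofReal L ≤ ∫⁻ x, ENNReal.ofReal (v x) ∂μ) :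
    ENNReal.ofReal (f L) + ENNReal.ofReal (m * L) ≤
      ∫⁻ x, (ENNReal.ofReal (f L) + ENNReal.ofReal m * ENNReal.ofReal (v x)) ∂μ := by
  rw [lintegral_add_left measurable_const, lintegral_const, measure_univ, mul_one,
    lintegral_const_mul' _ _ ENNReal.ofReal_ne_top, ENNReal.ofReal_mul hm]
  gcongr

/-- Jensen's inequality in the form of a lower bound by the value at a lower bound of the mean. -/
theorem ConvexOn.ofReal_le_lintegral (hf : ConvexOn ℝ (Ici 0) f)
    (hmono : MonotoneOn f (Ici 0)) (hpos : ∀ x ∈ Ici (0:ℝ), 0 ≤ f x) (hL : 0 < L)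
    (hv : ∀ x, 0 ≤ v x) (hlow : ENNReal.ofReal L ≤ ∫⁻ x, ENNReal.ofReal (v x) ∂μ) :
    ENNReal.ofReal (f L) ≤ ∫⁻ x, ENNReal.ofReal (f (v x)) ∂μ := by
  obtain ⟨m, hm, hsup⟩ := hf.exists_support hmono hL
  have h1 := (lintegral_support (f := f) hm hlow).trans
    (lintegral_mono fun x => ofReal_support_le hpos hm hL (hv x) (hsup _ (hv x)))
  rw [lintegral_add_right _ measurable_const, lintegral_const, measure_univ, mul_one] at h1
  exact (ENNReal.add_le_add_iff_right ENNReal.ofReal_ne_top).1 h1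

theorem StrictConvexOn.ae_eq_of_lintegral_eq (hf : StrictConvexOn ℝ (Ici 0) f)
    (hmono : MonotoneOn f (Ici 0)) (hpos : ∀ x ∈ Ici (0:ℝ), 0 ≤ f x) (hL : 0 < L)
    (hv : ∀ x, 0 ≤ v x) (hvm : AEMeasurable v μ)
    (hlow : ENNReal.ofReal L ≤ ∫⁻ x, ENNReal.ofReal (v x) ∂μ)
    (heq : ∫⁻ x, ENNReal.ofReal (f (v x)) ∂μ = ENNReal.ofReal (f L)) :
    ∀ᵐ x ∂μ, v x = L := by
  obtain ⟨m, hm, hsup⟩ := hf.convexOn.exists_support hmono hL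
  have hfm : Measurable fun x => f (max x 0) := by
    refine Monotone.measurable fun x y hxy => ?_
    exact hmono (le_max_right x 0) (le_max_right y 0) (max_le_max_right _ hxy)
  have hfv : AEMeasurable (fun x => f (v x)) μ := by
    have := hfm.comp_aemeasurable hvm
    refine this.congr (Filter.Eventually.of_forall fun x => ?_)
    simp [hv x]
  have hInt : ∫⁻ x, (ENNReal.ofReal (f (v x)) + ENNReal.ofReal (m * L)) ∂μ =
      ENNReal.ofReal (f L) + ENNReal.ofReal (m * L) := by
    rw [lintegral_add_right _ measurable_const, lintegral_const, measure_univ, mul_one, heq]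
  have hle : ∀ x, ENNReal.ofReal (f L) + ENNReal.ofReal m * ENNReal.ofReal (v x) ≤
      ENNReal.ofReal (f (v x)) + ENNReal.ofReal (m * L) :=
    fun x => ofReal_support_le hpos hm hL (hv x) (hsup _ (hv x))
  have hae := ae_eq_of_ae_le_of_lintegral_le (μ := μ) (Filter.Eventually.of_forall hle)
    (ne_top_of_le_ne_top (by rw [hInt]; simp) (lintegral_mono hle))
    (hfv.ennreal_ofReal.add_const _) (hInt.trans_le (lintegral_support hm hlow))
  filter_upwards [hae] with x hx
  rw [← ENNReal.ofReal_mul hm, ← ENNReal.ofReal_add (hpos L hL.le) (mul_nonneg hm (hv x)),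
    ← ENNReal.ofReal_add (hpos _ (hv x)) (by positivity),
    ENNReal.ofReal_eq_ofReal_iff (add_nonneg (hpos L hL.le) (mul_nonneg hm (hv x)))
      (add_nonneg (hpos _ (hv x)) (by positivity))] at hx
  by_contra hne
  obtain ⟨-, hf'⟩ := hf
  have hstr := hf' (hv x) hL.le hne (one_half_pos (α := ℝ)) (one_half_pos (α := ℝ)) (add_halves 1)
  have h2 := hsup (1 / 2 * v x + 1 / 2 * L) (by
    have := hv x
    simp only [mem_Ici]
    positivity)
  simp only [smul_eq_mul] at hstr
  linarith

end Convex

section Spherical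

open InnerProductGeometry Filter Topology

variable {F : Type*} [NormedAddCommGroup F] [InnerProductSpace ℝ F] {D D' : ℝ → F}

theorem tendsto_angle_pi {d : F} (hd : d ≠ 0) (h0 : HasDerivAt D d 0) (h1 : HasDerivAt D d 1)
    (hD0 : D 0 = 0) (hD1 : D 1 = 0) :
    Tendsto (fun ε => angle (D ε) (D (1 - ε))) (𝓝[>] 0) (𝓝 π) := by
  have t0 := h0.tendsto_slope_zero_right
  have t1 : Tendsto (fun ε : ℝ => (-ε)⁻¹ • (D (1 + -ε) - D 1)) (𝓝[>] 0) (𝓝 d) := by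
    refine h1.tendsto_slope_zero_left.comp ?_
    have := tendsto_neg_nhdsGT (a := (0 : ℝ))
    simpa using this
  have hc : ContinuousAt (fun y : F × F => angle y.1 y.2) (d, -d) :=
    continuousAt_angle (x := (d, -d)) hd (neg_ne_zero.2 hd)
  have := hc.tendsto.comp (t0.prodMk_nhds t1.neg)
  rw [angle_self_neg_of_nonzero hd] at this
  refine this.congr' ?_
  filter_upwards [self_mem_nhdsWithin] with ε hε
  have hε : 0 < ε := hε
  simp only [Function.comp_apply, zero_add, hD0, hD1, sub_zero]
  rw [angle_smul_left_of_pos _ _ (inv_pos.2 hε), ← neg_smul,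
    angle_smul_right_of_pos _ _ (by simpa using hε), sub_eq_add_neg]

theorem IsPrimitive.ofReal_angle_le [CompleteSpace F] (h : IsPrimitive D D') {a b : ℝ}
    (hab : a ≤ b) (hne : ∀ t ∈ Icc a b, D t ≠ 0) :
    ENNReal.ofReal (angle (D a) (D b)) ≤
      ∫⁻ t in Ioc a b, ENNReal.ofReal (angSpeed (D t) (D' t)) := by
  refine (ENNReal.ofReal_le_ofReal (h.angle_le hab hne)).trans ?_
  rw [intervalIntegral.integral_of_le hab, ofReal_integral_eq_lintegral_ofReal
    (h.intervalIntegrable_angSpeed hab hne).1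
    (Eventually.of_forall fun _ => angSpeed_nonneg _ _)]

theorem IsPrimitive.angle_le_of_ae_eq [CompleteSpace F] (h : IsPrimitive D D') {a b c : ℝ}
    (hab : a ≤ b) (hne : ∀ t ∈ Icc a b, D t ≠ 0)
    (hc : ∀ᵐ t, t ∈ Ioc a b → angSpeed (D t) (D' t) = c) :
    angle (D a) (D b) ≤ c * (b - a) := by
  refine (h.angle_le hab hne).trans_eq ?_
  rw [intervalIntegral.integral_congr_ae (g := fun _ => c) (by simpa [uIoc_of_le hab] using hc)]
  simp [mul_comm]

/-- A curve leaving the origin in direction `d` and returning to it with velocity `d` has radial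
projection of length at least `π`. -/
theorem IsPrimitive.ofReal_pi_le_lintegral [CompleteSpace F] (h : IsPrimitive D D') {d : F}
    (hd : d ≠ 0) (h0 : HasDerivAt D d 0) (h1 : HasDerivAt D d 1)
    (hD0 : D 0 = 0) (hD1 : D 1 = 0) (hne : ∀ t ∈ Ioo (0:ℝ) 1, D t ≠ 0) :
    ENNReal.ofReal π ≤ ∫⁻ t in Ioc (0:ℝ) 1, ENNReal.ofReal (angSpeed (D t) (D' t)) := by
  refine le_of_tendsto (ENNReal.tendsto_ofReal (tendsto_angle_pi hd h0 h1 hD0 hD1)) ?_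
  filter_upwards [Ioo_mem_nhdsGT (one_half_pos (α := ℝ))] with ε hε
  refine (h.ofReal_angle_le (by linarith [hε.2]) fun t ht => hne t
    ⟨hε.1.trans_le ht.1, by linarith [ht.2, hε.1]⟩).trans ?_
  exact lintegral_mono_set (Ioc_subset_Ioc hε.1.le (by linarith [hε.1]))

theorem IsPrimitive.angle_eq_of_ae_eq_pi [CompleteSpace F] (h : IsPrimitive D D') {d : F}
    (hd : d ≠ 0) (h0 : HasDerivAt D d 0) (h1 : HasDerivAt D d 1)
    (hD0 : D 0 = 0) (hD1 : D 1 = 0) (hne : ∀ t ∈ Ioo (0:ℝ) 1, D t ≠ 0)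
    (hc : ∀ᵐ t, t ∈ Ioc (0:ℝ) 1 → angSpeed (D t) (D' t) = π)
    {s t : ℝ} (hs : 0 < s) (hst : s ≤ t) (ht : t < 1) :
    angle (D s) (D t) = π * (t - s) := by
  have key : ∀ a b, 0 < a → a ≤ b → b < 1 → angle (D a) (D b) ≤ π * (b - a) := by
    intro a b ha hab hb
    refine h.angle_le_of_ae_eq hab (fun r hr => hne r ⟨ha.trans_le hr.1, hr.2.trans_lt hb⟩) ?_
    filter_upwards [hc] with r hr hrm using hr ⟨ha.trans hrm.1, hrm.2.trans hb.le⟩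
  refine le_antisymm (key s t hs hst ht) ?_
  suffices π ≤ π - π * (t - s) + angle (D s) (D t) by linarith
  refine le_of_tendsto (tendsto_angle_pi hd h0 h1 hD0 hD1) ?_
  filter_upwards [Ioo_mem_nhdsGT hs, Ioo_mem_nhdsGT (sub_pos.2 ht)] with ε hε hε'
  have e1 := angle_le_angle_add_angle (D ε) (D s) (D (1 - ε))
  have e2 := angle_le_angle_add_angle (D s) (D t) (D (1 - ε))
  have e3 := key ε s hε.1 hε.2.le (by linarith)
  have e4 := key t (1 - ε) (by linarith) (by linarith [hε'.2]) (by linarith [hε.1])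
  nlinarith [Real.pi_pos, hε.1]

theorem inner_add_eq (x y z : F) : ⟪‖x‖⁻¹ • x + ‖z‖⁻¹ • z, y⟫ =
    (‖x‖ / ‖x‖ * cos (angle x y) + ‖z‖ / ‖z‖ * cos (angle y z)) * ‖y‖ := by
  rw [inner_add_left, real_inner_smul_left, real_inner_smul_left, ← cos_angle_mul_norm_mul_norm x,
    real_inner_comm, ← cos_angle_mul_norm_mul_norm y]
  ring

theorem inner_pos_of_angle_add_lt {x y z : F} (hx : x ≠ 0) (hy : y ≠ 0) (hz : z ≠ 0)
    (h : angle x y + angle y z < π) : 0 < ⟪‖x‖⁻¹ • x + ‖z‖⁻¹ • z, y⟫ := by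
  rw [inner_add_eq, div_self (norm_ne_zero_iff.2 hx), div_self (norm_ne_zero_iff.2 hz)]
  have := Real.cos_lt_cos_of_nonneg_of_le_pi (angle_nonneg x y)
    (by linarith [angle_nonneg y z]) (show angle x y < π - angle y z by linarith)
  rw [Real.cos_pi_sub] at this
  have hy := norm_pos_iff.2 hy
  nlinarith

theorem inner_nonneg_of_angle_add_le {x y z : F} (hx : x ≠ 0) (hz : z ≠ 0)
    (h : angle x y + angle y z ≤ π) : 0 ≤ ⟪‖x‖⁻¹ • x + ‖z‖⁻¹ • z, y⟫ := by
  rw [inner_add_eq, div_self (norm_ne_zero_iff.2 hx), div_self (norm_ne_zero_iff.2 hz)]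
  have := Real.cos_le_cos_of_nonneg_of_le_pi (angle_nonneg x y)
    (by linarith [angle_nonneg y z]) (show angle x y ≤ π - angle y z by linarith)
  rw [Real.cos_pi_sub] at this
  have hy := norm_nonneg y
  nlinarith

theorem integral_inner_eq_zero [CompleteSpace F] (hcont : Continuous D)
    (hmean : ∫ t in (0:ℝ)..1, D t = 0) (e : F) : ∫ t in (0:ℝ)..1, ⟪e, D t⟫ = 0 := by
  have := (innerSL ℝ e).intervalIntegral_comp_comm (hcont.intervalIntegrable (μ := volume) 0 1)
  simpa [hmean] using this

/-- A closed curve of mean zero avoiding the origin has radial projection of length at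
least `2π`. -/
theorem IsPrimitive.two_pi_le_integral [CompleteSpace F] (h : IsPrimitive D D')
    (hclosed : D 1 = D 0) (hne : ∀ t, D t ≠ 0) (hmean : ∫ t in (0:ℝ)..1, D t = 0) :
    2 * π ≤ ∫ t in (0:ℝ)..1, angSpeed (D t) (D' t) := by
  by_contra! hlt
  set v := fun t => angSpeed (D t) (D' t) with hv
  have hInt : ∀ a b, a ≤ b → IntervalIntegrable v volume a b := fun a b hab =>
    h.intervalIntegrable_angSpeed hab fun t _ => hne t
  have hL : 0 ≤ ∫ t in (0:ℝ)..1, v t :=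
    intervalIntegral.integral_nonneg zero_le_one fun _ _ => angSpeed_nonneg _ _
  have hcont : ContinuousOn (fun t => ∫ s in (0:ℝ)..t, v s) (Icc 0 1) := by
    have := intervalIntegral.continuousOn_primitive_interval (μ := volume) (f := v) (a := 0) (b := 1)
      (by rw [uIcc_of_le zero_le_one, integrableOn_Icc_iff_integrableOn_Ioc]
          exact (hInt 0 1 zero_le_one).1)
    rwa [uIcc_of_le zero_le_one] at this
  obtain ⟨m, hm, hmL⟩ := intermediate_value_Icc zero_le_one hcont
    (show (∫ t in (0:ℝ)..1, v t) / 2 ∈ Icc _ _ by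
      simp only [intervalIntegral.integral_same]
      constructor <;> linarith)
  have hadd : ∀ a b c, a ≤ b → b ≤ c →
      angle (D a) (D b) + angle (D b) (D c) ≤ ∫ t in a..c, v t := by
    intro a b c hab hbc
    rw [← integral_add_adjacent_intervals (hInt a b hab) (hInt b c hbc)]
    exact add_le_add (h.angle_le hab fun t _ => hne t) (h.angle_le hbc fun t _ => hne t)
  have hm1 : ∫ t in m..(1:ℝ), v t = (∫ t in (0:ℝ)..1, v t) / 2 := by
    have := integral_add_adjacent_intervals (hInt 0 m hm.1) (hInt m 1 hm.2)
    simp only at hmL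
    linarith
  have hpos : ∀ t ∈ Ioo (0:ℝ) 1,
      0 < ⟪‖D 0‖⁻¹ • D 0 + ‖D m‖⁻¹ • D m, D t⟫ := by
    intro t ht
    apply inner_pos_of_angle_add_lt (hne _) (hne _) (hne _)
    rcases le_total t m with htm | htm
    · have := hadd 0 t m ht.1.le htm
      simp only at hmL
      linarith
    · have := hadd m t 1 htm ht.2.le
      rw [hclosed] at this
      linarith [angle_comm (D 0) (D t), angle_comm (D t) (D m)]
  have h1 := intervalIntegral.intervalIntegral_pos_of_pos_on
    ((continuous_const.inner h.continuous).intervalIntegrable 0 1) hpos zero_lt_one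
  rw [integral_inner_eq_zero h.continuous hmean] at h1
  exact lt_irrefl _ h1

theorem IsPrimitive.angle_zero_eq_of_ae_eq_two_pi [CompleteSpace F] (h : IsPrimitive D D')
    (hclosed : D 1 = D 0) (hne : ∀ t, D t ≠ 0) (hmean : ∫ t in (0:ℝ)..1, D t = 0)
    (hc : ∀ᵐ t, angSpeed (D t) (D' t) = 2 * π) {t : ℝ} (ht0 : 0 ≤ t) (ht1 : t ≤ 1 / 2) :
    angle (D 0) (D t) = 2 * π * t := by
  have key : ∀ a b, a ≤ b → angle (D a) (D b) ≤ 2 * π * (b - a) := fun a b hab =>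
    h.angle_le_of_ae_eq hab (fun r _ => hne r) (hc.mono fun _ hr _ => hr)
  have hnn : ∀ t ∈ Icc (0:ℝ) 1,
      0 ≤ ⟪‖D 0‖⁻¹ • D 0 + ‖D (1 / 2)‖⁻¹ • D (1 / 2), D t⟫ := by
    intro t ht
    apply inner_nonneg_of_angle_add_le (hne _) (hne _)
    rcases le_total t (1 / 2) with htm | htm
    · linarith [key 0 t ht.1, key t (1 / 2) htm]
    · have := key t 1 ht.2
      rw [hclosed] at this
      linarith [key (1 / 2) t htm, angle_comm (D 0) (D t), angle_comm (D t) (D (1 / 2))]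
  have h0 : ⟪‖D 0‖⁻¹ • D 0 + ‖D (1 / 2)‖⁻¹ • D (1 / 2), D 0⟫ = 0 := by
    by_contra hne0
    have := intervalIntegral.integral_pos zero_lt_one
      (continuous_const.inner h.continuous).continuousOn
      (fun t ht => hnn t (Ioc_subset_Icc_self ht)) ⟨0, by simp,
        lt_of_le_of_ne (hnn 0 (by simp)) (Ne.symm hne0)⟩
    rw [integral_inner_eq_zero h.continuous hmean] at this
    exact lt_irrefl _ this
  rw [inner_add_eq, angle_self (hne 0), div_self (norm_ne_zero_iff.2 (hne _)),
    div_self (norm_ne_zero_iff.2 (hne _)), mul_eq_zero, cos_zero,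
    or_iff_left (norm_ne_zero_iff.2 (hne _))] at h0
  have hpi : angle (D 0) (D (1 / 2)) = π := by
    apply Real.injOn_cos ⟨angle_nonneg _ _, angle_le_pi _ _⟩ ⟨Real.pi_pos.le, le_rfl⟩
    rw [Real.cos_pi]
    linarith
  have := angle_le_angle_add_angle (D 0) (D t) (D (1 / 2))
  linarith [key 0 t ht0, key t (1 / 2) ht1]

theorem IsPrimitive.cos_angle_eq_of_ae_eq_two_pi [CompleteSpace F] (h : IsPrimitive D D')
    (hper : Function.Periodic D 1) (hne : ∀ t, D t ≠ 0) (hmean : ∫ t in (0:ℝ)..1, D t = 0)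
    (hc : ∀ᵐ t, angSpeed (D t) (D' t) = 2 * π) (s t : ℝ) :
    cos (angle (D s) (D t)) = cos (2 * π * (t - s)) := by
  have key : ∀ s r : ℝ, 0 ≤ r → r ≤ 1 / 2 → angle (D s) (D (s + r)) = 2 * π * r := by
    intro s r hr0 hr1
    have := (h.comp_const_add s).angle_zero_eq_of_ae_eq_two_pi (by simp [hper s])
      (fun t => hne _) ?_ ?_ hr0 hr1
    · simpa using this
    · rw [intervalIntegral.integral_comp_add_left D]
      have := hper.intervalIntegral_add_eq (s + 0) 0
      rw [zero_add, add_assoc, zero_add] at this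
      rw [this, hmean]
    · exact (measurePreserving_add_left volume s).quasiMeasurePreserving.ae hc
  obtain ⟨r, k, hr0, hr1, hk⟩ : ∃ (r : ℝ) (k : ℤ), 0 ≤ r ∧ r < 1 ∧ t = s + r + k := by
    refine ⟨Int.fract (t - s), ⌊t - s⌋, Int.fract_nonneg _, Int.fract_lt_one _, ?_⟩
    rw [add_assoc, Int.fract_add_floor]
    ring
  have hDt : D t = D (s + r) := by
    rw [hk]
    simpa using (hper.int_mul k) (s + r)
  have hcos : cos (2 * π * (t - s)) = cos (2 * π * r) := by
    rw [hk, show 2 * π * (s + r + k - s) = 2 * π * r + k * (2 * π) by ring,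
      Real.cos_add_int_mul_two_pi]
  rw [hDt, hcos]
  rcases le_total r (1 / 2) with hr | hr
  · rw [key s r hr0 hr]
  · have := key (s + r) (1 - r) (by linarith) (by linarith)
    rw [show s + r + (1 - r) = s + 1 by ring, hper s] at this
    rw [angle_comm, this, show 2 * π * (1 - r) = 2 * π - 2 * π * r by ring,
      Real.cos_two_pi_sub]

end Spherical

theorem ae_of_ae_mem_Ioc {p : ℝ → Prop} (hper : ∀ t, p (t + 1) ↔ p t)
    (h : ∀ᵐ t : ℝ, t ∈ Ioc (0:ℝ) 1 → p t) : ∀ᵐ t : ℝ, p t := by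
  have hz : ∀ (k : ℤ) t, p (t + k) ↔ p t := by
    intro k
    induction k using Int.induction_on with
    | zero => simp
    | succ i hi => intro t; rw [← hi t, ← hper (t + (i : ℤ)), add_assoc t]; push_cast; rfl
    | pred i hi =>
      intro t
      rw [← hi t, ← hper (t + _), add_assoc t]
      push_cast
      rw [sub_add_cancel]
  have h' : ∀ᵐ t : ℝ, ∀ k : ℤ, t + k ∈ Ioc (0:ℝ) 1 → p (t + k) := ae_all_iff.2 fun k =>
    (measurePreserving_add_right volume (k : ℝ)).quasiMeasurePreserving.ae h
  filter_upwards [h'] with t ht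
  have := ht (-(⌈t⌉ - 1)) ⟨by push_cast; linarith [Int.ceil_lt_add_one t],
    by push_cast; linarith [Int.le_ceil t]⟩
  rwa [hz] at this

theorem continuous_angle_of_ne_zero {F : Type*} [NormedAddCommGroup F] [InnerProductSpace ℝ F]
    {X : Type*} [TopologicalSpace X] {A B : X → F} (hA : Continuous A) (hB : Continuous B)
    (hA0 : ∀ x, A x ≠ 0) (hB0 : ∀ x, B x ≠ 0) :
    Continuous fun x => InnerProductGeometry.angle (A x) (B x) := by
  refine continuous_iff_continuousAt.2 fun x => ?_
  have := InnerProductGeometry.continuousAt_angle (x := (A x, B x)) (hA0 x) (hB0 x)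
  exact this.comp₂ hA.continuousAt hB.continuousAt

instance isProbabilityMeasure_restrict_Ioc : IsProbabilityMeasure (volume.restrict (Ioc (0:ℝ) 1)) :=
  ⟨by simp⟩

namespace ClosedCurve

open Filter Topology InnerProductGeometry

variable {n : ℕ} (γ : ClosedCurve n)

theorem isPrimitive : IsPrimitive γ.toFun γ.deriv' := by
  refine ⟨fun a b => γ.deriv'_periodic.intervalIntegrable₀ one_ne_zero ?_ a b, γ.eq_integral⟩
  rw [intervalIntegrable_iff_integrableOn_Icc_of_le zero_le_one]
  exact γ.integrableOn

theorem continuous_toFun : Continuous γ.toFun := γ.isPrimitive.continuous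

theorem gaussDerivW_eq (u w : ℝ) : gaussDerivW γ u w =
    angSpeed (γ.toFun (u + w) - γ.toFun u) (γ.deriv' (u + w)) := by
  rw [gaussDerivW, gaussMap, projPerp_inv_norm_smul, angSpeed]

theorem gaussDerivU_eq (u w : ℝ) : gaussDerivU γ u w =
    angSpeed (γ.toFun (u + w) - γ.toFun u) (γ.deriv' (u + w) - γ.deriv' u) := by
  rw [gaussDerivU, gaussMap, projPerp_inv_norm_smul, angSpeed]

theorem isPrimitive_chord_right (u : ℝ) :
    IsPrimitive (fun w => γ.toFun (u + w) - γ.toFun u) (fun w => γ.deriv' (u + w)) :=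
  (γ.isPrimitive.comp_const_add u).sub_const _

theorem isPrimitive_chord (w : ℝ) :
    IsPrimitive (fun u => γ.toFun (u + w) - γ.toFun u)
      (fun u => γ.deriv' (u + w) - γ.deriv' u) := by
  simpa [add_comm w] using (γ.isPrimitive.comp_const_add w).sub γ.isPrimitive

variable {γ}

theorem IsInj.chord_ne_zero (h : γ.IsInj) (u : ℝ) {w : ℝ} (hw : w ∈ Ioo (0:ℝ) 1) :
    γ.toFun (u + w) - γ.toFun u ≠ 0 := by
  intro h0
  obtain ⟨k, hk⟩ := h _ _ (sub_eq_zero.1 h0)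
  rw [add_sub_cancel_left] at hk
  have h1 : (0 : ℤ) < k := by exact_mod_cast hk ▸ hw.1
  have h2 : k < (1 : ℤ) := by exact_mod_cast hk ▸ hw.2
  omega

variable (γ) in
theorem periodic_chord (w : ℝ) :
    Function.Periodic (fun u => γ.toFun (u + w) - γ.toFun u) 1 := fun u => by
  have := γ.periodic (u + w)
  simp only [γ.periodic u]
  rw [← this]
  ring_nf

variable (γ) in
theorem periodic_gaussDerivU (w : ℝ) : Function.Periodic (fun u => gaussDerivU γ u w) 1 :=
  fun u => by
    have h1 := γ.deriv'_periodic (u + w)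
    have h2 := γ.periodic_chord w u
    simp only [gaussDerivU_eq] at h2 ⊢
    rw [h2, γ.deriv'_periodic u, ← h1, add_right_comm]

variable (γ) in
theorem integral_chord_eq_zero (w : ℝ) :
    ∫ u in (0:ℝ)..1, (γ.toFun (u + w) - γ.toFun u) = 0 := by
  have hi : ∀ a b, IntervalIntegrable γ.toFun volume a b :=
    fun a b => γ.continuous_toFun.intervalIntegrable a b
  rw [intervalIntegral.integral_sub
    (Continuous.intervalIntegrable (by have := γ.continuous_toFun; fun_prop) 0 1) (hi 0 1),
    intervalIntegral.integral_comp_add_right γ.toFun, sub_eq_zero]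
  have := γ.periodic.intervalIntegral_add_eq w 0
  simpa [add_comm] using this

theorem hasDerivAt_chord {u : ℝ} (hd : HasDerivAt γ.toFun (γ.deriv' u) u) :
    HasDerivAt (fun w => γ.toFun (u + w) - γ.toFun u) (γ.deriv' u) 0 ∧
    HasDerivAt (fun w => γ.toFun (u + w) - γ.toFun u) (γ.deriv' u) 1 := by
  constructor
  · refine HasDerivAt.sub_const _ (HasDerivAt.comp_const_add u 0 (by simpa using hd))
  · refine HasDerivAt.sub_const _ (HasDerivAt.comp_const_add u 1 ?_)
    have := HasDerivAt.comp_sub_const (u + 1) 1 (f := γ.toFun) (f' := γ.deriv' u)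
      (by simpa using hd)
    simpa [γ.periodic.sub_eq] using this

theorem IsInj.ofReal_pi_le (h : γ.IsInj) {u : ℝ} (hd : HasDerivAt γ.toFun (γ.deriv' u) u)
    (hne : γ.deriv' u ≠ 0) :
    ENNReal.ofReal π ≤ ∫⁻ w in Ioc (0:ℝ) 1, ENNReal.ofReal (gaussDerivW γ u w) := by
  simp only [gaussDerivW_eq]
  have h01 := hasDerivAt_chord hd
  exact (γ.isPrimitive_chord_right u).ofReal_pi_le_lintegral hne h01.1 h01.2 (by simp)
    (by simp [γ.periodic u]) fun w hw => h.chord_ne_zero u hw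

theorem IsInj.ofReal_two_pi_le (h : γ.IsInj) {w : ℝ} (hw : w ∈ Ioo (0:ℝ) 1) :
    ENNReal.ofReal (2 * π) ≤ ∫⁻ u in Ioc (0:ℝ) 1, ENNReal.ofReal (gaussDerivU γ u w) := by
  simp only [gaussDerivU_eq]
  have hp := γ.isPrimitive_chord w
  refine (ENNReal.ofReal_le_ofReal (hp.two_pi_le_integral
    (by simpa using γ.periodic_chord w 0) (fun u => h.chord_ne_zero u hw)
    (γ.integral_chord_eq_zero w))).trans ?_
  rw [intervalIntegral.integral_of_le zero_le_one, ofReal_integral_eq_lintegral_ofReal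
    (hp.intervalIntegrable_angSpeed zero_le_one fun u _ => h.chord_ne_zero u hw).1
    (Eventually.of_forall fun _ => angSpeed_nonneg _ _)]

variable (γ) in
theorem aemeasurable_gaussDerivW (u : ℝ) :
    AEMeasurable (gaussDerivW γ u) (volume.restrict (Ioc (0:ℝ) 1)) := by
  rw [funext (γ.gaussDerivW_eq u)]
  exact ((γ.isPrimitive_chord_right u).aestronglyMeasurable_angSpeed 0 1).aemeasurable

variable (γ) in
theorem aemeasurable_gaussDerivU (w : ℝ) :
    AEMeasurable (fun u => gaussDerivU γ u w) (volume.restrict (Ioc (0:ℝ) 1)) := by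
  simp only [gaussDerivU_eq]
  exact ((γ.isPrimitive_chord w).aestronglyMeasurable_angSpeed 0 1).aemeasurable

/-- Constant angular speed `π` of the chords from almost every base point determines all angles
between chords. -/
theorem IsInj.angle_chord_eq (h : γ.IsInj) (hreg : γ.IsRegular)
    (hc : ∀ᵐ u, ∀ᵐ w ∂volume.restrict (Ioc (0:ℝ) 1), gaussDerivW γ u w = π)
    {s t : ℝ} (hs : 0 < s) (hst : s ≤ t) (ht : t < 1) (u : ℝ) :
    angle (γ.toFun (u + s) - γ.toFun u) (γ.toFun (u + t) - γ.toFun u) = π * (t - s) := by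
  have hae : ∀ᵐ u, angle (γ.toFun (u + s) - γ.toFun u) (γ.toFun (u + t) - γ.toFun u) =
      π * (t - s) := by
    filter_upwards [hc, hreg, γ.isPrimitive.ae_hasDerivAt] with u hu hr hd
    have h01 := hasDerivAt_chord hd
    simp only [gaussDerivW_eq] at hu
    exact (γ.isPrimitive_chord_right u).angle_eq_of_ae_eq_pi hr h01.1 h01.2 (by simp)
      (by simp [γ.periodic u]) (fun w hw => h.chord_ne_zero u hw)
      ((ae_restrict_iff' measurableSet_Ioc).1 hu) hs hst ht
  have hcont : Continuous fun u =>
      angle (γ.toFun (u + s) - γ.toFun u) (γ.toFun (u + t) - γ.toFun u) := by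
    exact continuous_angle_of_ne_zero (γ.isPrimitive_chord s).continuous
      (γ.isPrimitive_chord t).continuous (fun u => h.chord_ne_zero u ⟨hs, hst.trans_lt ht⟩)
      fun u => h.chord_ne_zero u ⟨hs.trans_le hst, ht⟩
  exact congrFun (Continuous.ae_eq_iff_eq volume hcont continuous_const |>.1 hae) u

theorem IsInj.cos_angle_chord_eq (h : γ.IsInj) {w : ℝ} (hw : w ∈ Ioo (0:ℝ) 1)
    (hc : ∀ᵐ u ∂volume.restrict (Ioc (0:ℝ) 1), gaussDerivU γ u w = 2 * π) (s t : ℝ) :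
    cos (angle (γ.toFun (s + w) - γ.toFun s) (γ.toFun (t + w) - γ.toFun t)) =
      cos (2 * π * (t - s)) := by
  have hc' : ∀ᵐ u, gaussDerivU γ u w = 2 * π :=
    ae_of_ae_mem_Ioc (fun t => Eq.congr_left (γ.periodic_gaussDerivU w t))
      ((ae_restrict_iff' measurableSet_Ioc).1 hc)
  simp only [gaussDerivU_eq] at hc'
  exact (γ.isPrimitive_chord w).cos_angle_eq_of_ae_eq_two_pi (γ.periodic_chord w)
    (fun u => h.chord_ne_zero u hw) (γ.integral_chord_eq_zero w) hc' s t

end ClosedCurve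

theorem norm_add_eq_of_periodic {F : Type*} [NormedAddCommGroup F] {D : ℝ → F} {w : ℝ} (hcont : Continuous D)
    (hper : Function.Periodic D 1) (hD0 : ∀ t, D t ≠ 0)
    (h : ∀ s t, ‖D s‖ * ‖D (t + w)‖ = ‖D (s + w)‖ * ‖D t‖) (s : ℝ) : ‖D (s + w)‖ = ‖D s‖ := by
  have hpos : 0 < ∫ t in (0:ℝ)..1, ‖D t‖ :=
    intervalIntegral.intervalIntegral_pos_of_pos_on (hcont.norm.intervalIntegrable 0 1)
      (fun t _ => norm_pos_iff.2 (hD0 t)) zero_lt_one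
  have hshift : ∫ t in (0:ℝ)..1, ‖D (t + w)‖ = ∫ t in (0:ℝ)..1, ‖D t‖ := by
    rw [intervalIntegral.integral_comp_add_right fun t => ‖D t‖]
    have := (hper.comp norm).intervalIntegral_add_eq w 0
    simpa [add_comm] using this
  have : ∫ t in (0:ℝ)..1, ‖D s‖ * ‖D (t + w)‖ = ∫ t in (0:ℝ)..1, ‖D (s + w)‖ * ‖D t‖ := by
    simp only [h s]
  rw [intervalIntegral.integral_const_mul, intervalIntegral.integral_const_mul, hshift] at this
  exact (mul_right_cancel₀ hpos.ne' this).symm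

section TwoPi

variable {F : Type*} [NormedAddCommGroup F] [InnerProductSpace ℝ F]

theorem norm_mul_norm_add_eq {D : ℝ → F} {w : ℝ} (hD0 : ∀ t, D t ≠ 0)
    (hw : sin (2 * π * w) ≠ 0)
    (hD : ∀ s t, ⟪D s, D t⟫ = ‖D s‖ * ‖D t‖ * cos (2 * π * (t - s)))
    (hE : ∀ s t, ⟪D s + D (s + w), D t + D (t + w)⟫ =
      ‖D s + D (s + w)‖ * ‖D t + D (t + w)‖ * cos (2 * π * (t - s))) (s t : ℝ) :
    ‖D s‖ * ‖D (t + w)‖ = ‖D (s + w)‖ * ‖D t‖ := by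
  have expand : ∀ s t, (‖D s‖ * ‖D t‖ + ‖D (s + w)‖ * ‖D (t + w)‖) * cos (2 * π * (t - s)) +
      ‖D s‖ * ‖D (t + w)‖ * cos (2 * π * (t - s) + 2 * π * w) +
      ‖D (s + w)‖ * ‖D t‖ * cos (2 * π * (t - s) - 2 * π * w) =
      ‖D s + D (s + w)‖ * ‖D t + D (t + w)‖ * cos (2 * π * (t - s)) := by
    intro s t
    rw [← hE s t, inner_add_left, inner_add_right, inner_add_right, hD, hD, hD, hD,
      show 2 * π * (t + w - s) = 2 * π * (t - s) + 2 * π * w by ring,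
      show 2 * π * (t - (s + w)) = 2 * π * (t - s) - 2 * π * w by ring,
      show 2 * π * (t + w - (s + w)) = 2 * π * (t - s) by ring]
    ring
  have hsq : ∀ t, ‖D t + D (t + w)‖ ^ 2 =
      ‖D t‖ ^ 2 + ‖D (t + w)‖ ^ 2 + 2 * (‖D t‖ * ‖D (t + w)‖) * cos (2 * π * w) := by
    intro t
    rw [norm_add_sq_real, hD, add_sub_cancel_left]
    ring
  have quarter : ∀ s, ‖D s‖ * ‖D (s + 1 / 4 + w)‖ = ‖D (s + w)‖ * ‖D (s + 1 / 4)‖ := by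
    intro s
    have h := expand s (s + 1 / 4)
    rw [show 2 * π * (s + 1 / 4 - s) = π / 2 by ring, add_comm (π / 2), Real.cos_add_pi_div_two,
      Real.cos_pi_div_two_sub, Real.cos_pi_div_two] at h
    have : (‖D s‖ * ‖D (s + 1 / 4 + w)‖ - ‖D (s + w)‖ * ‖D (s + 1 / 4)‖) *
      sin (2 * π * w) = 0 := by linarith
    rcases mul_eq_zero.1 this with h | h
    · linarith
    · exact absurd h hw
  have hq := quarter t
  have hpos := norm_pos_iff.2 (hD0 (t + 1 / 4))
  have hN : ‖D (t + 1 / 4) + D (t + 1 / 4 + w)‖ * ‖D t‖ = ‖D t + D (t + w)‖ * ‖D (t + 1 / 4)‖ := by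
    rw [← sq_eq_sq₀ (by positivity) (by positivity), mul_pow, mul_pow, hsq, hsq]
    linear_combination (‖D t‖ * ‖D (t + 1 / 4 + w)‖ + ‖D (t + w)‖ * ‖D (t + 1 / 4)‖ +
      2 * ‖D t‖ * ‖D (t + 1 / 4)‖ * cos (2 * π * w)) * hq
  have e1 := expand s t
  have e2 := expand s (t + 1 / 4)
  rw [show 2 * π * (t + 1 / 4 - s) = 2 * π * (t - s) + π / 2 by ring,
    add_right_comm _ (π / 2), add_sub_right_comm _ (π / 2), Real.cos_add_pi_div_two,
    Real.cos_add_pi_div_two,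
    Real.cos_add_pi_div_two, Real.sin_add, Real.sin_sub] at e2
  rw [Real.cos_add, Real.cos_sub] at e1
  have hcs := Real.sin_sq_add_cos_sq (2 * π * (t - s))
  set a := ‖D s‖
  set a' := ‖D (s + w)‖
  set b := ‖D t‖
  set b' := ‖D (t + w)‖
  set b2 := ‖D (t + 1 / 4)‖
  set b2' := ‖D (t + 1 / 4 + w)‖
  set S := sin (2 * π * (t - s))
  set C := cos (2 * π * (t - s))
  set cw := cos (2 * π * w)
  set sw := sin (2 * π * w)
  set N := ‖D s + D (s + w)‖
  set Nt := ‖D t + D (t + w)‖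
  set N2 := ‖D (t + 1 / 4) + D (t + 1 / 4 + w)‖
  have h0 : b2 * sw * (a * b' - a' * b) = 0 := by
    linear_combination (-b2 * S) * e1 - b * C * e2 + N * C * S * hN +
      (-(a' * S * C) - a * C * (S * cw + C * sw)) * hq - b2 * sw * (a * b' - a' * b) * hcs
  rcases mul_eq_zero.1 h0 with h | h
  · rcases mul_eq_zero.1 h with h | h
    · exact absurd h hpos.ne'
    · exact absurd h hw
  · linarith

end TwoPi

namespace ClosedCurve

open Filter Topology InnerProductGeometry

variable {n : ℕ} {γ : ClosedCurve n}

/-- Chord lengths are those of a circle of diameter `K` parametrized with constant speed. -/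
def HasCircularChords (γ : ClosedCurve n) (K : ℝ) : Prop :=
  0 < K ∧ ∀ s t, ‖γ.toFun s - γ.toFun t‖ = K * |sin (π * (s - t))|

theorem IsInj.hasCircularChords (h : γ.IsInj) {k : ℝ → ℝ}
    (hk : ∀ u, ∀ w ∈ Ioo (0:ℝ) 1, ‖γ.toFun (u + w) - γ.toFun u‖ = k u * sin (π * w))
    (hk' : ∀ u, ∀ w ∈ Ioo (0:ℝ) (1 / 2), k (u + w) = k u) :
    ∃ K, γ.HasCircularChords K := by
  have hconst : ∀ x, 0 ≤ x → ∀ u, k (u + x) = k u := by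
    intro x hx u
    obtain ⟨N, hN⟩ := exists_nat_gt (2 * x)
    rcases hx.eq_or_lt with rfl | hx
    · simp
    have hN0 : (0:ℝ) < N := by linarith
    have hp : Function.Periodic k (x / N) := fun u => hk' u _ ⟨by positivity, by
      rw [div_lt_iff₀ hN0]; linarith⟩
    have := hp.nat_mul N u
    rwa [mul_div_cancel₀ _ hN0.ne'] at this
  have hk0 : ∀ u, k u = k 0 := by
    intro u
    rcases le_total 0 u with hu | hu
    · simpa using hconst u hu 0
    · simpa using (hconst (-u) (by linarith) u).symm
  refine ⟨k 0, ?_, fun s t => ?_⟩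
  · have := hk 0 (1 / 2) (by norm_num)
    rw [show π * (1 / 2) = π / 2 by ring, Real.sin_pi_div_two, mul_one] at this
    rw [← this]
    exact norm_pos_iff.2 (h.chord_ne_zero 0 (by norm_num))
  · have hst : s = t + Int.fract (s - t) + ⌊s - t⌋ := by
      rw [add_assoc, Int.fract_add_floor]
      ring
    have h1 : γ.toFun s = γ.toFun (t + Int.fract (s - t)) := by
      conv_lhs => rw [hst]
      simpa using (γ.periodic.int_mul ⌊s - t⌋) (t + Int.fract (s - t))
    have h2 : |sin (π * (s - t))| = |sin (π * Int.fract (s - t))| := by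
      rw [← Real.sqrt_sq_eq_abs, ← Real.sqrt_sq_eq_abs, Real.sin_sq_eq_half_sub,
        Real.sin_sq_eq_half_sub]
      conv_lhs => rw [← Int.fract_add_floor (s - t),
        show 2 * (π * (Int.fract (s - t) + ⌊s - t⌋)) =
          2 * (π * Int.fract (s - t)) + ⌊s - t⌋ * (2 * π) by ring, Real.cos_add_int_mul_two_pi]
    have hf0 := Int.fract_nonneg (s - t)
    have hf1 := Int.fract_lt_one (s - t)
    rw [h1, h2]
    rcases hf0.eq_or_lt with hf | hf
    · simp [← hf]
    · rw [hk t _ ⟨hf, hf1⟩, hk0 t, abs_of_nonneg]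
      exact Real.sin_nonneg_of_nonneg_of_le_pi (by positivity)
        (by nlinarith [Real.pi_pos])

theorem sin_pi_mul_pos {w : ℝ} (hw : w ∈ Ioo (0:ℝ) 1) : 0 < sin (π * w) :=
  Real.sin_pos_of_pos_of_lt_pi (mul_pos Real.pi_pos hw.1) (by nlinarith [Real.pi_pos, hw.2])

/-- Rigidity for `∂_w`: the inscribed angles determine the chord lengths by the law of sines. -/
theorem IsInj.hasCircularChords_of_gaussDerivW (h : γ.IsInj) (hreg : γ.IsRegular)
    (hc : ∀ᵐ u, ∀ᵐ w ∂volume.restrict (Ioc (0:ℝ) 1), gaussDerivW γ u w = π) :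
    ∃ K, γ.HasCircularChords K := by
  have ang := fun {s t : ℝ} => h.angle_chord_eq hreg hc (s := s) (t := t)
  have law : ∀ u s t, 0 < s → s < t → t < 1 →
      sin (π * t) * ‖γ.toFun (u + s) - γ.toFun u‖ =
        sin (π * s) * ‖γ.toFun (u + t) - γ.toFun u‖ ∧
      sin (π * t) * ‖γ.toFun (u + t) - γ.toFun (u + s)‖ =
        sin (π * (t - s)) * ‖γ.toFun (u + t) - γ.toFun u‖ := by
    intro u s t hs hst ht
    have aA := ang hs hst.le ht u
    have aB := ang (s := t - s) (t := 1 - s) (by linarith) (by linarith) (by linarith) (u + s)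
    have aC := ang (s := 1 - t) (t := 1 - t + s) (by linarith) (by linarith) (by linarith) (u + t)
    rw [show u + s + (t - s) = u + t by ring, show u + s + (1 - s) = u + 1 by ring,
      γ.periodic u] at aB
    rw [show u + t + (1 - t) = u + 1 by ring, show u + t + (1 - t + s) = u + s + 1 by ring,
      γ.periodic u, γ.periodic (u + s)] at aC
    have sB : sin (π * (1 - s - (t - s))) = sin (π * t) := by
      rw [← Real.sin_pi_sub]
      ring_nf
    have sC : sin (π * (1 - t + s - (1 - t))) = sin (π * s) := by ring_nf
    have l1 := EuclideanGeometry.law_sin (γ.toFun (u + s)) (γ.toFun u) (γ.toFun (u + t))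
    have l2 := EuclideanGeometry.law_sin (γ.toFun (u + t)) (γ.toFun (u + s)) (γ.toFun u)
    simp only [EuclideanGeometry.angle, vsub_eq_sub, dist_eq_norm, aA, aB, aC, sB, sC] at l1 l2
    rw [norm_sub_rev (γ.toFun u)] at l1 l2
    exact ⟨l2, l1.symm⟩
  refine h.hasCircularChords
    (k := fun u => ‖γ.toFun (u + 1 / 2) - γ.toFun u‖) ?_ ?_
  · intro u w hw
    rcases lt_trichotomy w (1 / 2) with hlt | rfl | hlt
    · have := (law u w (1 / 2) hw.1 hlt (by norm_num)).1
      rw [show π * (1 / 2) = π / 2 by ring, Real.sin_pi_div_two] at this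
      linarith
    · rw [show π * (1 / 2) = π / 2 by ring, Real.sin_pi_div_two, mul_one]
    · have := (law u (1 / 2) w (by norm_num) hlt hw.2).1
      rw [show π * (1 / 2) = π / 2 by ring, Real.sin_pi_div_two] at this
      linarith
  · intro u w hw
    have h1 := (law u w (w + 1 / 2) hw.1 (by linarith) (by linarith [hw.2])).2
    have h2 := (law u (1 / 2) (w + 1 / 2) (by norm_num) (by linarith [hw.1])
      (by linarith [hw.2])).1
    have hp := sin_pi_mul_pos (w := w + 1 / 2) ⟨by linarith [hw.1], by linarith [hw.2]⟩
    rw [add_sub_cancel_left] at h1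
    rw [← h2, ← add_assoc] at h1
    exact mul_left_cancel₀ hp.ne' h1

theorem IsInj.inner_chord_eq (h : γ.IsInj) {w : ℝ} (hw : w ∈ Ioo (0:ℝ) 1)
    (hc : ∀ᵐ u ∂volume.restrict (Ioc (0:ℝ) 1), gaussDerivU γ u w = 2 * π) (s t : ℝ) :
    ⟪γ.toFun (s + w) - γ.toFun s, γ.toFun (t + w) - γ.toFun t⟫ =
      ‖γ.toFun (s + w) - γ.toFun s‖ * ‖γ.toFun (t + w) - γ.toFun t‖ *
        cos (2 * π * (t - s)) := by
  rw [← h.cos_angle_chord_eq hw hc, mul_comm (_ * _), ← mul_assoc, mul_assoc,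
    cos_angle_mul_norm_mul_norm]

theorem IsInj.norm_chord_of_gaussDerivU (h : γ.IsInj)
    (hc : ∀ w ∈ Ioo (0:ℝ) 1, ∀ᵐ u ∂volume.restrict (Ioc (0:ℝ) 1), gaussDerivU γ u w = 2 * π)
    {w : ℝ} (hw : w ∈ Ioo (0:ℝ) (1 / 2)) (u : ℝ) :
    ‖γ.toFun (u + w + w) - γ.toFun (u + w)‖ = ‖γ.toFun (u + w) - γ.toFun u‖ := by
  have hw1 : w ∈ Ioo (0:ℝ) 1 := ⟨hw.1, by linarith [hw.2]⟩
  have hw2 : w + w ∈ Ioo (0:ℝ) 1 := ⟨by linarith [hw.1], by linarith [hw.2]⟩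
  have hs : sin (2 * π * w) ≠ 0 := by
    rw [show 2 * π * w = π * (w + w) by ring]
    exact (sin_pi_mul_pos hw2).ne'
  refine norm_add_eq_of_periodic (γ.isPrimitive_chord w).continuous (γ.periodic_chord w)
    (fun t => h.chord_ne_zero t hw1) (norm_mul_norm_add_eq (fun t => h.chord_ne_zero t hw1) hs
      (h.inner_chord_eq hw1 (hc w hw1)) fun s t => ?_) u
  have e : ∀ s, γ.toFun (s + w) - γ.toFun s + (γ.toFun (s + w + w) - γ.toFun (s + w)) =
      γ.toFun (s + (w + w)) - γ.toFun s := by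
    intro s
    rw [add_assoc]
    abel
  rw [e, e]
  exact h.inner_chord_eq hw2 (hc _ hw2) s t

theorem IsInj.norm_chord_two_mul (h : γ.IsInj)
    (hc : ∀ w ∈ Ioo (0:ℝ) 1, ∀ᵐ u ∂volume.restrict (Ioc (0:ℝ) 1), gaussDerivU γ u w = 2 * π)
    {w : ℝ} (hw : w ∈ Ioo (0:ℝ) (1 / 2)) (u : ℝ) :
    ‖γ.toFun (u + 2 * w) - γ.toFun u‖ / sin (π * (2 * w)) =
      ‖γ.toFun (u + w) - γ.toFun u‖ / sin (π * w) := by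
  have hw1 : w ∈ Ioo (0:ℝ) 1 := ⟨hw.1, by linarith [hw.2]⟩
  have hcos : 0 < cos (π * w) := Real.cos_pos_of_mem_Ioo
    ⟨by nlinarith [Real.pi_pos, hw.1], by nlinarith [Real.pi_pos, hw.2]⟩
  have hsin := sin_pi_mul_pos hw1
  have hN := h.norm_chord_of_gaussDerivU hc hw u
  have key : ‖γ.toFun (u + 2 * w) - γ.toFun u‖ =
      2 * cos (π * w) * ‖γ.toFun (u + w) - γ.toFun u‖ := by
    rw [← sq_eq_sq₀ (by positivity) (by positivity),
      show γ.toFun (u + 2 * w) - γ.toFun u = (γ.toFun (u + w) - γ.toFun u) +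
        (γ.toFun (u + w + w) - γ.toFun (u + w)) by rw [two_mul, ← add_assoc]; abel,
      norm_add_sq_real, h.inner_chord_eq hw1 (hc w hw1), hN, add_sub_cancel_left,
      mul_assoc 2 π, Real.cos_two_mul]
    ring
  rw [key, show π * (2 * w) = 2 * (π * w) by ring, Real.sin_two_mul]
  field_simp

theorem tendsto_norm_chord_div_sin {u : ℝ} {d : EuclideanSpace ℝ (Fin n)}
    (hd : HasDerivAt γ.toFun d u) :
    Tendsto (fun w => ‖γ.toFun (u + w) - γ.toFun u‖ / sin (π * w)) (𝓝[>] 0) (𝓝 (‖d‖ / π)) := by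
  have h1 := hd.tendsto_slope_zero_right.norm
  have h2 : HasDerivAt (fun w => sin (π * w)) π 0 := by
    simpa using ((hasDerivAt_id (0:ℝ)).const_mul π).sin
  have h3 := h2.tendsto_slope_zero_right
  refine (h1.div h3 Real.pi_ne_zero).congr' ?_
  filter_upwards [self_mem_nhdsWithin] with w hw
  have hw : 0 < w := hw
  simp only [Pi.div_apply, norm_smul, norm_inv, Real.norm_eq_abs, abs_of_pos hw, zero_add, mul_zero, Real.sin_zero,
    sub_zero, smul_eq_mul]
  exact mul_div_mul_left _ _ (inv_ne_zero hw.ne')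

theorem IsInj.norm_chord_eq_of_hasDerivAt (h : γ.IsInj)
    (hc : ∀ w ∈ Ioo (0:ℝ) 1, ∀ᵐ u ∂volume.restrict (Ioc (0:ℝ) 1), gaussDerivU γ u w = 2 * π)
    {u : ℝ} {d : EuclideanSpace ℝ (Fin n)} (hd : HasDerivAt γ.toFun d u) {w : ℝ}
    (hw : w ∈ Ioo (0:ℝ) 1) :
    ‖γ.toFun (u + w) - γ.toFun u‖ / sin (π * w) = ‖d‖ / π := by
  have hseq : ∀ m : ℕ, ‖γ.toFun (u + w * (1 / 2) ^ m) - γ.toFun u‖ / sin (π * (w * (1 / 2) ^ m)) =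
      ‖γ.toFun (u + w) - γ.toFun u‖ / sin (π * w) := by
    intro m
    induction m with
    | zero => simp
    | succ m ih =>
      have hle : (1 / 2 : ℝ) ^ m ≤ 1 := pow_le_one₀ (by norm_num) (by norm_num)
      have hpos : (0:ℝ) < (1 / 2) ^ m := by positivity
      rw [← ih, ← h.norm_chord_two_mul hc (w := w * (1 / 2) ^ (m + 1))
        ⟨mul_pos hw.1 (by positivity), by rw [pow_succ]; nlinarith [hw.1, hw.2]⟩]
      rw [show 2 * (w * (1 / 2) ^ (m + 1)) = w * (1 / 2) ^ m by ring]
  have ht : Tendsto (fun m : ℕ => w * (1 / 2 : ℝ) ^ m) atTop (𝓝[>] 0) := by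
    refine tendsto_nhdsWithin_iff.2 ⟨?_, Eventually.of_forall fun m =>
      mul_pos hw.1 (by positivity)⟩
    simpa using (tendsto_pow_atTop_nhds_zero_of_lt_one (r := (1 / 2 : ℝ)) (by norm_num)
      (by norm_num)).const_mul w
  have := (tendsto_norm_chord_div_sin hd).comp ht
  exact tendsto_nhds_unique (tendsto_const_nhds.congr fun m => (hseq m).symm) this

/-- Rigidity for `∂_u`. -/
theorem IsInj.hasCircularChords_of_gaussDerivU (h : γ.IsInj)
    (hc : ∀ w ∈ Ioo (0:ℝ) 1,
      ∀ᵐ u ∂volume.restrict (Ioc (0:ℝ) 1), gaussDerivU γ u w = 2 * π) :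
    ∃ K, γ.HasCircularChords K := by
  have hk : ∀ w ∈ Ioo (0:ℝ) 1, ∀ u,
      ‖γ.toFun (u + w) - γ.toFun u‖ / sin (π * w) = ‖γ.toFun (u + 1 / 2) - γ.toFun u‖ := by
    intro w hw
    have hae : ∀ᵐ u, ‖γ.toFun (u + w) - γ.toFun u‖ / sin (π * w) =
        ‖γ.toFun (u + 1 / 2) - γ.toFun u‖ := by
      filter_upwards [γ.isPrimitive.ae_hasDerivAt] with u hu
      have h2 := h.norm_chord_eq_of_hasDerivAt hc hu (w := 1 / 2) (by norm_num)
      rw [show π * (1 / 2) = π / 2 by ring, Real.sin_pi_div_two, div_one] at h2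
      rw [h.norm_chord_eq_of_hasDerivAt hc hu hw, h2]
    exact congrFun ((Continuous.ae_eq_iff_eq volume
      ((γ.isPrimitive_chord w).continuous.norm.div_const _)
      (γ.isPrimitive_chord (1 / 2)).continuous.norm).1 hae)
  refine h.hasCircularChords (k := fun u => ‖γ.toFun (u + 1 / 2) - γ.toFun u‖) ?_ ?_
  · intro u w hw
    rw [← hk w hw u, div_mul_cancel₀ _ (sin_pi_mul_pos hw).ne']
  · intro u w hw
    have hw1 : w ∈ Ioo (0:ℝ) 1 := ⟨hw.1, by linarith [hw.2]⟩
    rw [← hk w hw1, h.norm_chord_of_gaussDerivU hc hw, hk w hw1]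

end ClosedCurve

namespace ClosedCurve

variable {n : ℕ} {γ : ClosedCurve n}

/-- `γ` traverses a round circle once with constant speed. -/
def IsCircleParam (γ : ClosedCurve n) : Prop :=
  ∃ (m p q : EuclideanSpace ℝ (Fin n)) (r : ℝ), 0 < r ∧ ‖p‖ = r ∧ ‖q‖ = r ∧ ⟪p, q⟫ = 0 ∧
    ∀ t, γ.toFun t = m + (cos (2 * π * t) • p + sin (2 * π * t) • q)

theorem HasCircularChords.isCircleParam {K : ℝ} (h : γ.HasCircularChords K) :
    γ.IsCircleParam := by
  obtain ⟨hK, h⟩ := h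
  have hsq : ∀ s t, ‖γ.toFun s - γ.toFun t‖ ^ 2 = K ^ 2 / 2 * (1 - cos (2 * π * (s - t))) := by
    intro s t
    rw [h, mul_pow, sq_abs, Real.sin_sq_eq_half_sub, ← mul_assoc 2 π]
    ring
  have hin : ∀ s t, ⟪γ.toFun s - γ.toFun 0, γ.toFun t - γ.toFun 0⟫ =
      K ^ 2 / 4 * (1 - cos (2 * π * s) - cos (2 * π * t) + cos (2 * π * (s - t))) := by
    intro s t
    rw [real_inner_eq_norm_mul_self_add_norm_mul_self_sub_norm_sub_mul_self_div_two,
      sub_sub_sub_cancel_right, ← sq, ← sq, ← sq, hsq, hsq, hsq, sub_zero, sub_zero]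
    ring
  have c2 : cos (2 * π * (1 / 2)) = -1 := by rw [← Real.cos_pi]; ring_nf
  have c4 : cos (2 * π * (1 / 4)) = 0 := by rw [← Real.cos_pi_div_two]; ring_nf
  set y := γ.toFun (1 / 2) - γ.toFun 0 with hy
  set z := γ.toFun (1 / 4) - γ.toFun 0 with hz
  have hyy : ⟪y, y⟫ = K ^ 2 := by rw [hy, hin, c2, sub_self, mul_zero, Real.cos_zero]; ring
  have hzz : ⟪z, z⟫ = K ^ 2 / 2 := by rw [hz, hin, c4, sub_self, mul_zero, Real.cos_zero]; ring
  have hyz : ⟪y, z⟫ = K ^ 2 / 2 := by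
    rw [hy, hz, hin, c2, c4, show (1 / 2 - 1 / 4 : ℝ) = 1 / 4 by norm_num, c4]
    ring
  have hyn : ‖y‖ = K := by
    rw [real_inner_self_eq_norm_sq] at hyy
    exact (sq_eq_sq₀ (norm_nonneg _) hK.le).1 hyy
  refine ⟨γ.toFun 0 + (1 / 2 : ℝ) • y, -((1 / 2 : ℝ) • y), z - (1 / 2 : ℝ) • y, K / 2,
    by positivity, ?_, ?_, ?_, fun t => ?_⟩
  · rw [norm_neg, norm_smul, hyn]
    norm_num
    ring
  · rw [← sq_eq_sq₀ (norm_nonneg _) (by positivity), ← real_inner_self_eq_norm_sq]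
    simp only [inner_sub_left, inner_sub_right, real_inner_smul_left, real_inner_smul_right,
      real_inner_comm y z, hyy, hzz, hyz]
    ring
  · simp only [inner_neg_left, inner_sub_right, real_inner_smul_left, real_inner_smul_right,
      hyy, hyz]
    ring
  · set x := γ.toFun t - γ.toFun 0 with hx
    have hxx : ⟪x, x⟫ = K ^ 2 / 2 * (1 - cos (2 * π * t)) := by
      rw [hx, hin, sub_self, mul_zero, Real.cos_zero]
      ring
    have hxy : ⟪x, y⟫ = K ^ 2 / 2 * (1 - cos (2 * π * t)) := by
      rw [hx, hy, hin, c2, mul_sub, show 2 * π * (1 / 2) = π by ring, Real.cos_sub_pi]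
      ring
    have hxz : ⟪x, z⟫ = K ^ 2 / 4 * (1 - cos (2 * π * t) + sin (2 * π * t)) := by
      rw [hx, hz, hin, c4, mul_sub, show 2 * π * (1 / 4) = π / 2 by ring,
        Real.cos_sub_pi_div_two]
      ring
    have h0 : x - (((1 - cos (2 * π * t) - sin (2 * π * t)) / 2) • y +
        sin (2 * π * t) • z) = 0 := by
      rw [← inner_self_eq_zero (𝕜 := ℝ)]
      simp only [inner_sub_left, inner_sub_right, inner_add_left, inner_add_right,
        real_inner_smul_left, real_inner_smul_right, real_inner_comm x y, real_inner_comm x z,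
        real_inner_comm y z, hyy, hzz, hyz, hxx, hxy, hxz]
      have := Real.sin_sq_add_cos_sq (2 * π * t)
      linear_combination (-(K ^ 2 / 4)) * this
    rw [← sub_eq_zero, ← h0, hx]
    module

theorem norm_sq_add_smul {F : Type*} [NormedAddCommGroup F] [InnerProductSpace ℝ F] {p q : F}
    {r : ℝ} (hp : ‖p‖ = r) (hq : ‖q‖ = r) (hpq : ⟪p, q⟫ = 0) (a b : ℝ) :
    ‖a • p + b • q‖ ^ 2 = (a ^ 2 + b ^ 2) * r ^ 2 := by
  rw [norm_add_sq_real, real_inner_smul_left, real_inner_smul_right, hpq, norm_smul, norm_smul,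
    hp, hq, mul_pow, mul_pow, Real.norm_eq_abs, Real.norm_eq_abs, sq_abs, sq_abs]
  ring

theorem exists_cos_sin_eq {a b : ℝ} (h : a ^ 2 + b ^ 2 = 1) : ∃ t, cos t = a ∧ sin t = b := by
  have ha : -1 ≤ a ∧ a ≤ 1 := abs_le.1 ((sq_le_one_iff_abs_le_one a).1 (by nlinarith))
  rcases le_total 0 b with hb | hb
  · refine ⟨arccos a, Real.cos_arccos ha.1 ha.2, ?_⟩
    rw [Real.sin_arccos, show 1 - a ^ 2 = b ^ 2 by linarith, Real.sqrt_sq hb]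
  · refine ⟨-arccos a, by rw [Real.cos_neg, Real.cos_arccos ha.1 ha.2], ?_⟩
    rw [Real.sin_neg, Real.sin_arccos, show 1 - a ^ 2 = (-b) ^ 2 by linarith,
      Real.sqrt_sq (by linarith), neg_neg]

theorem isCircle_range {F : Type*} [NormedAddCommGroup F] [InnerProductSpace ℝ F] {m p q : F}
    {r : ℝ} (hr : 0 < r) (hp : ‖p‖ = r) (hq : ‖q‖ = r) (hpq : ⟪p, q⟫ = 0) :
    IsCircle (range fun t : ℝ => m + (cos (2 * π * t) • p + sin (2 * π * t) • q)) := by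
  refine ⟨m, r, Submodule.span ℝ (range ![p, q]), hr, ?_, ?_⟩
  · have hli : LinearIndependent ℝ ![p, q] := by
      rw [LinearIndependent.pair_iff]
      intro a b hab
      have := norm_sq_add_smul hp hq hpq a b
      rw [hab, norm_zero] at this
      have h0 : a ^ 2 + b ^ 2 = 0 := by
        rcases mul_eq_zero.1 (by linarith : (a ^ 2 + b ^ 2) * r ^ 2 = 0) with h | h
        · exact h
        · exact absurd h (by positivity)
      constructor <;> nlinarith [sq_nonneg a, sq_nonneg b]
    rw [finrank_span_eq_card hli, Fintype.card_fin]
  · ext x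
    simp only [Matrix.range_cons, Matrix.range_empty, union_empty, singleton_union,
      Submodule.mem_span_pair, mem_range, mem_ofPred_eq]
    constructor
    · rintro ⟨t, rfl⟩
      rw [add_sub_cancel_left]
      refine ⟨?_, _, _, rfl⟩
      rw [← sq_eq_sq₀ (norm_nonneg _) hr.le, norm_sq_add_smul hp hq hpq, Real.cos_sq_add_sin_sq,
        one_mul]
    · rintro ⟨hx, a, b, hab⟩
      have h1 := norm_sq_add_smul hp hq hpq a b
      rw [hab, hx] at h1
      obtain ⟨t, rfl, rfl⟩ := exists_cos_sin_eq (a := a) (b := b)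
        (mul_right_cancel₀ (pow_pos hr 2).ne' (by linarith))
      refine ⟨t / (2 * π), ?_⟩
      rw [mul_div_cancel₀ _ (by positivity), hab]
      abel

theorem hasDerivAt_circle {F : Type*} [NormedAddCommGroup F] [NormedSpace ℝ F] (m p q : F)
    (t : ℝ) : HasDerivAt (fun t : ℝ => m + (cos (2 * π * t) • p + sin (2 * π * t) • q))
      ((2 * π) • ((-sin (2 * π * t)) • p + cos (2 * π * t) • q)) t := by
  have h : HasDerivAt (fun t : ℝ => 2 * π * t) (2 * π) t := by
    simpa using (hasDerivAt_id t).const_mul (2 * π)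
  refine (((h.cos.smul_const p).add (h.sin.smul_const q)).const_add m).congr_deriv ?_
  module

theorem ae_deriv_eq {m p q : EuclideanSpace ℝ (Fin n)}
    (h : ∀ t, γ.toFun t = m + (cos (2 * π * t) • p + sin (2 * π * t) • q)) :
    ∀ᵐ t, γ.deriv' t = (2 * π) • ((-sin (2 * π * t)) • p + cos (2 * π * t) • q) := by
  filter_upwards [γ.isPrimitive.ae_hasDerivAt] with t ht
  rw [funext h] at ht
  exact ht.unique (hasDerivAt_circle m p q t)

theorem IsCircleParam.isCircle (h : γ.IsCircleParam) :
    IsCircle (range γ.toFun) ∧ ∃ c : ℝ, ∀ᵐ t, ‖γ.deriv' t‖ = c := by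
  obtain ⟨m, p, q, r, hr, hp, hq, hpq, h⟩ := h
  refine ⟨?_, 2 * π * r, ?_⟩
  · rw [funext h]
    exact isCircle_range hr hp hq hpq
  · filter_upwards [ae_deriv_eq h] with t ht
    rw [ht, ← sq_eq_sq₀ (norm_nonneg _) (by positivity), norm_smul, mul_pow,
      norm_sq_add_smul hp hq hpq, neg_sq, Real.sin_sq_add_cos_sq, Real.norm_eq_abs, sq_abs]
    ring

theorem angSpeed_smul_add {F : Type*} [NormedAddCommGroup F] [InnerProductSpace ℝ F] {T N : F}
    {r : ℝ} (hr : 0 < r) (hT : ‖T‖ = r) (hN : ‖N‖ = r) (hTN : ⟪T, N⟫ = 0) {a : ℝ} (ha : a ≠ 0)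
    (b c : ℝ) : angSpeed (a • T) (b • T + c • N) = |c| / |a| := by
  have : projPerp (a • T) (b • T + c • N) = c • N := by
    rw [projPerp, inner_add_right, real_inner_smul_left, real_inner_smul_left,
      real_inner_smul_right, real_inner_smul_right, hTN, real_inner_self_eq_norm_sq, hT,
      norm_smul, hT, mul_pow, Real.norm_eq_abs, sq_abs, smul_smul,
      show (a * (b * r ^ 2) + a * (c * 0)) / (a ^ 2 * r ^ 2) * a = b by field_simp; ring]
    abel
  rw [angSpeed, this, norm_smul, norm_smul, hT, hN, Real.norm_eq_abs, Real.norm_eq_abs,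
    mul_div_mul_right _ _ hr.ne']

theorem circle_chord_eq {F : Type*} [NormedAddCommGroup F] [NormedSpace ℝ F] (m p q : F)
    (u w : ℝ) :
    (m + (cos (2 * π * (u + w)) • p + sin (2 * π * (u + w)) • q)) -
      (m + (cos (2 * π * u) • p + sin (2 * π * u) • q)) =
    (2 * sin (π * w)) • ((-sin (π * (2 * u + w))) • p + cos (π * (2 * u + w)) • q) := by
  rw [show 2 * π * (u + w) = π * (2 * u + w) + π * w by ring,
    show 2 * π * u = π * (2 * u + w) - π * w by ring, Real.cos_add, Real.cos_sub, Real.sin_add,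
    Real.sin_sub]
  module

theorem circle_tangent_eq {F : Type*} [NormedAddCommGroup F] [NormedSpace ℝ F] (p q : F)
    (a x : ℝ) :
    (2 * π) • ((-sin (a + x)) • p + cos (a + x) • q) =
      (2 * π * cos x) • ((-sin a) • p + cos a • q) +
        (-(2 * π * sin x)) • (cos a • p + sin a • q) := by
  rw [Real.cos_add, Real.sin_add]
  module

theorem IsCircleParam.gaussDeriv_eq (h : γ.IsCircleParam) :
    (∀ u, ∀ᵐ w, w ∈ Ioc (0:ℝ) 1 → gaussDerivW γ u w = π) ∧
    ∀ w ∈ Ioo (0:ℝ) 1, ∀ᵐ u, gaussDerivU γ u w = 2 * π := by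
  obtain ⟨m, p, q, r, hr, hp, hq, hpq, h⟩ := h
  have hT : ∀ a : ℝ, ‖(-sin a) • p + cos a • q‖ = r := fun a => by
    rw [← sq_eq_sq₀ (norm_nonneg _) hr.le, norm_sq_add_smul hp hq hpq, neg_sq,
      Real.sin_sq_add_cos_sq, one_mul]
  have hN : ∀ a : ℝ, ‖cos a • p + sin a • q‖ = r := fun a => by
    rw [← sq_eq_sq₀ (norm_nonneg _) hr.le, norm_sq_add_smul hp hq hpq,
      Real.cos_sq_add_sin_sq, one_mul]
  have hTN : ∀ a : ℝ, ⟪(-sin a) • p + cos a • q, cos a • p + sin a • q⟫ = 0 := fun a => by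
    simp only [inner_add_left, inner_add_right, real_inner_smul_left, real_inner_smul_right,
      real_inner_comm p q, hpq, real_inner_self_eq_norm_sq, hp, hq]
    ring
  have hd := ae_deriv_eq h
  constructor
  · intro u
    filter_upwards [(measurePreserving_add_left volume u).quasiMeasurePreserving.ae hd,
      Measure.ae_ne volume 1] with w hw hw1 hwm
    have hs := sin_pi_mul_pos ⟨hwm.1, lt_of_le_of_ne hwm.2 hw1⟩
    rw [gaussDerivW_eq, hw, h, h, circle_chord_eq,
      show 2 * π * (u + w) = π * (2 * u + w) + π * w by ring, circle_tangent_eq,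
      angSpeed_smul_add hr (hT _) (hN _) (hTN _) (by positivity), abs_neg,
      abs_of_pos (by positivity), abs_of_pos (by positivity)]
    field_simp
  · intro w hw
    have hs := sin_pi_mul_pos hw
    filter_upwards [hd, (measurePreserving_add_right volume w).quasiMeasurePreserving.ae hd]
      with u hu huw
    rw [gaussDerivU_eq, huw, hu, h, h, circle_chord_eq,
      show 2 * π * (u + w) = π * (2 * u + w) + π * w by ring,
      show 2 * π * u = π * (2 * u + w) + -(π * w) by ring, circle_tangent_eq, circle_tangent_eq,
      Real.cos_neg, Real.sin_neg, add_sub_add_left_eq_sub, ← sub_smul]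
    have := angSpeed_smul_add hr (hT (π * (2 * u + w))) (hN _) (hTN _)
      (a := 2 * sin (π * w)) (by positivity) 0 (-(2 * (2 * π * sin (π * w))))
    rw [zero_smul, zero_add, abs_neg, abs_of_pos (by positivity), abs_of_pos (by positivity)]
      at this
    convert this using 1
    · ring_nf
    · field_simp

end ClosedCurve

section Lift

open Complex (I)

theorem IsPrimitive.comp_continuousLinearMap {E F : Type*} [NormedAddCommGroup E]
    [InnerProductSpace ℝ E] [CompleteSpace E] [NormedAddCommGroup F] [InnerProductSpace ℝ F]
    [CompleteSpace F] {D D' : ℝ → E} (h : IsPrimitive D D') (L : E →L[ℝ] F) :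
    IsPrimitive (fun t => L (D t)) (fun t => L (D' t)) := by
  refine ⟨fun a b => ⟨L.integrable_comp (h.intervalIntegrable a b).1,
    L.integrable_comp (h.intervalIntegrable a b).2⟩, fun t => ?_⟩
  rw [L.intervalIntegral_comp_comm (h.intervalIntegrable 0 t), h.eq_integral t, map_add]

/-- Angle function of an absolutely continuous curve on a circle. -/
theorem IsPrimitive.exists_angle {z z' : ℝ → ℂ} (h : IsPrimitive z z') {r c : ℝ} (hr : 0 < r)
    (hz : ∀ t, ‖z t‖ = r) (hc : ∀ᵐ t, ‖z' t‖ = c) :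
    ∃ θ κ : ℝ → ℝ, IsPrimitive θ κ ∧ θ 0 = 0 ∧ (∀ᵐ t, |κ t| = c / r) ∧
      ∀ t, z t = z 0 * Complex.exp (θ t * I) := by
  set κ : ℝ → ℝ := fun t => ((r ^ 2)⁻¹ * (starRingEnd ℂ (z t) * z' t)).im with hκ
  have hκi : ∀ a b, IntervalIntegrable κ volume a b := fun a b => by
    have := ((h.intervalIntegrable a b).continuousOn_mul
      (g := fun t => (((r ^ 2)⁻¹ : ℝ) : ℂ) * starRingEnd ℂ (z t))
      (continuous_const.mul (Complex.continuous_conj.comp h.continuous)).continuousOn)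
    simp only [mul_assoc] at this
    exact ⟨Complex.imCLM.integrable_comp this.1, Complex.imCLM.integrable_comp this.2⟩
  set θ : ℝ → ℝ := fun t => ∫ s in (0:ℝ)..t, κ s with hθ
  have hp : IsPrimitive θ κ := ⟨hκi, fun t => by simp [hθ]⟩
  have hzz : ∀ t, starRingEnd ℂ (z t) * z t = (r : ℂ) ^ 2 := fun t => by
    rw [← Complex.normSq_eq_conj_mul_self, Complex.normSq_eq_norm_sq, hz]
    push_cast
    rfl
  have hz' : ∀ᵐ t, z' t = κ t * I * z t := by
    filter_upwards [h.ae_hasDerivAt] with t ht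
    have h1 := ht.norm_sq
    simp only [hz] at h1
    have h2 : (starRingEnd ℂ (z t) * z' t).re = 0 := by
      have := h1.unique (hasDerivAt_const t (r ^ 2))
      rw [Complex.inner] at this
      rw [mul_comm (starRingEnd ℂ (z t))]
      linarith
    have h3 : starRingEnd ℂ (z t) * z' t = r ^ 2 * (κ t * I) := by
      apply Complex.ext
      · rw [h2]
        simp [← Complex.ofReal_pow]
      · have hr2 : r ^ 2 ≠ 0 := by positivity
        simp only [hκ, ← Complex.ofReal_pow, Complex.im_ofReal_mul, Complex.I_im, mul_one]
        field_simp
    have hrc : (r : ℂ) ^ 2 ≠ 0 := by exact_mod_cast (pow_pos hr 2).ne'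
    apply mul_left_cancel₀ hrc
    linear_combination (z t) * h3 - (z' t) * hzz t
  refine ⟨θ, κ, hp, by simp [hθ], ?_, fun t => ?_⟩
  · filter_upwards [hz', hc] with t h1 h2
    rw [h1, norm_mul, norm_mul, Complex.norm_I, mul_one, hz, Complex.norm_real,
      Real.norm_eq_abs] at h2
    rw [← h2, mul_div_cancel_right₀ _ hr.ne']
  · have hacz : AbsolutelyContinuousOnInterval z 0 t :=
      h.absolutelyContinuousOnInterval (C := 1) fun a _ b _ => by rw [dist_eq_norm, one_mul]
    have hace : AbsolutelyContinuousOnInterval (fun t => Complex.exp (-θ t * I)) 0 t := by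
      refine hp.absolutelyContinuousOnInterval (C := 1) fun a _ b _ => ?_
      rw [dist_eq_norm, one_mul, show Complex.exp (-θ a * I) - Complex.exp (-θ b * I) =
        Complex.exp ((-θ b : ℝ) * I) * (Complex.exp (I * (θ b - θ a : ℝ)) - 1) by
          rw [mul_sub, mul_one, ← Complex.exp_add]; push_cast; ring_nf,
        norm_mul, Complex.norm_exp_ofReal_mul_I, one_mul]
      exact Real.norm_exp_I_mul_ofReal_sub_one_le.trans_eq (norm_sub_rev _ _)
    obtain ⟨C, hC⟩ := (hacz.smul hace).const_of_ae_hasDerivAt_zero (by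
      filter_upwards [hz', h.ae_hasDerivAt, hp.ae_hasDerivAt] with s h1 h2 h3 _
      have h4 : HasDerivAt (fun t => Complex.exp (-θ t * I))
          (Complex.exp (-θ s * I) * (-κ s * I)) s :=
        ((h3.ofReal_comp.neg).mul_const I).cexp
      refine (h2.mul h4).congr_deriv ?_
      rw [h1]
      ring)
    have e := (hC t Set.right_mem_uIcc).trans (hC 0 Set.left_mem_uIcc).symm
    have h0 : θ 0 = 0 := by simp [hθ]
    simp only [Pi.smul_apply', smul_eq_mul, h0, Complex.ofReal_zero, neg_zero, zero_mul,
      Complex.exp_zero, mul_one] at e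
    rw [← e, mul_assoc, ← Complex.exp_add]
    simp

theorem IsPrimitive.eq_mul_of_monotoneOn {θ κ : ℝ → ℝ} (h : IsPrimitive θ κ) {ω : ℝ}
    (hω : ∀ᵐ t, |κ t| = ω) (hm : MonotoneOn θ (Ioo 0 1)) {t : ℝ} (ht : t ∈ Icc (0:ℝ) 1) :
    θ t = θ 0 + ω * t := by
  have hae : ∀ᵐ s, s ∈ uIoc 0 t → κ s = ω := by
    filter_upwards [hω, h.ae_hasDerivAt, Measure.ae_ne volume 1] with s h1 h2 h3 hs
    rw [uIoc_of_le ht.1] at hs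
    have hs1 : s ∈ Ioo (0:ℝ) 1 := ⟨hs.1, lt_of_le_of_ne (hs.2.trans ht.2) h3⟩
    have : 0 ≤ κ s := h2.hasDerivWithinAt.nonneg_of_monotoneOn
      (accPt_principal_iff_nhdsWithin.2 (by
        rw [sdiff_eq, nhdsWithin_inter_of_mem
          (mem_nhdsWithin_of_mem_nhds (Ioo_mem_nhds hs1.1 hs1.2))]
        infer_instance)) hm
    rw [← h1, abs_of_nonneg this]
  rw [h.eq_integral t, intervalIntegral.integral_congr_ae (g := fun _ => ω) hae]
  simp [mul_comm]

theorem IsPrimitive.eq_mul_of_injOn {θ κ : ℝ → ℝ} (h : IsPrimitive θ κ) {ω : ℝ}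
    (hω : ∀ᵐ t, |κ t| = ω) (hi : InjOn θ (Ioo 0 1)) :
    ∃ σ : ℝ, σ ^ 2 = 1 ∧ ∀ t ∈ Icc (0:ℝ) 1, θ t = θ 0 + σ * (ω * t) := by
  rcases h.continuous.continuousOn.strictMonoOn_of_injOn_Ioo one_pos hi with hm | hm
  · exact ⟨1, by norm_num, fun t ht => by rw [one_mul, h.eq_mul_of_monotoneOn hω hm.monotoneOn ht]⟩
  · refine ⟨-1, by norm_num, fun t ht => ?_⟩
    have hn : IsPrimitive (fun t => -θ t) (fun t => -κ t) :=
      h.comp_continuousLinearMap (-ContinuousLinearMap.id ℝ ℝ)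
    have := hn.eq_mul_of_monotoneOn (ω := ω) (by simpa using hω) hm.antitoneOn.neg ht
    linarith

theorem IsPrimitive.exists_eq_exp {z z' : ℝ → ℂ} (h : IsPrimitive z z') {r c : ℝ} (hr : 0 < r)
    (hc0 : 0 < c) (hz : ∀ t, ‖z t‖ = r) (hc : ∀ᵐ t, ‖z' t‖ = c) (hper : Function.Periodic z 1)
    (hinj : ∀ s t, z s = z t → ∃ k : ℤ, s - t = k) :
    ∃ σ : ℝ, σ ^ 2 = 1 ∧ ∀ t, z t = z 0 * Complex.exp ((σ * (2 * π * t) : ℝ) * I) := by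
  obtain ⟨θ, κ, hp, h0, hκ, hθ⟩ := h.exists_angle hr hz hc
  have hi : InjOn θ (Ioo 0 1) := by
    intro s hs t ht hst
    obtain ⟨k, hk⟩ := hinj s t (by rw [hθ s, hθ t, hst])
    have h1 : k < (1 : ℤ) := by exact_mod_cast (by rw [← hk]; linarith [hs.2, ht.1] : (k : ℝ) < 1)
    have h2 : (-1 : ℤ) < k := by
      exact_mod_cast (by rw [← hk]; linarith [hs.1, ht.2] : (-1 : ℝ) < k)
    have h3 : k = 0 := by omega
    rw [h3, Int.cast_zero] at hk
    linarith
  obtain ⟨σ, hσ, hlin⟩ := hp.eq_mul_of_injOn hκ hi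
  simp only [h0, zero_add] at hlin
  have hσ1 : |σ| = 1 :=
    (sq_eq_sq₀ (abs_nonneg σ) zero_le_one).1 (by rw [sq_abs, hσ, one_pow])
  have hexp : ∀ k : ℤ, Complex.exp (((σ * (2 * π * k) : ℝ) : ℂ) * I) = 1 := fun k => by
    rw [Complex.exp_eq_one_iff]
    rcases (abs_eq zero_le_one).1 hσ1 with rfl | rfl
    · exact ⟨k, by push_cast; ring⟩
    · exact ⟨-k, by push_cast; ring⟩
  have hz0 : z 0 ≠ 0 := norm_pos_iff.1 (by rw [hz]; exact hr)
  have hω0 : 0 < c / r := div_pos hc0 hr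
  have hω : c / r = 2 * π := by
    have h1 : Complex.exp (θ 1 * I) = 1 := by
      have := hθ 1
      rw [show z 1 = z 0 by simpa using hper 0] at this
      exact (mul_left_cancel₀ hz0 (this.symm.trans (mul_one _).symm))
    obtain ⟨k, hk⟩ := Complex.exp_eq_one_iff.1 h1
    have hk' : σ * (c / r) = k * (2 * π) := by
      have := hlin 1 (by simp)
      rw [mul_one] at this
      rw [← this]
      have h2 : (θ 1 : ℂ) = k * (2 * π) := by
        apply mul_right_cancel₀ Complex.I_ne_zero
        rw [hk]
        ring
      exact_mod_cast h2
    have hωk : c / r = |(k : ℝ)| * (2 * π) := by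
      rw [← abs_of_pos (a := 2 * π) (by positivity), ← abs_mul, ← hk', abs_mul,
        abs_of_pos hω0, hσ1, one_mul]
    have hkp : 0 < |(k : ℝ)| := by
      by_contra hk0
      have : |(k : ℝ)| = 0 := le_antisymm (not_lt.1 hk0) (abs_nonneg _)
      rw [this, zero_mul] at hωk
      exact hω0.ne' hωk
    have hk1 : (1 : ℝ) ≤ |(k : ℝ)| := by
      have : (0 : ℤ) < |k| := by exact_mod_cast hkp
      exact_mod_cast this
    have hm : 1 / |(k : ℝ)| ∈ Icc (0:ℝ) 1 := ⟨by positivity, (div_le_one hkp).2 hk1⟩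
    have hz1 : z (1 / |(k : ℝ)|) = z 0 := by
      have e : c / r * (1 / |(k : ℝ)|) = 2 * π := by rw [hωk]; field_simp
      have e1 := hexp 1
      rw [Int.cast_one, mul_one] at e1
      rw [hθ, hlin _ hm, e, e1, mul_one]
    obtain ⟨j, hj⟩ := hinj _ _ hz1
    rw [sub_zero] at hj
    have hj0 : (0 : ℤ) < j := by exact_mod_cast (by rw [← hj]; positivity : (0 : ℝ) < j)
    have hj1 : (1 : ℝ) ≤ j := by exact_mod_cast hj0
    have : |(k : ℝ)| = 1 := by
      refine le_antisymm ?_ hk1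
      rw [← hj, le_div_iff₀ hkp, one_mul] at hj1
      exact hj1
    rw [hωk, this, one_mul]
  refine ⟨σ, hσ, fun t => ?_⟩
  have hf : Int.fract t ∈ Icc (0:ℝ) 1 := ⟨Int.fract_nonneg t, (Int.fract_lt_one t).le⟩
  have h1 : z t = z (Int.fract t) := by
    conv_lhs => rw [← Int.fract_add_floor t]
    simpa using hper.int_mul ⌊t⌋ (Int.fract t)
  have h2 : σ * (2 * π * t) = σ * (2 * π * Int.fract t) + σ * (2 * π * ⌊t⌋) := by
    rw [← mul_add, ← mul_add, Int.fract_add_floor]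
  rw [h1, hθ, hlin _ hf, hω, h2, Complex.ofReal_add, add_mul, Complex.exp_add, hexp, mul_one]

end Lift

namespace ClosedCurve

variable {n : ℕ} {γ : ClosedCurve n}

theorem IsInj.isCircleParam (h : γ.IsInj) (hreg : γ.IsRegular) (hS : IsCircle (range γ.toFun))
    {c : ℝ} (hc : ∀ᵐ t, ‖γ.deriv' t‖ = c) : γ.IsCircleParam := by
  obtain ⟨m, r, V, hr, hV, hS⟩ := hS
  let J : ℂ ≃ₗᵢ[ℝ] V :=
    Complex.isometryOfOrthonormal ((stdOrthonormalBasis ℝ V).reindex (finCongr hV))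
  let L : EuclideanSpace ℝ (Fin n) →L[ℝ] ℂ :=
    (J.symm.toContinuousLinearEquiv : V →L[ℝ] ℂ).comp V.orthogonalProjectionOnto
  have hJL : ∀ v ∈ V, (J (L v) : EuclideanSpace ℝ (Fin n)) = v := fun v hv => by
    simp [L, Submodule.starProjection_eq_self_iff.2 hv]
  have hLn : ∀ v ∈ V, ‖L v‖ = ‖v‖ := fun v hv => by
    conv_rhs => rw [← hJL v hv]
    rw [← Submodule.coe_norm, J.norm_map]
  have hmem : ∀ t, ‖γ.toFun t - m‖ = r ∧ γ.toFun t - m ∈ V := fun t => by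
    have : γ.toFun t ∈ range γ.toFun := mem_range_self t
    rwa [hS] at this
  have hc0 : 0 < c := by
    obtain ⟨t, h1, h2⟩ := (hreg.and hc).exists
    rw [← h2]
    exact norm_pos_iff.2 h1
  have hp := (γ.isPrimitive.sub_const m).comp_continuousLinearMap L
  have hc' : ∀ᵐ t, ‖L (γ.deriv' t)‖ = c := by
    filter_upwards [(γ.isPrimitive.sub_const m).ae_hasDerivAt, hc] with t ht hct
    have hP := V.starProjection.hasFDerivAt.comp_hasDerivAt t ht
    have e : γ.deriv' t = V.starProjection (γ.deriv' t) := by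
      refine ht.unique (hP.congr_of_eventuallyEq (Filter.Eventually.of_forall fun s => ?_))
      exact (Submodule.starProjection_eq_self_iff.2 (hmem s).2).symm
    rw [hLn _ (Submodule.starProjection_eq_self_iff.1 e.symm), hct]
  obtain ⟨σ, hσ, hz⟩ := hp.exists_eq_exp hr hc0
    (fun t => by rw [hLn _ (hmem t).2, (hmem t).1]) hc'
    (fun t => by simp only [γ.periodic t])
    (fun s t hst => h s t (by
      have := congrArg (fun x => (J x : EuclideanSpace ℝ (Fin n))) hst
      simp only [hJL _ (hmem _).2] at this
      exact sub_left_injective this))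
  set z₀ := L (γ.toFun 0 - m) with hz₀
  have hz₀n : ‖z₀‖ = r := by rw [hLn _ (hmem 0).2, (hmem 0).1]
  have hσ1 : |σ| = 1 :=
    (sq_eq_sq₀ (abs_nonneg σ) zero_le_one).1 (by rw [sq_abs, hσ, one_pow])
  refine ⟨m, J z₀, J (σ * z₀ * Complex.I), r, hr, ?_, ?_, ?_, fun t => ?_⟩
  · rw [← Submodule.coe_norm, J.norm_map, hz₀n]
  · rw [← Submodule.coe_norm, J.norm_map, norm_mul, norm_mul, Complex.norm_I, mul_one, hz₀n,
      Complex.norm_real, Real.norm_eq_abs, hσ1, one_mul]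
  · rw [← Submodule.coe_inner, J.inner_map_map, Complex.inner]
    simp
    ring
  · rw [← sub_eq_iff_eq_add', ← hJL _ (hmem t).2, hz t, ← Submodule.coe_smul, ← Submodule.coe_smul,
      ← Submodule.coe_add, ← J.map_smul, ← J.map_smul, ← J.map_add]
    congr 2
    have hcos : cos (σ * (2 * π * t)) = cos (2 * π * t) := by
      rcases (abs_eq zero_le_one).1 hσ1 with rfl | rfl <;> simp
    have hsin : sin (σ * (2 * π * t)) = σ * sin (2 * π * t) := by
      rcases (abs_eq zero_le_one).1 hσ1 with rfl | rfl <;> simp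
    rw [Complex.exp_mul_I, ← Complex.ofReal_cos, ← Complex.ofReal_sin, hcos, hsin,
      Complex.real_smul, Complex.real_smul]
    push_cast
    ring

end ClosedCurve

/-- **Jensen-type lower bounds for convex integrands** (Lemma 4.1): for convex increasing
`f : [0,∞) → [0,∞)`, (a) `∫₀¹ f(|∂_w φ_γ|) dw ≥ f(π)` for a.e. `u` and
(b) `∫₀¹ f(|∂_u φ_γ|) du ≥ f(2π)` for all `w ∈ (0,1)`, with equality in both when the
image of `γ` is a circle parametrized with constant speed; if `f` is strictly convex and
(a) holds with equality a.e. or (b) holds with equality for all `w`, then the image of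
`γ` is a circle parametrized with constant speed. -/
theorem convex_integrand_bounds {n : ℕ} (f : ℝ → ℝ) (hf : ConvexOn ℝ (Set.Ici 0) f)
    (hmono : MonotoneOn f (Set.Ici 0)) (hpos : ∀ x ∈ Set.Ici (0:ℝ), 0 ≤ f x)
    (γ : ClosedCurve n) (hinj : γ.IsInj) (hreg : γ.IsRegular) :
    (∀ᵐ u : ℝ ∂volume, ENNReal.ofReal (f π) ≤
      ∫⁻ w in Set.Ioc (0:ℝ) 1, ENNReal.ofReal (f (gaussDerivW γ u w))) ∧
    (∀ w ∈ Set.Ioo (0:ℝ) 1, ENNReal.ofReal (f (2 * π)) ≤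
      ∫⁻ u in Set.Ioc (0:ℝ) 1, ENNReal.ofReal (f (gaussDerivU γ u w))) ∧
    ((IsCircle (Set.range γ.toFun) ∧ ∃ c : ℝ, ∀ᵐ t : ℝ ∂volume, ‖γ.deriv' t‖ = c) →
      (∀ᵐ u : ℝ ∂volume,
        (∫⁻ w in Set.Ioc (0:ℝ) 1, ENNReal.ofReal (f (gaussDerivW γ u w))) =
          ENNReal.ofReal (f π)) ∧
      (∀ w ∈ Set.Ioo (0:ℝ) 1,
        (∫⁻ u in Set.Ioc (0:ℝ) 1, ENNReal.ofReal (f (gaussDerivU γ u w))) =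
          ENNReal.ofReal (f (2 * π)))) ∧
    (StrictConvexOn ℝ (Set.Ici 0) f →
      ((∀ᵐ u : ℝ ∂volume,
          (∫⁻ w in Set.Ioc (0:ℝ) 1, ENNReal.ofReal (f (gaussDerivW γ u w))) =
            ENNReal.ofReal (f π)) ∨
       (∀ w ∈ Set.Ioo (0:ℝ) 1,
          (∫⁻ u in Set.Ioc (0:ℝ) 1, ENNReal.ofReal (f (gaussDerivU γ u w))) =
            ENNReal.ofReal (f (2 * π)))) →
      IsCircle (Set.range γ.toFun) ∧ ∃ c : ℝ, ∀ᵐ t : ℝ ∂volume, ‖γ.deriv' t‖ = c) := by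
  have haeW : ∀ᵐ u : ℝ, HasDerivAt γ.toFun (γ.deriv' u) u ∧ γ.deriv' u ≠ 0 :=
    γ.isPrimitive.ae_hasDerivAt.and hreg
  refine ⟨?_, fun w hw => ?_, ?_, fun hstrict heq => ?_⟩
  · filter_upwards [haeW] with u hu
    exact hf.ofReal_le_lintegral hmono hpos Real.pi_pos
      (fun w => by rw [γ.gaussDerivW_eq]; exact angSpeed_nonneg _ _)
      (hinj.ofReal_pi_le hu.1 hu.2)
  · exact hf.ofReal_le_lintegral hmono hpos Real.two_pi_pos
      (fun u => by rw [γ.gaussDerivU_eq]; exact angSpeed_nonneg _ _)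
      (hinj.ofReal_two_pi_le hw)
  · rintro ⟨hS, c, hc⟩
    obtain ⟨hW, hU⟩ := (hinj.isCircleParam hreg hS hc).gaussDeriv_eq
    refine ⟨Filter.Eventually.of_forall fun u => ?_, fun w hw => ?_⟩
    · rw [setLIntegral_congr_fun_ae (g := fun _ => ENNReal.ofReal (f π)) measurableSet_Ioc
        ((hW u).mono fun w h hw => by simp only [h hw])]
      simp
    · rw [lintegral_congr_ae (g := fun _ => ENNReal.ofReal (f (2 * π)))
        ((ae_restrict_of_ae (hU w hw)).mono fun u h => by simp only [h])]
      simp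
  · refine ClosedCurve.IsCircleParam.isCircle ?_
    rcases heq with heq | heq
    · obtain ⟨K, hK⟩ := hinj.hasCircularChords_of_gaussDerivW hreg (by
        filter_upwards [haeW, heq] with u hu he
        exact hstrict.ae_eq_of_lintegral_eq hmono hpos Real.pi_pos
          (fun w => by rw [γ.gaussDerivW_eq]; exact angSpeed_nonneg _ _)
          (γ.aemeasurable_gaussDerivW u) (hinj.ofReal_pi_le hu.1 hu.2) he)
      exact hK.isCircleParam
    · obtain ⟨K, hK⟩ := hinj.hasCircularChords_of_gaussDerivU fun w hw =>
        hstrict.ae_eq_of_lintegral_eq hmono hpos Real.two_pi_pos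
          (fun u => by rw [γ.gaussDerivU_eq]; exact angSpeed_nonneg _ _)
          (γ.aemeasurable_gaussDerivU w) (hinj.ofReal_two_pi_le hw) (heq w hw)
      exact hK.isCircleParam

end
end
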